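/- arXiv:1505.06183 — 5 statements merged into one kernel-verified Lean document; each statement's English description precedes it below -/
import Mathlib

section
/- There exists a constant C > 0 depending only on n and γ such that for every λ > 0, every σ ∈ ℝⁿ, every point x = (x̄, x_N) ∈ ℝ^N_+ and every m ∈ {0,1,2}, the m-th derivative of W_{λ,σ} in the tangential variable x̄ satisfies |∇_{x̄}^m W_{λ,σ}(x)| ≤ C λ^{(n-2γ)/2} / (λ^{n-2γ+m} + |x-(σ,0)|^{n-2γ+m}). -/
open MeasureTheory Real Filter Topology

noncomputable section

/-- The constant `c_{n,γ}` in the definition of the standard bubble. -/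
def cng (n : ℕ) (γ : ℝ) : ℝ :=
  2 ^ (((n : ℝ) - 2 * γ) / 2) *
    (Real.Gamma (((n : ℝ) + 2 * γ) / 2) / Real.Gamma (((n : ℝ) - 2 * γ) / 2)) ^
      (((n : ℝ) - 2 * γ) / (4 * γ))

/-- The constant `p_{n,γ}` in the Poisson kernel. -/
def png (n : ℕ) (γ : ℝ) : ℝ :=
  Real.Gamma (((n : ℝ) + 2 * γ) / 2) / (Real.pi ^ ((n : ℝ) / 2) * Real.Gamma γ)

/-- The bubble `w_{λ,σ}` on `ℝⁿ`. -/
def bubble (n : ℕ) (γ lam : ℝ) (σ : EuclideanSpace ℝ (Fin n))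
    (x : EuclideanSpace ℝ (Fin n)) : ℝ :=
  cng n γ * (lam / (lam ^ 2 + ‖x - σ‖ ^ 2)) ^ (((n : ℝ) - 2 * γ) / 2)

/-- The extension `W_{λ,σ}` of the bubble to the upper half space, given by
convolution with the Poisson kernel. -/
def bubbleExt (n : ℕ) (γ lam : ℝ) (σ : EuclideanSpace ℝ (Fin n))
    (x : EuclideanSpace ℝ (Fin n)) (xN : ℝ) : ℝ :=
  png n γ * ∫ ξ : EuclideanSpace ℝ (Fin n),
    xN ^ (2 * γ) / (‖x - ξ‖ ^ 2 + xN ^ 2) ^ (((n : ℝ) + 2 * γ) / 2) * bubble n γ lam σ ξ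


/-- The parallel sum `s t / (s + t)`: the convolution of `exp (-s |·|²)` and `exp (-t |·|²)` is a
multiple of the Gaussian `exp (-(s t / (s + t)) |·|²)`. -/
def parallelSum (z : ℝ × ℝ) : ℝ := z.1 * z.2 / (z.1 + z.2)

/-- Lebesgue measure on the open positive quadrant. -/
def quadrantMeasure : Measure (ℝ × ℝ) :=
  (volume.restrict (Set.Ioi 0)).prod (volume.restrict (Set.Ioi 0))

/-- The density with which Gaussians are superposed to give the extended bubble. -/
def subordinationWeight (n : ℕ) (γ lam xN : ℝ) (z : ℝ × ℝ) : ℝ :=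
  z.2 ^ (((n : ℝ) - 2 * γ) / 2 - 1) * z.1 ^ (((n : ℝ) + 2 * γ) / 2 - 1) *
    exp (-(z.1 * xN ^ 2) - z.2 * lam ^ 2) * (π / (z.1 + z.2)) ^ ((n : ℝ) / 2)

lemma rpow_mul_exp_neg_half_le {p z : ℝ} (hp : 0 < p) (hz : 0 ≤ z) :
    z ^ p * exp (-(z / 2)) ≤ (2 * p) ^ p := by
  have h1 : z / (2 * p) ≤ exp (z / (2 * p)) := by
    linarith [add_one_le_exp (z / (2 * p))]
  have h2 : z ≤ 2 * p * exp (z / (2 * p)) := by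
    rw [div_le_iff₀ (by positivity)] at h1
    linarith
  have h3 : z ^ p ≤ (2 * p) ^ p * exp (z / 2) := by
    calc z ^ p ≤ (2 * p * exp (z / (2 * p))) ^ p := rpow_le_rpow hz h2 hp.le
      _ = (2 * p) ^ p * exp (z / 2) := by
        rw [mul_rpow (by positivity) (exp_pos _).le, ← exp_mul]
        congr 2
        field_simp
  calc z ^ p * exp (-(z / 2)) ≤ (2 * p) ^ p * exp (z / 2) * exp (-(z / 2)) := by gcongr
    _ = (2 * p) ^ p := by rw [mul_assoc, ← exp_add]; simp

lemma integrable_and_integral_rpow_mul_min_rpow {γ p T : ℝ} (hγ : 0 < γ) (hp : γ < p) (hT : 0 < T) :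
    IntegrableOn (fun t : ℝ => t ^ (-γ - 1) * min t T ^ p) (Set.Ioi 0) ∧
      ∫ t in Set.Ioi 0, t ^ (-γ - 1) * min t T ^ p = T ^ (p - γ) * (1 / (p - γ) + 1 / γ) := by
  have e1 : Set.EqOn (fun t : ℝ => t ^ (p - γ - 1)) (fun t : ℝ => t ^ (-γ - 1) * min t T ^ p)
      (Set.Ioc 0 T) := by
    intro t ht
    simp only
    rw [min_eq_left ht.2, ← rpow_add ht.1]
    congr 1
    ring
  have e2 : Set.EqOn (fun t : ℝ => t ^ (-γ - 1) * T ^ p) (fun t : ℝ => t ^ (-γ - 1) * min t T ^ p)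
      (Set.Ioi T) := by
    intro t ht
    simp only
    rw [min_eq_right (le_of_lt ht)]
  have i1 : IntegrableOn (fun t : ℝ => t ^ (-γ - 1) * min t T ^ p) (Set.Ioc 0 T) := by
    refine IntegrableOn.congr_fun ?_ e1 measurableSet_Ioc
    exact (intervalIntegrable_iff_integrableOn_Ioc_of_le hT.le).1
      (intervalIntegral.intervalIntegrable_rpow' (by linarith))
  have i2 : IntegrableOn (fun t : ℝ => t ^ (-γ - 1) * min t T ^ p) (Set.Ioi T) := by
    refine IntegrableOn.congr_fun ?_ e2 measurableSet_Ioi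
    exact (integrableOn_Ioi_rpow_of_lt (by linarith) hT).mul_const _
  have hU : Set.Ioi (0 : ℝ) = Set.Ioc 0 T ∪ Set.Ioi T := (Set.Ioc_union_Ioi_eq_Ioi hT.le).symm
  refine ⟨hU ▸ i1.union i2, ?_⟩
  rw [hU, setIntegral_union (Set.Ioc_disjoint_Ioi le_rfl) measurableSet_Ioi i1 i2,
    ← setIntegral_congr_fun measurableSet_Ioc e1, ← setIntegral_congr_fun measurableSet_Ioi e2,
    ← intervalIntegral.integral_of_le hT.le, integral_rpow (Or.inl (by linarith)),
    integral_mul_const, integral_Ioi_rpow_of_lt (by linarith) hT,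
    zero_rpow (by linarith : p - γ - 1 + 1 ≠ 0)]
  have h3 : T ^ (-γ - 1 + 1) * T ^ p = T ^ (p - γ) := by
    rw [← rpow_add hT]; congr 1; ring
  have h4 : p - γ - 1 + 1 = p - γ := by ring
  have h5 : -T ^ (-γ - 1 + 1) / (-γ - 1 + 1) * T ^ p = T ^ (p - γ) / γ := by
    rw [← h3]
    have : -γ - 1 + 1 = -γ := by ring
    rw [this]
    field_simp
  rw [h4, h5]
  ring

lemma parallelSum_le_fst {z : ℝ × ℝ} (h1 : 0 < z.1) (h2 : 0 < z.2) : parallelSum z ≤ z.1 := by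
  unfold parallelSum
  rw [div_le_iff₀ (by positivity)]
  nlinarith [sq_nonneg z.1]

lemma parallelSum_le_snd {z : ℝ × ℝ} (h1 : 0 < z.1) (h2 : 0 < z.2) : parallelSum z ≤ z.2 := by
  unfold parallelSum
  rw [div_le_iff₀ (by positivity)]
  nlinarith [sq_nonneg z.2]

lemma parallelSum_pos {z : ℝ × ℝ} (h1 : 0 < z.1) (h2 : 0 < z.2) : 0 < parallelSum z := by
  unfold parallelSum
  positivity

lemma subordinationWeight_nonneg {n : ℕ} {γ lam xN : ℝ} {z : ℝ × ℝ} (h1 : 0 < z.1)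
    (h2 : 0 < z.2) : 0 ≤ subordinationWeight n γ lam xN z := by
  unfold subordinationWeight
  positivity

lemma subordinationWeight_mul_le {n : ℕ} (hn : 0 < n) (γ lam xN : ℝ) (hlam : 0 < lam) (j : ℕ)
    {ρ : ℝ} (hρ : 0 ≤ ρ) {z : ℝ × ℝ} (h1 : 0 < z.1) (h2 : 0 < z.2) :
    subordinationWeight n γ lam xN z * parallelSum z ^ j * exp (-(parallelSum z * ρ)) ≤
      π ^ ((n : ℝ) / 2) * ((n : ℝ) + 2 * j) ^ ((n : ℝ) / 2 + j) *
        (z.1 ^ (γ - 1) * exp (-(xN ^ 2 / 2 * z.1)) *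
          (z.2 ^ (-γ - 1) * min z.2 (1 / (lam ^ 2 + xN ^ 2 + ρ)) ^ ((n : ℝ) / 2 + j))) := by
  have hn' : (1 : ℝ) ≤ n := by exact_mod_cast hn
  set p : ℝ := (n : ℝ) / 2 + j with hp
  have hp0 : 0 < p := by positivity
  have hK : (n : ℝ) + 2 * j = 2 * p := by rw [hp]; ring
  have hK1 : 1 ≤ 2 * p := by rw [← hK]; linarith [(Nat.cast_nonneg j : (0 : ℝ) ≤ j)]
  have hκ0 := parallelSum_pos h1 h2
  have hκ1 := parallelSum_le_fst h1 h2
  have hκ2 := parallelSum_le_snd h1 h2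
  set R : ℝ := lam ^ 2 + xN ^ 2 + ρ with hR
  have hR0 : 0 < R := by positivity
  have hexp : exp (-(z.1 * xN ^ 2) - z.2 * lam ^ 2) * exp (-(parallelSum z * ρ)) ≤
      exp (-(xN ^ 2 / 2 * z.1)) * exp (-(parallelSum z * R / 2)) := by
    rw [← exp_add, ← exp_add]
    apply exp_le_exp.2
    rw [hR]
    nlinarith [mul_nonneg (sub_nonneg.2 hκ1) (sq_nonneg xN),
      mul_nonneg (sub_nonneg.2 hκ2) (sq_nonneg lam), mul_nonneg hκ0.le hρ,
      mul_nonneg h2.le (sq_nonneg lam)]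
  have halg : z.2 ^ (((n : ℝ) - 2 * γ) / 2 - 1) * z.1 ^ (((n : ℝ) + 2 * γ) / 2 - 1) *
      (π / (z.1 + z.2)) ^ ((n : ℝ) / 2) * parallelSum z ^ j =
      π ^ ((n : ℝ) / 2) * (z.1 ^ (γ - 1) * z.2 ^ (-γ - 1) * parallelSum z ^ p) := by
    have e1 : ((n : ℝ) - 2 * γ) / 2 - 1 = (-γ - 1) + n / 2 := by ring
    have e2 : ((n : ℝ) + 2 * γ) / 2 - 1 = (γ - 1) + n / 2 := by ring
    have e3 : parallelSum z ^ ((n : ℝ) / 2) =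
        z.1 ^ ((n : ℝ) / 2) * z.2 ^ ((n : ℝ) / 2) / (z.1 + z.2) ^ ((n : ℝ) / 2) := by
      unfold parallelSum
      rw [div_rpow (by positivity) (by positivity), mul_rpow h1.le h2.le]
    rw [e1, e2, rpow_add h1, rpow_add h2, hp, rpow_add hκ0, rpow_natCast, e3,
      div_rpow pi_pos.le (by positivity)]
    ring
  have hmin : parallelSum z ^ p * exp (-(parallelSum z * R / 2)) ≤
      (2 * p) ^ p * min z.2 (1 / R) ^ p := by
    rcases le_total z.2 (1 / R) with h | h
    · rw [min_eq_left h]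
      have a1 : exp (-(parallelSum z * R / 2)) ≤ 1 := exp_le_one_iff.2 (by
        have := mul_pos hκ0 hR0
        linarith)
      have a2 : parallelSum z ^ p ≤ z.2 ^ p := rpow_le_rpow hκ0.le hκ2 hp0.le
      have a3 : 1 ≤ (2 * p) ^ p := one_le_rpow hK1 hp0.le
      calc _ ≤ z.2 ^ p * 1 := by gcongr
        _ = 1 * z.2 ^ p := by ring
        _ ≤ _ := by gcongr
    · rw [min_eq_right h]
      have := rpow_mul_exp_neg_half_le hp0 (mul_pos hκ0 hR0).le
      rw [mul_rpow hκ0.le hR0.le] at this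
      rw [div_rpow zero_le_one hR0.le, one_rpow, mul_one_div,
        le_div_iff₀ (by positivity)]
      linarith
  rw [hK]
  calc subordinationWeight n γ lam xN z * parallelSum z ^ j * exp (-(parallelSum z * ρ))
      = (z.2 ^ (((n : ℝ) - 2 * γ) / 2 - 1) * z.1 ^ (((n : ℝ) + 2 * γ) / 2 - 1) *
        (π / (z.1 + z.2)) ^ ((n : ℝ) / 2) * parallelSum z ^ j) *
        (exp (-(z.1 * xN ^ 2) - z.2 * lam ^ 2) * exp (-(parallelSum z * ρ))) := by
        unfold subordinationWeight; ring
    _ ≤ (π ^ ((n : ℝ) / 2) * (z.1 ^ (γ - 1) * z.2 ^ (-γ - 1) * parallelSum z ^ p)) *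
        (exp (-(xN ^ 2 / 2 * z.1)) * exp (-(parallelSum z * R / 2))) := by
        rw [halg]
        have := parallelSum_pos h1 h2
        gcongr
    _ = (π ^ ((n : ℝ) / 2) * (z.1 ^ (γ - 1) * z.2 ^ (-γ - 1)) * exp (-(xN ^ 2 / 2 * z.1))) *
        (parallelSum z ^ p * exp (-(parallelSum z * R / 2))) := by ring
    _ ≤ (π ^ ((n : ℝ) / 2) * (z.1 ^ (γ - 1) * z.2 ^ (-γ - 1)) * exp (-(xN ^ 2 / 2 * z.1))) *
        ((2 * p) ^ p * min z.2 (1 / R) ^ p) := by gcongr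
    _ = _ := by ring

lemma ae_quadrantMeasure : ∀ᵐ z ∂quadrantMeasure, 0 < z.1 ∧ 0 < z.2 := by
  unfold quadrantMeasure
  rw [Measure.prod_restrict]
  filter_upwards [ae_restrict_mem (measurableSet_Ioi.prod measurableSet_Ioi)] with z hz
  exact hz

@[fun_prop]
lemma measurable_parallelSum : Measurable parallelSum := by
  unfold parallelSum
  fun_prop

@[fun_prop]
lemma measurable_subordinationWeight (n : ℕ) (γ lam xN : ℝ) :
    Measurable (subordinationWeight n γ lam xN) := by
  unfold subordinationWeight
  fun_prop

/-- The superposition of Gaussians `exp (-κ ρ)`, `κ = parallelSum z`, with density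
`subordinationWeight` times `κ ^ j`. -/
def gaussianMoment (n : ℕ) (γ lam xN : ℝ) (j : ℕ) (ρ : ℝ) : ℝ :=
  ∫ z, subordinationWeight n γ lam xN z * parallelSum z ^ j * exp (-(parallelSum z * ρ))
    ∂quadrantMeasure

lemma gaussianMoment_bound {n : ℕ} (hn : 0 < n) {γ : ℝ} (hγ : 0 < γ) (hnγ : 2 * γ < n) (j : ℕ) :
    ∃ C, 0 < C ∧ ∀ lam xN ρ : ℝ, 0 < lam → 0 < xN → 0 ≤ ρ →
      Integrable (fun z => subordinationWeight n γ lam xN z * parallelSum z ^ j *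
        exp (-(parallelSum z * ρ))) quadrantMeasure ∧
      0 ≤ gaussianMoment n γ lam xN j ρ ∧
      xN ^ (2 * γ) * gaussianMoment n γ lam xN j ρ ≤
        C * √(lam ^ 2 + xN ^ 2 + ρ) ^ (-((n : ℝ) - 2 * γ + 2 * j)) := by
  set p : ℝ := (n : ℝ) / 2 + j with hp
  have hj : (0 : ℝ) ≤ j := Nat.cast_nonneg j
  have hpγ : γ < p := by rw [hp]; linarith
  have hn' : (0 : ℝ) < n := by exact_mod_cast hn
  have hp0 : 0 < p := by linarith
  have hG := Gamma_pos_of_pos hγ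
  have hpγ' : 0 < p - γ := by linarith
  refine ⟨π ^ ((n : ℝ) / 2) * ((n : ℝ) + 2 * j) ^ p *
    (2 ^ γ * Gamma γ * (1 / (p - γ) + 1 / γ)), by positivity, ?_⟩
  intro lam xN ρ hlam hxN hρ
  set R : ℝ := lam ^ 2 + xN ^ 2 + ρ with hR
  have hR0 : 0 < R := by positivity
  have hX : 0 < xN ^ 2 / 2 := by positivity
  have hGint := integral_rpow_mul_exp_neg_mul_Ioi hγ hX
  have hA : IntegrableOn (fun s : ℝ => s ^ (γ - 1) * exp (-(xN ^ 2 / 2 * s))) (Set.Ioi 0) := by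
    refine Integrable.of_integral_ne_zero ?_
    rw [hGint]
    positivity
  obtain ⟨hB, hBint⟩ := integrable_and_integral_rpow_mul_min_rpow hγ hpγ
    (one_div_pos.2 hR0)
  have hAB := (hA.mul_prod hB).const_mul (π ^ ((n : ℝ) / 2) * ((n : ℝ) + 2 * j) ^ p)
  have hle : ∀ᵐ z ∂quadrantMeasure,
      subordinationWeight n γ lam xN z * parallelSum z ^ j * exp (-(parallelSum z * ρ)) ≤
      π ^ ((n : ℝ) / 2) * ((n : ℝ) + 2 * j) ^ p *
        (z.1 ^ (γ - 1) * exp (-(xN ^ 2 / 2 * z.1)) *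
          (z.2 ^ (-γ - 1) * min z.2 (1 / R) ^ p)) := by
    filter_upwards [ae_quadrantMeasure] with z hz
    exact subordinationWeight_mul_le hn γ lam xN hlam j hρ hz.1 hz.2
  have hnn : ∀ᵐ z ∂quadrantMeasure, 0 ≤
      subordinationWeight n γ lam xN z * parallelSum z ^ j * exp (-(parallelSum z * ρ)) := by
    filter_upwards [ae_quadrantMeasure] with z hz
    have h1 := parallelSum_pos hz.1 hz.2
    have h2 := subordinationWeight_nonneg (n := n) (γ := γ) (lam := lam) (xN := xN) hz.1 hz.2
    positivity
  have hint : Integrable (fun z => subordinationWeight n γ lam xN z * parallelSum z ^ j *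
      exp (-(parallelSum z * ρ))) quadrantMeasure := by
    refine Integrable.mono' hAB (Measurable.aestronglyMeasurable (by fun_prop)) ?_
    filter_upwards [hle, hnn] with z h1 h2
    rwa [norm_of_nonneg h2]
  refine ⟨hint, integral_nonneg_of_ae hnn, ?_⟩
  have hI : gaussianMoment n γ lam xN j ρ ≤ π ^ ((n : ℝ) / 2) * ((n : ℝ) + 2 * j) ^ p *
      ((1 / (xN ^ 2 / 2)) ^ γ * Gamma γ * ((1 / R) ^ (p - γ) * (1 / (p - γ) + 1 / γ))) := by
    refine (integral_mono_ae hint hAB hle).trans_eq ?_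
    unfold quadrantMeasure
    rw [integral_const_mul, integral_prod_mul (fun s : ℝ => s ^ (γ - 1) * exp (-(xN ^ 2 / 2 * s)))
      (fun t : ℝ => t ^ (-γ - 1) * min t (1 / R) ^ p), hGint, hBint]
  have e1 : xN ^ (2 * γ) * (1 / (xN ^ 2 / 2)) ^ γ = 2 ^ γ := by
    rw [rpow_mul hxN.le, ← mul_rpow (by positivity) (by positivity)]
    congr 1
    norm_num
    field_simp
  have e2 : (1 / R) ^ (p - γ) = √R ^ (-((n : ℝ) - 2 * γ + 2 * j)) := by
    rw [sqrt_eq_rpow, ← rpow_mul hR0.le, one_div, ← rpow_neg_one, ← rpow_mul hR0.le, hp]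
    congr 1
    ring
  calc xN ^ (2 * γ) * gaussianMoment n γ lam xN j ρ
      ≤ xN ^ (2 * γ) * (π ^ ((n : ℝ) / 2) * ((n : ℝ) + 2 * j) ^ p *
      ((1 / (xN ^ 2 / 2)) ^ γ * Gamma γ * ((1 / R) ^ (p - γ) * (1 / (p - γ) + 1 / γ)))) := by
        gcongr
    _ = (xN ^ (2 * γ) * (1 / (xN ^ 2 / 2)) ^ γ) * (π ^ ((n : ℝ) / 2) * ((n : ℝ) + 2 * j) ^ p *
      (Gamma γ * ((1 / R) ^ (p - γ) * (1 / (p - γ) + 1 / γ)))) := by ring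
    _ = _ := by rw [e1, e2]; ring

lemma integrable_gaussianMoment {n : ℕ} (hn : 0 < n) {γ : ℝ} (hγ : 0 < γ) (hnγ : 2 * γ < n)
    (j : ℕ) {lam xN ρ : ℝ} (hlam : 0 < lam) (hxN : 0 < xN) (hρ : 0 ≤ ρ) :
    Integrable (fun z => subordinationWeight n γ lam xN z * parallelSum z ^ j *
      exp (-(parallelSum z * ρ))) quadrantMeasure := by
  obtain ⟨C, -, h⟩ := gaussianMoment_bound hn hγ hnγ j
  exact (h lam xN ρ hlam hxN hρ).1

lemma hasFDerivAt_gaussianMoment {n : ℕ} (hn : 0 < n) {γ : ℝ} (hγ : 0 < γ) (hnγ : 2 * γ < n)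
    (j : ℕ) {lam xN : ℝ} (hlam : 0 < lam) (hxN : 0 < xN) (σ y : EuclideanSpace ℝ (Fin n)) :
    HasFDerivAt (fun y => gaussianMoment n γ lam xN j (‖y - σ‖ ^ 2))
      ((-2 * gaussianMoment n γ lam xN (j + 1) (‖y - σ‖ ^ 2)) • innerSL ℝ (y - σ)) y := by
  have hi (j : ℕ) (ρ : ℝ) (hρ : 0 ≤ ρ) :=
    integrable_gaussianMoment hn hγ hnγ j hlam hxN hρ
  have hbound : Integrable (fun z => subordinationWeight n γ lam xN z * parallelSum z ^ (j + 1) *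
      (2 * (‖y - σ‖ + 1))) quadrantMeasure := by
    have := (hi (j + 1) 0 le_rfl).mul_const (2 * (‖y - σ‖ + 1))
    simpa using this
  have key := hasFDerivAt_integral_of_dominated_of_fderiv_le (μ := quadrantMeasure) (𝕜 := ℝ)
    (F := fun (y : EuclideanSpace ℝ (Fin n)) z => subordinationWeight n γ lam xN z *
      parallelSum z ^ j * exp (-(parallelSum z * ‖y - σ‖ ^ 2)))
    (F' := fun y z => (subordinationWeight n γ lam xN z *
      parallelSum z ^ (j + 1) * exp (-(parallelSum z * ‖y - σ‖ ^ 2))) •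
        ((-2 : ℝ) • innerSL ℝ (y - σ)))
    (Metric.ball_mem_nhds y one_pos)
    (Eventually.of_forall fun y => (hi j _ (by positivity)).aestronglyMeasurable)
    (hi j _ (by positivity))
    ((hi (j + 1) _ (by positivity)).aestronglyMeasurable.smul_const _)
    ?_ hbound ?_
  · refine key.congr_fderiv ?_
    rw [integral_smul_const, smul_smul, mul_comm (-2 : ℝ)]
    rfl
  · filter_upwards [ae_quadrantMeasure] with z hz x hx
    have h1 := parallelSum_pos hz.1 hz.2
    have h2 := subordinationWeight_nonneg (n := n) (γ := γ) (lam := lam) (xN := xN) hz.1 hz.2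
    rw [norm_smul, norm_smul, innerSL_apply_norm, norm_of_nonneg (by positivity)]
    have h3 : exp (-(parallelSum z * ‖x - σ‖ ^ 2)) ≤ 1 := by
      apply exp_le_one_iff.2
      have : 0 ≤ parallelSum z * ‖x - σ‖ ^ 2 := by positivity
      linarith
    have h4 : ‖x - σ‖ ≤ ‖y - σ‖ + 1 := by
      have := norm_add_le (x - y) (y - σ)
      rw [sub_add_sub_cancel] at this
      rw [Metric.mem_ball, dist_eq_norm] at hx
      linarith
    have h5 : ‖(-2 : ℝ)‖ = 2 := by norm_num
    rw [h5]
    calc _ ≤ subordinationWeight n γ lam xN z * parallelSum z ^ (j + 1) * 1 *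
        (2 * (‖y - σ‖ + 1)) := by gcongr
      _ = _ := by ring
  · refine Eventually.of_forall fun z x _ => ?_
    have h1 : HasFDerivAt (fun x : EuclideanSpace ℝ (Fin n) => ‖x - σ‖ ^ 2)
        ((2 : ℝ) • innerSL ℝ (x - σ)) x := by
      have := ((hasFDerivAt_id (𝕜 := ℝ) x).sub_const σ).norm_sq
      refine this.congr_fderiv ?_
      ext v
      simp
    have h2 := ((h1.const_mul (parallelSum z)).neg.exp).const_mul
      (subordinationWeight n γ lam xN z * parallelSum z ^ j)
    refine h2.congr_fderiv ?_
    ext v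
    simp
    ring

lemma integral_exp_neg_mul_sq_add_mul_sq (n : ℕ) {z : ℝ × ℝ} (h1 : 0 < z.1) (h2 : 0 < z.2)
    (y σ : EuclideanSpace ℝ (Fin n)) :
    ∫ ξ : EuclideanSpace ℝ (Fin n), exp (-(z.1 * ‖y - ξ‖ ^ 2) - z.2 * ‖ξ - σ‖ ^ 2) =
      (π / (z.1 + z.2)) ^ ((n : ℝ) / 2) * exp (-(parallelSum z * ‖y - σ‖ ^ 2)) := by
  have hs : 0 < z.1 + z.2 := by positivity
  have e (ξ : EuclideanSpace ℝ (Fin n)) : exp (-(z.1 * ‖y - ξ‖ ^ 2) - z.2 * ‖ξ - σ‖ ^ 2) =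
      exp (-(z.1 + z.2) * ‖ξ - (σ + (z.1 / (z.1 + z.2)) • (y - σ))‖ ^ 2) *
        exp (-(parallelSum z * ‖y - σ‖ ^ 2)) := by
    rw [← exp_add]
    congr 1
    have e1 : y - ξ = (y - σ) - (ξ - σ) := by abel
    have e2 : ξ - (σ + (z.1 / (z.1 + z.2)) • (y - σ)) =
      (ξ - σ) - (z.1 / (z.1 + z.2)) • (y - σ) := by abel
    rw [e1, e2]
    generalize y - σ = u
    generalize ξ - σ = v
    rw [norm_sub_sq_real, norm_sub_sq_real, norm_smul, inner_smul_right, real_inner_comm, mul_pow,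
      norm_eq_abs, sq_abs]
    unfold parallelSum
    field_simp
    ring
  simp_rw [e]
  rw [integral_mul_const,
    integral_sub_right_eq_self (fun ξ : EuclideanSpace ℝ (Fin n) => exp (-(z.1 + z.2) * ‖ξ‖ ^ 2)),
    GaussianFourier.integral_rexp_neg_mul_sq_norm hs]
  simp

lemma bubbleExt_eq_gaussianMoment {n : ℕ} (hn : 0 < n) {γ : ℝ} (hγ : 0 < γ) (hnγ : 2 * γ < n)
    {lam xN : ℝ} (hlam : 0 < lam) (hxN : 0 < xN) (σ y : EuclideanSpace ℝ (Fin n)) :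
    bubbleExt n γ lam σ y xN = png n γ * cng n γ /
      (Gamma (((n : ℝ) - 2 * γ) / 2) * Gamma (((n : ℝ) + 2 * γ) / 2)) *
      lam ^ (((n : ℝ) - 2 * γ) / 2) *
      (xN ^ (2 * γ) * gaussianMoment n γ lam xN 0 (‖y - σ‖ ^ 2)) := by
  set a : ℝ := ((n : ℝ) - 2 * γ) / 2 with ha
  set b : ℝ := ((n : ℝ) + 2 * γ) / 2 with hb
  have ha0 : 0 < a := by rw [ha]; linarith
  have hb0 : 0 < b := by rw [hb]; linarith
  have hGa := Gamma_pos_of_pos ha0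
  have hGb := Gamma_pos_of_pos hb0
  set f : EuclideanSpace ℝ (Fin n) → ℝ × ℝ → ℝ := fun ξ z =>
    (z.1 ^ (b - 1) * exp (-((‖y - ξ‖ ^ 2 + xN ^ 2) * z.1))) *
      (z.2 ^ (a - 1) * exp (-((lam ^ 2 + ‖ξ - σ‖ ^ 2) * z.2))) with hf
  have hfz (z : ℝ × ℝ) (ξ : EuclideanSpace ℝ (Fin n)) : f ξ z =
      z.2 ^ (a - 1) * z.1 ^ (b - 1) * exp (-(z.1 * xN ^ 2) - z.2 * lam ^ 2) *
        exp (-(z.1 * ‖y - ξ‖ ^ 2) - z.2 * ‖ξ - σ‖ ^ 2) := by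
    have : exp (-((‖y - ξ‖ ^ 2 + xN ^ 2) * z.1)) * exp (-((lam ^ 2 + ‖ξ - σ‖ ^ 2) * z.2)) =
        exp (-(z.1 * xN ^ 2) - z.2 * lam ^ 2) *
          exp (-(z.1 * ‖y - ξ‖ ^ 2) - z.2 * ‖ξ - σ‖ ^ 2) := by
      rw [← exp_add, ← exp_add]
      congr 1
      ring
    rw [hf]
    linear_combination (z.2 ^ (a - 1) * z.1 ^ (b - 1)) * this
  have hint1 (ξ : EuclideanSpace ℝ (Fin n)) : ∫ z, f ξ z ∂quadrantMeasure =
      (1 / (‖y - ξ‖ ^ 2 + xN ^ 2)) ^ b * Gamma b *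
        ((1 / (lam ^ 2 + ‖ξ - σ‖ ^ 2)) ^ a * Gamma a) := by
    simp only [hf, quadrantMeasure]
    rw [integral_prod_mul
      (fun s : ℝ => s ^ (b - 1) * exp (-((‖y - ξ‖ ^ 2 + xN ^ 2) * s)))
      (fun t : ℝ => t ^ (a - 1) * exp (-((lam ^ 2 + ‖ξ - σ‖ ^ 2) * t))),
      integral_rpow_mul_exp_neg_mul_Ioi hb0 (by positivity),
      integral_rpow_mul_exp_neg_mul_Ioi ha0 (by positivity)]
  have hint2 : ∀ᵐ z ∂quadrantMeasure, ∫ ξ, f ξ z =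
      subordinationWeight n γ lam xN z * parallelSum z ^ 0 *
        exp (-(parallelSum z * ‖y - σ‖ ^ 2)) := by
    filter_upwards [ae_quadrantMeasure] with z hz
    simp_rw [hfz]
    rw [integral_const_mul, integral_exp_neg_mul_sq_add_mul_sq n hz.1 hz.2]
    unfold subordinationWeight
    ring
  have hmom := integrable_gaussianMoment hn hγ hnγ 0 hlam hxN (sq_nonneg ‖y - σ‖)
  have : SFinite quadrantMeasure := by unfold quadrantMeasure; infer_instance
  have hprod : Integrable (Function.uncurry f) (volume.prod quadrantMeasure) := by
    rw [integrable_prod_iff' (Measurable.aestronglyMeasurable (by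
      simp only [hf, Function.uncurry_def]; fun_prop))]
    constructor
    · filter_upwards [ae_quadrantMeasure] with z hz
      simp only [Function.uncurry_apply_pair, hfz]
      refine Integrable.const_mul (Integrable.of_integral_ne_zero ?_) _
      rw [integral_exp_neg_mul_sq_add_mul_sq n hz.1 hz.2]
      have := hz.1
      have := hz.2
      positivity
    · refine hmom.congr ?_
      filter_upwards [hint2, ae_quadrantMeasure] with z hz hpos
      rw [← hz]
      refine integral_congr_ae (Eventually.of_forall fun ξ => ?_)
      simp only [Function.uncurry_apply_pair]
      rw [norm_of_nonneg]
      have := hpos.1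
      have := hpos.2
      simp only [hf]
      positivity
  have hswap := integral_integral_swap hprod
  rw [integral_congr_ae hint2] at hswap
  simp_rw [hint1] at hswap
  unfold bubbleExt bubble gaussianMoment
  rw [← hswap, ← ha, ← hb]
  have hpt (ξ : EuclideanSpace ℝ (Fin n)) :
      xN ^ (2 * γ) / (‖y - ξ‖ ^ 2 + xN ^ 2) ^ b *
        (cng n γ * (lam / (lam ^ 2 + ‖ξ - σ‖ ^ 2)) ^ a) =
      (cng n γ * lam ^ a * xN ^ (2 * γ) / (Gamma a * Gamma b)) *
      ((1 / (‖y - ξ‖ ^ 2 + xN ^ 2)) ^ b * Gamma b *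
        ((1 / (lam ^ 2 + ‖ξ - σ‖ ^ 2)) ^ a * Gamma a)) := by
    rw [div_rpow hlam.le (by positivity), div_rpow zero_le_one (by positivity),
      div_rpow zero_le_one (by positivity), one_rpow, one_rpow]
    field_simp
  simp_rw [hpt]
  rw [integral_const_mul]
  ring

theorem stmt_0 (n : ℕ) (γ : ℝ) (hγ0 : 0 < γ) (hγ1 : γ < 1) (hn : 2 * γ < (n : ℝ)) :
    ∃ C : ℝ, 0 < C ∧
      ∀ (lam : ℝ), 0 < lam → ∀ (σ xb : EuclideanSpace ℝ (Fin n)) (xN : ℝ), 0 < xN →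
        ∀ m : ℕ, m ≤ 2 →
          ‖iteratedFDeriv ℝ m (fun y => bubbleExt n γ lam σ y xN) xb‖ ≤
            C * lam ^ (((n : ℝ) - 2 * γ) / 2) /
              (lam ^ ((n : ℝ) - 2 * γ + (m : ℝ)) +
                Real.sqrt (‖xb - σ‖ ^ 2 + xN ^ 2) ^ ((n : ℝ) - 2 * γ + (m : ℝ))) := by
  have hn0 : 0 < n := by
    have : (0 : ℝ) < n := by linarith
    exact_mod_cast this
  obtain ⟨C₀, hC₀, h₀⟩ := gaussianMoment_bound hn0 hγ0 hn 0
  obtain ⟨C₁, hC₁, h₁⟩ := gaussianMoment_bound hn0 hγ0 hn 1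
  obtain ⟨C₂, hC₂, h₂⟩ := gaussianMoment_bound hn0 hγ0 hn 2
  set K : ℝ := png n γ * cng n γ /
      (Gamma (((n : ℝ) - 2 * γ) / 2) * Gamma (((n : ℝ) + 2 * γ) / 2)) with hK
  refine ⟨2 * ((|K| + 1) * (C₀ + 2 * C₁ + 4 * C₂)), by positivity, ?_⟩
  intro lam hlam σ xb xN hxN m hm
  set q : ℝ := (n : ℝ) - 2 * γ with hq
  have hq0 : 0 < q := by rw [hq]; linarith
  set r : ℝ := ‖xb - σ‖ with hr
  set S : ℝ := √(lam ^ 2 + xN ^ 2 + r ^ 2) with hS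
  have hS0 : 0 < S := by positivity
  have hrS : r ≤ S := le_sqrt_of_sq_le (by nlinarith [sq_nonneg lam, sq_nonneg xN])
  have hlamS : lam ≤ S := le_sqrt_of_sq_le (by nlinarith [sq_nonneg r, sq_nonneg xN])
  have hxS : √(r ^ 2 + xN ^ 2) ≤ S := sqrt_le_sqrt (by nlinarith [sq_nonneg lam])
  obtain ⟨-, p₀, b₀⟩ := h₀ lam xN (r ^ 2) hlam hxN (by positivity)
  obtain ⟨-, p₁, b₁⟩ := h₁ lam xN (r ^ 2) hlam hxN (by positivity)
  obtain ⟨-, p₂, b₂⟩ := h₂ lam xN (r ^ 2) hlam hxN (by positivity)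
  rw [← hS] at b₀ b₁ b₂
  set L : ℝ := K * lam ^ (q / 2) * xN ^ (2 * γ) with hL
  have hLabs : |L| = |K| * lam ^ (q / 2) * xN ^ (2 * γ) := by
    rw [hL, abs_mul, abs_mul, abs_of_pos (rpow_pos_of_pos hlam _),
      abs_of_pos (rpow_pos_of_pos hxN _)]
  have hW : (fun y => bubbleExt n γ lam σ y xN) =
      fun y => L * gaussianMoment n γ lam xN 0 (‖y - σ‖ ^ 2) := by
    funext y
    rw [bubbleExt_eq_gaussianMoment hn0 hγ0 hn hlam hxN σ y, hL]
    ring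
  have hd (j : ℕ) (y : EuclideanSpace ℝ (Fin n)) :=
    hasFDerivAt_gaussianMoment hn0 hγ0 hn j hlam hxN σ y
  have hfd : fderiv ℝ (fun y => bubbleExt n γ lam σ y xN) =
      fun y => (L * (-2 * gaussianMoment n γ lam xN 1 (‖y - σ‖ ^ 2))) • innerSL ℝ (y - σ) := by
    funext y
    rw [hW, ((hd 0 y).const_mul L).fderiv, smul_smul]
  suffices hmain : ‖iteratedFDeriv ℝ m (fun y => bubbleExt n γ lam σ y xN) xb‖ ≤
      |K| * lam ^ (q / 2) * (C₀ + 2 * C₁ + 4 * C₂) * S ^ (-(q + m)) by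
    have hqm : 0 ≤ q + m := by positivity
    have hden : lam ^ (q + m) + √(r ^ 2 + xN ^ 2) ^ (q + m) ≤ 2 * S ^ (q + m) := by
      have := rpow_le_rpow hlam.le hlamS hqm
      have := rpow_le_rpow (sqrt_nonneg _) hxS hqm
      linarith
    rw [le_div_iff₀ (by positivity)]
    calc _ ≤ (|K| * lam ^ (q / 2) * (C₀ + 2 * C₁ + 4 * C₂) * S ^ (-(q + m))) *
          (2 * S ^ (q + m)) := by gcongr
      _ = 2 * (|K| * (C₀ + 2 * C₁ + 4 * C₂)) * lam ^ (q / 2) := by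
        rw [rpow_neg hS0.le]
        field_simp
      _ ≤ _ := by
        gcongr
        linarith
  have hS1 : r * S ^ (-(q + 2)) ≤ S ^ (-(q + 1)) := by
    have e : S ^ (-(q + 1)) = S * S ^ (-(q + 2)) := by
      rw [← rpow_one_add' hS0.le (by linarith)]
      congr 1
      ring
    rw [e]
    gcongr
  have hS2 : r ^ 2 * S ^ (-(q + 4)) ≤ S ^ (-(q + 2)) := by
    have e : S ^ (-(q + 2)) = S ^ 2 * S ^ (-(q + 4)) := by
      rw [← rpow_natCast, ← rpow_add hS0]
      congr 1
      push_cast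
      ring
    rw [e]
    gcongr
  simp only [Nat.cast_zero, Nat.cast_one, Nat.cast_ofNat, mul_zero, mul_one] at b₀ b₁ b₂
  have e4 : q + 2 * 2 = q + 4 := by norm_num
  rw [e4] at b₂
  have hX := rpow_pos_of_pos hxN (2 * γ)
  set G₀ := gaussianMoment n γ lam xN 0 (r ^ 2)
  set G₁ := gaussianMoment n γ lam xN 1 (r ^ 2)
  set G₂ := gaussianMoment n γ lam xN 2 (r ^ 2)
  have hr0 : 0 ≤ r := norm_nonneg _
  have hsum (c T : ℝ) (hc : c ≤ C₀ + 2 * C₁ + 4 * C₂) (hT : 0 ≤ T) :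
      |K| * lam ^ (q / 2) * (c * T) ≤ |K| * lam ^ (q / 2) * (C₀ + 2 * C₁ + 4 * C₂) * T := by
    rw [mul_assoc _ _ T]
    gcongr
  clear_value L
  interval_cases m
  · rw [norm_iteratedFDeriv_zero, congrFun hW xb, norm_mul, ← hr, norm_eq_abs, norm_of_nonneg p₀, hLabs,
      Nat.cast_zero]
    calc _ = |K| * lam ^ (q / 2) * (xN ^ (2 * γ) * G₀) := by ring
      _ ≤ |K| * lam ^ (q / 2) * (C₀ * S ^ (-(q + 0))) := by gcongr
      _ ≤ _ := hsum _ _ (by linarith) (by positivity)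
  · rw [← norm_iteratedFDeriv_fderiv, norm_iteratedFDeriv_zero, hfd, norm_smul, norm_mul,
      norm_mul, ← hr, norm_eq_abs, norm_of_nonneg p₁, hLabs, innerSL_apply_norm]
    have h2 : ‖(-2 : ℝ)‖ = 2 := by norm_num
    rw [h2, ← hr, Nat.cast_one]
    calc _ = |K| * lam ^ (q / 2) * (2 * (xN ^ (2 * γ) * G₁) * r) := by ring
      _ ≤ |K| * lam ^ (q / 2) * (2 * (C₁ * S ^ (-(q + 2))) * r) := by gcongr
      _ = |K| * lam ^ (q / 2) * (2 * C₁ * (r * S ^ (-(q + 2)))) := by ring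
      _ ≤ |K| * lam ^ (q / 2) * (2 * C₁ * S ^ (-(q + 1))) := by gcongr
      _ ≤ _ := hsum _ _ (by linarith) (by positivity)
  · have hJ : HasFDerivAt (fun y : EuclideanSpace ℝ (Fin n) => innerSL ℝ (y - σ))
        (innerSL ℝ) xb :=
      (innerSL ℝ (E := EuclideanSpace ℝ (Fin n))).hasFDerivAt.comp xb
        ((hasFDerivAt_id (𝕜 := ℝ) xb).sub_const σ)
    have hD := (((hd 1 xb).const_mul (-2)).const_mul L).smul hJ
    rw [← norm_iteratedFDeriv_fderiv, ← norm_iteratedFDeriv_fderiv, norm_iteratedFDeriv_zero, hfd]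
    refine (congrArg norm hD.fderiv).trans_le ((norm_add_le _ _).trans ?_)
    have h2 : ‖(-2 : ℝ)‖ = 2 := by norm_num
    rw [ContinuousLinearMap.norm_smulRight_apply, norm_smul, norm_smul, norm_smul, norm_smul,
      ← hr, norm_mul, norm_mul, norm_mul, norm_eq_abs L, norm_of_nonneg p₁, norm_of_nonneg p₂, hLabs,
      innerSL_apply_norm, h2, ← hr, Nat.cast_ofNat]
    calc _ ≤ |K| * lam ^ (q / 2) * xN ^ (2 * γ) * (2 * G₁) * 1 +
          |K| * lam ^ (q / 2) * xN ^ (2 * γ) * (2 * (2 * G₂ * r)) * r := by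
          gcongr
          exact norm_innerSL_le _
      _ = |K| * lam ^ (q / 2) *
          (2 * (xN ^ (2 * γ) * G₁) + 4 * r ^ 2 * (xN ^ (2 * γ) * G₂)) := by ring
      _ ≤ |K| * lam ^ (q / 2) *
          (2 * (C₁ * S ^ (-(q + 2))) + 4 * r ^ 2 * (C₂ * S ^ (-(q + 4)))) := by gcongr
      _ = |K| * lam ^ (q / 2) *
          (2 * C₁ * S ^ (-(q + 2)) + 4 * C₂ * (r ^ 2 * S ^ (-(q + 4)))) := by ring
      _ ≤ |K| * lam ^ (q / 2) * (2 * C₁ * S ^ (-(q + 2)) + 4 * C₂ * S ^ (-(q + 2))) := by gcongr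
      _ = |K| * lam ^ (q / 2) * ((2 * C₁ + 4 * C₂) * S ^ (-(q + 2))) := by ring
      _ ≤ _ := hsum _ _ (by linarith) (by positivity)

end
end

section
/- There exists a constant C > 0 depending only on n and γ such that for every λ > 0, every σ ∈ ℝⁿ, every point x = (x̄, x_N) ∈ ℝ^N_+ and every m ∈ {0,1}, |∇_{x̄}^m ∂_{x_N} W_{λ,σ}(x)| ≤ C λ^{(n-2γ)/2} ( x_N^{2γ-1}/(λ^{n+m} + |x-(σ,0)|^{n+m}) + 1/(λ^{n-2γ+1+m} + |x-(σ,0)|^{n-2γ+1+m}) ), where ∇_{x̄}^m denotes the m-th derivative in the tangential variable x̄. -/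
open MeasureTheory Real Filter Topology

noncomputable section

/-- The beta integral `∫₀^∞ v^(a-1) (v+1)^(-k) dv`. -/
def betaPrimeIntegral (a k : ℝ) : ℝ := ∫ v in Set.Ioi (0 : ℝ), v ^ (a - 1) * (v + 1) ^ (-k)

lemma integrableOn_rpow_mul_add_rpow_neg {a k M : ℝ} (ha : 0 < a) (hk : a < k) (hM : 0 < M) :
    IntegrableOn (fun v : ℝ => v ^ (a - 1) * (v + M) ^ (-k)) (Set.Ioi 0) := by
  have hmeas : Measurable (fun v : ℝ => v ^ (a - 1) * (v + M) ^ (-k)) := by fun_prop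
  rw [← Set.Ioc_union_Ioi_eq_Ioi (zero_le_one : (0 : ℝ) ≤ 1)]
  refine IntegrableOn.union ?_ ?_
  · have h1 : IntegrableOn (fun v : ℝ => v ^ (a - 1) * M ^ (-k)) (Set.Ioc 0 1) :=
      ((intervalIntegrable_iff_integrableOn_Ioc_of_le zero_le_one).1
        (intervalIntegral.intervalIntegrable_rpow' (by linarith))).mul_const _
    refine Integrable.mono' h1 hmeas.aestronglyMeasurable ?_
    filter_upwards [ae_restrict_mem measurableSet_Ioc] with v hv
    have hv0 := hv.1
    rw [Real.norm_of_nonneg (by positivity)]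
    gcongr ?_ * ?_
    exact Real.rpow_le_rpow_of_nonpos hM (by linarith) (by linarith)
  · have h1 : IntegrableOn (fun v : ℝ => v ^ (a - 1 - k)) (Set.Ioi 1) :=
      integrableOn_Ioi_rpow_of_lt (by linarith) one_pos
    refine Integrable.mono' h1 hmeas.aestronglyMeasurable ?_
    filter_upwards [ae_restrict_mem measurableSet_Ioi] with v hv
    have hv0 : 0 < v := lt_trans one_pos hv
    rw [Real.norm_of_nonneg (by positivity), sub_eq_add_neg (a - 1) k, Real.rpow_add hv0]
    gcongr ?_ * ?_
    exact Real.rpow_le_rpow_of_nonpos hv0 (by linarith) (by linarith)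

lemma betaPrimeIntegral_pos {a k : ℝ} (ha : 0 < a) (hk : a < k) : 0 < betaPrimeIntegral a k := by
  have hpos : ∀ v ∈ Set.Ioi (0 : ℝ), 0 < v ^ (a - 1) * (v + 1) ^ (-k) := fun v hv => by
    have : 0 < v := hv
    positivity
  rw [betaPrimeIntegral, setIntegral_pos_iff_support_of_nonneg_ae
    (by filter_upwards [ae_restrict_mem measurableSet_Ioi] with v hv using (hpos v hv).le)
    (integrableOn_rpow_mul_add_rpow_neg ha hk one_pos),
    Set.inter_eq_self_of_subset_right (s := Function.support _) (fun v hv => (hpos v hv).ne')]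
  simp

lemma integral_rpow_mul_add_rpow_neg (a k : ℝ) {M : ℝ} (hM : 0 < M) :
    ∫ v in Set.Ioi (0 : ℝ), v ^ (a - 1) * (v + M) ^ (-k) = M ^ (a - k) * betaPrimeIntegral a k := by
  have h := integral_comp_mul_left_Ioi (fun v : ℝ => v ^ (a - 1) * (v + M) ^ (-k)) 0 hM
  rw [mul_zero, smul_eq_mul, eq_inv_mul_iff_mul_eq₀ hM.ne'] at h
  rw [← h, betaPrimeIntegral, ← integral_const_mul, ← integral_const_mul]
  refine setIntegral_congr_fun measurableSet_Ioi fun v hv => ?_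
  have hv : 0 < v := hv
  have e : M * v + M = M * (v + 1) := by ring
  have e2 : M ^ (a - k) = M * (M ^ (a - 1) * M ^ (-k)) := by
    nth_rw 2 [← Real.rpow_one M]
    rw [← Real.rpow_add hM, ← Real.rpow_add hM]
    ring_nf
  rw [e, Real.mul_rpow hM.le hv.le, Real.mul_rpow hM.le (by positivity), e2]
  ring

lemma rpow_mul_add_div_rpow_neg {γ k M c v : ℝ} (hM : 0 < M) (hc : 0 < c) (hv : 0 < v) :
    v ^ (γ - 2) * (M + c / v) ^ (-k) =
      M ^ (-k) * (v ^ (k - 1 + γ - 1) * (v + c / M) ^ (-k)) := by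
  have e : M + c / v = M * (v⁻¹ * (v + c / M)) := by field_simp
  rw [e, Real.mul_rpow hM.le (by positivity), Real.mul_rpow (by positivity) (by positivity),
    Real.inv_rpow hv.le, Real.rpow_neg hv.le, inv_inv,
    show k - 1 + γ - 1 = γ - 2 + k by ring, Real.rpow_add hv]
  ring

lemma integrableOn_rpow_mul_add_div_rpow_neg {γ k M c : ℝ} (hγ : γ < 1) (hk : 0 < k - 1 + γ)
    (hM : 0 < M) (hc : 0 < c) :
    IntegrableOn (fun v : ℝ => v ^ (γ - 2) * (M + c / v) ^ (-k)) (Set.Ioi 0) := by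
  refine (integrableOn_congr_fun (fun v hv => rpow_mul_add_div_rpow_neg hM hc hv)
    measurableSet_Ioi).2 ?_
  exact (integrableOn_rpow_mul_add_rpow_neg hk (by linarith) (by positivity)).const_mul _

lemma integral_rpow_mul_add_div_rpow_neg {γ k M c : ℝ} (hM : 0 < M) (hc : 0 < c) :
    ∫ v in Set.Ioi (0 : ℝ), v ^ (γ - 2) * (M + c / v) ^ (-k) =
      M ^ (-k) * ((c / M) ^ (γ - 1) * betaPrimeIntegral (k - 1 + γ) k) := by
  rw [setIntegral_congr_fun measurableSet_Ioi
    (fun v hv => rpow_mul_add_div_rpow_neg (γ := γ) (k := k) hM hc hv), integral_const_mul,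
    integral_rpow_mul_add_rpow_neg _ _ (by positivity)]
  ring_nf

lemma rpow_mul_mul_add_rpow_neg {a b A B u : ℝ} (hA : 0 < A) (hB : 0 < B) (hu : 0 < u) :
    u ^ (a - 1) * (u * A + B) ^ (-(a + b)) =
      A ^ (-(a + b)) * (u ^ (a - 1) * (u + B / A) ^ (-(a + b))) := by
  rw [show u * A + B = A * (u + B / A) by field_simp, Real.mul_rpow hA.le (by positivity)]
  ring

/-- Feynman's parametrisation of a product of two negative powers. -/
lemma integral_feynman {a b A B : ℝ} (hA : 0 < A) (hB : 0 < B) :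
    ∫ u in Set.Ioi (0 : ℝ), u ^ (a - 1) * (u * A + B) ^ (-(a + b)) =
      A ^ (-a) * B ^ (-b) * betaPrimeIntegral a (a + b) := by
  rw [setIntegral_congr_fun measurableSet_Ioi
    (fun u hu => rpow_mul_mul_add_rpow_neg (a := a) (b := b) hA hB hu), integral_const_mul,
    integral_rpow_mul_add_rpow_neg _ _ (by positivity), Real.div_rpow hB.le hA.le,
    show a - (a + b) = -b by ring, neg_add, Real.rpow_add hA]
  have := (Real.rpow_pos_of_pos hA (-b)).ne'
  field_simp

lemma integrableOn_feynman {a b A B : ℝ} (ha : 0 < a) (hb : 0 < b) (hA : 0 < A) (hB : 0 < B) :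
    IntegrableOn (fun u : ℝ => u ^ (a - 1) * (u * A + B) ^ (-(a + b))) (Set.Ioi 0) := by
  refine (integrableOn_congr_fun
    (fun u hu => rpow_mul_mul_add_rpow_neg hA hB hu) measurableSet_Ioi).2 ?_
  exact (integrableOn_rpow_mul_add_rpow_neg ha (by linarith) (by positivity)).const_mul _

lemma integral_mul_norm_sub_sq_add_rpow_neg {n : ℕ} (k : ℝ) {a M : ℝ} (ha : 0 < a) (hM : 0 < M)
    (η : EuclideanSpace ℝ (Fin n)) :
    ∫ ξ : EuclideanSpace ℝ (Fin n), (a * ‖ξ - η‖ ^ 2 + M) ^ (-k) =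
      M ^ (-k) * (a / M) ^ (-((n : ℝ) / 2)) *
        ∫ ξ : EuclideanSpace ℝ (Fin n), (1 + ‖ξ‖ ^ 2) ^ (-k) := by
  rw [integral_sub_right_eq_self (fun ξ : EuclideanSpace ℝ (Fin n) => (a * ‖ξ‖ ^ 2 + M) ^ (-k)) η]
  have e : ∀ ξ : EuclideanSpace ℝ (Fin n), (a * ‖ξ‖ ^ 2 + M) ^ (-k) =
      M ^ (-k) * (1 + ‖√(a / M) • ξ‖ ^ 2) ^ (-k) := fun ξ => by
    rw [norm_smul, mul_pow, Real.norm_of_nonneg (Real.sqrt_nonneg _),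
      Real.sq_sqrt (by positivity), ← Real.mul_rpow hM.le (by positivity)]
    congr 1
    field_simp
    ring
  simp_rw [e]
  rw [integral_const_mul, Measure.integral_comp_smul volume
    (fun ξ : EuclideanSpace ℝ (Fin n) => (1 + ‖ξ‖ ^ 2) ^ (-k)), finrank_euclideanSpace_fin,
    smul_eq_mul, abs_of_nonneg (by positivity), Real.sqrt_eq_rpow, ← Real.rpow_natCast,
    ← Real.rpow_mul (by positivity), ← Real.rpow_neg (by positivity)]
  ring_nf

lemma mul_norm_sub_sq_add_norm_sub_sq {E : Type*} [NormedAddCommGroup E] [InnerProductSpace ℝ E]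
    {u : ℝ} (hu : 0 < 1 + u) (x σ ξ : E) :
    u * ‖x - ξ‖ ^ 2 + ‖ξ - σ‖ ^ 2 =
      (1 + u) * ‖ξ - (σ + (u / (1 + u)) • (x - σ))‖ ^ 2 + u / (1 + u) * ‖x - σ‖ ^ 2 := by
  rw [show x - ξ = (x - σ) - (ξ - σ) by abel,
    show ξ - (σ + (u / (1 + u)) • (x - σ)) = (ξ - σ) - (u / (1 + u)) • (x - σ) by abel]
  generalize x - σ = d
  generalize ξ - σ = p
  rw [norm_sub_sq_real, norm_sub_sq_real, norm_smul, inner_smul_right, mul_pow, Real.norm_eq_abs,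
    sq_abs, real_inner_comm]
  field_simp
  ring

lemma integrable_rpow_neg_norm_sub_sq_add {n : ℕ} {a t : ℝ} (ha : (n : ℝ) / 2 < a) (ht : 0 < t)
    (x : EuclideanSpace ℝ (Fin n)) :
    Integrable (fun ξ : EuclideanSpace ℝ (Fin n) => (‖x - ξ‖ ^ 2 + t ^ 2) ^ (-a)) := by
  have h := integrable_rpow_neg_one_add_norm_sq (E := EuclideanSpace ℝ (Fin n)) (μ := volume)
    (r := 2 * a) (by rw [finrank_euclideanSpace_fin]; linarith)
  have h2 := ((h.comp_smul (inv_ne_zero ht.ne')).comp_sub_left x).const_mul ((t ^ 2) ^ (-a))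
  refine h2.congr (Eventually.of_forall fun ξ => ?_)
  simp only
  rw [show -(2 * a) / 2 = -a by ring, ← Real.mul_rpow (by positivity) (by positivity), norm_smul,
    mul_pow, Real.norm_of_nonneg (by positivity)]
  congr 1
  field_simp
  ring

lemma integrable_rpow_neg_mul_rpow_neg {n : ℕ} {a b L t : ℝ} (ha : (n : ℝ) / 2 < a) (hb : 0 < b)
    (hL : 0 < L) (ht : 0 < t) (x σ : EuclideanSpace ℝ (Fin n)) :
    Integrable (fun ξ : EuclideanSpace ℝ (Fin n) =>
      (‖x - ξ‖ ^ 2 + t ^ 2) ^ (-a) * (‖ξ - σ‖ ^ 2 + L ^ 2) ^ (-b)) := by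
  refine Integrable.mono' ((integrable_rpow_neg_norm_sub_sq_add ha ht x).mul_const
    ((L ^ 2) ^ (-b))) (Measurable.aestronglyMeasurable (by fun_prop))
    (Eventually.of_forall fun ξ => ?_)
  rw [Real.norm_of_nonneg (by positivity)]
  gcongr ?_ * ?_
  exact Real.rpow_le_rpow_of_nonpos (by positivity) (le_add_of_nonneg_left (by positivity))
    (by linarith)

lemma integrable_feynman_prod {n : ℕ} {a b L t : ℝ} (ha : (n : ℝ) / 2 < a) (hb : 0 < b)
    (hL : 0 < L) (ht : 0 < t) (x σ : EuclideanSpace ℝ (Fin n)) :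
    Integrable (Function.uncurry fun (ξ : EuclideanSpace ℝ (Fin n)) (u : ℝ) =>
      u ^ (a - 1) * (u * (‖x - ξ‖ ^ 2 + t ^ 2) + (‖ξ - σ‖ ^ 2 + L ^ 2)) ^ (-(a + b)))
      (volume.prod (volume.restrict (Set.Ioi 0))) := by
  have ha0 : 0 < a := lt_of_le_of_lt (by positivity) ha
  have hA : ∀ ξ : EuclideanSpace ℝ (Fin n), 0 < ‖x - ξ‖ ^ 2 + t ^ 2 := fun ξ => by positivity
  have hB : ∀ ξ : EuclideanSpace ℝ (Fin n), 0 < ‖ξ - σ‖ ^ 2 + L ^ 2 := fun ξ => by positivity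
  have hmeas : Measurable fun p : EuclideanSpace ℝ (Fin n) × ℝ =>
      p.2 ^ (a - 1) * (p.2 * (‖x - p.1‖ ^ 2 + t ^ 2) + (‖p.1 - σ‖ ^ 2 + L ^ 2)) ^ (-(a + b)) := by
    fun_prop
  rw [integrable_prod_iff (by exact hmeas.aestronglyMeasurable)]
  simp only [Function.uncurry_apply_pair]
  refine ⟨?_, ?_⟩
  · filter_upwards with ξ
    have h := integrableOn_feynman ha0 hb (hA ξ) (hB ξ)
    rwa [IntegrableOn] at h
  refine ((integrable_rpow_neg_mul_rpow_neg ha hb hL ht x σ).mul_const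
    (betaPrimeIntegral a (a + b))).congr (Eventually.of_forall fun ξ => ?_)
  simp only
  rw [← integral_feynman (hA ξ) (hB ξ)]
  refine setIntegral_congr_fun measurableSet_Ioi fun u hu => ?_
  have hu : 0 < u := hu
  exact (Real.norm_of_nonneg (by positivity)).symm

lemma integral_poisson_mul_bubble {n : ℕ} {γ L t : ℝ} (hγ : 0 < γ) (hn : 2 * γ < (n : ℝ))
    (hL : 0 < L) (ht : 0 < t) (x σ : EuclideanSpace ℝ (Fin n)) :
    t ^ (2 * γ) * ((∫ ξ : EuclideanSpace ℝ (Fin n),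
        (‖x - ξ‖ ^ 2 + t ^ 2) ^ (-(((n : ℝ) + 2 * γ) / 2)) *
          (‖ξ - σ‖ ^ 2 + L ^ 2) ^ (-(((n : ℝ) - 2 * γ) / 2))) *
        betaPrimeIntegral (((n : ℝ) + 2 * γ) / 2) n) =
      (∫ ξ : EuclideanSpace ℝ (Fin n), (1 + ‖ξ‖ ^ 2) ^ (-(n : ℝ))) *
        ∫ v in Set.Ioi (0 : ℝ), v ^ (γ - 1) *
          (‖x - σ‖ ^ 2 + (v + L ^ 2) * (v + t ^ 2) / v) ^ (-((n : ℝ) / 2)) := by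
  have hsum : ((n : ℝ) + 2 * γ) / 2 + ((n : ℝ) - 2 * γ) / 2 = n := by ring
  have h1 := integral_integral_swap (integrable_feynman_prod
    (a := ((n : ℝ) + 2 * γ) / 2) (b := ((n : ℝ) - 2 * γ) / 2) (by linarith) (by linarith) hL ht x σ)
  have e1 : ∀ ξ : EuclideanSpace ℝ (Fin n), ∫ u in Set.Ioi (0 : ℝ),
      u ^ (((n : ℝ) + 2 * γ) / 2 - 1) *
        (u * (‖x - ξ‖ ^ 2 + t ^ 2) + (‖ξ - σ‖ ^ 2 + L ^ 2)) ^
          (-(((n : ℝ) + 2 * γ) / 2 + ((n : ℝ) - 2 * γ) / 2)) = _ := fun ξ =>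
    integral_feynman (by positivity) (by positivity)
  simp_rw [e1] at h1
  rw [integral_mul_const, hsum] at h1
  rw [h1]
  set S := ∫ ξ : EuclideanSpace ℝ (Fin n), (1 + ‖ξ‖ ^ 2) ^ (-(n : ℝ)) with hS
  have h2 := integral_comp_mul_left_Ioi (fun v : ℝ => v ^ (γ - 1) *
          (‖x - σ‖ ^ 2 + (v + L ^ 2) * (v + t ^ 2) / v) ^ (-((n : ℝ) / 2))) 0
          (b := t ^ 2) (by positivity)
  rw [mul_zero, smul_eq_mul, eq_inv_mul_iff_mul_eq₀ (by positivity)] at h2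
  rw [← h2, ← integral_const_mul, ← integral_const_mul, ← integral_const_mul]
  refine setIntegral_congr_fun measurableSet_Ioi fun u hu => ?_
  have hu : 0 < u := hu
  have hM : 0 < u / (1 + u) * ‖x - σ‖ ^ 2 + (u * t ^ 2 + L ^ 2) := by positivity
  have e2 : ∀ ξ : EuclideanSpace ℝ (Fin n),
      u * (‖x - ξ‖ ^ 2 + t ^ 2) + (‖ξ - σ‖ ^ 2 + L ^ 2) =
        (1 + u) * ‖ξ - (σ + (u / (1 + u)) • (x - σ))‖ ^ 2 +
          (u / (1 + u) * ‖x - σ‖ ^ 2 + (u * t ^ 2 + L ^ 2)) := fun ξ => by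
    have := mul_norm_sub_sq_add_norm_sub_sq (by positivity : 0 < 1 + u) x σ ξ
    linarith
  simp_rw [e2]
  rw [integral_const_mul,
    integral_mul_norm_sub_sq_add_rpow_neg _ (by positivity : 0 < 1 + u) hM, ← hS]
  have e3 : ‖x - σ‖ ^ 2 + (t ^ 2 * u + L ^ 2) * (t ^ 2 * u + t ^ 2) / (t ^ 2 * u) =
      u⁻¹ * ((1 + u) * (u / (1 + u) * ‖x - σ‖ ^ 2 + (u * t ^ 2 + L ^ 2))) := by
    field_simp
    ring
  rw [e3]
  generalize u / (1 + u) * ‖x - σ‖ ^ 2 + (u * t ^ 2 + L ^ 2) = M at hM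
  have e4 : u ^ (((n : ℝ) + 2 * γ) / 2 - 1) = u ^ (γ - 1) * u ^ ((n : ℝ) / 2) := by
    rw [← Real.rpow_add hu]
    ring_nf
  have e5 : t ^ (2 * γ) = t ^ 2 * (t ^ 2) ^ (γ - 1) := by
    rw [← Real.rpow_natCast t 2, ← Real.rpow_mul ht.le, ← Real.rpow_add ht]
    push_cast
    ring_nf
  have e6 : M ^ (-(n : ℝ)) = M ^ (-((n : ℝ) / 2)) * M ^ (-((n : ℝ) / 2)) := by
    rw [← Real.rpow_add hM]
    ring_nf
  rw [e4, e5, e6, Real.mul_rpow (by positivity) hu.le, Real.mul_rpow (by positivity)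
    (by positivity), Real.mul_rpow (by positivity) hM.le, Real.div_rpow (by positivity) hM.le,
    Real.inv_rpow hu.le, Real.rpow_neg hu.le, inv_inv]
  have := (Real.rpow_pos_of_pos hM (-((n : ℝ) / 2))).ne'
  field_simp

/-- The extended bubble as a single one-dimensional integral, up to a constant depending only on
`n` and `γ`. -/
lemma exists_bubbleExt_eq {n : ℕ} {γ : ℝ} (hγ : 0 < γ) (hn : 2 * γ < (n : ℝ)) :
    ∃ K : ℝ, ∀ L : ℝ, 0 < L → ∀ (σ x : EuclideanSpace ℝ (Fin n)) (t : ℝ), 0 < t →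
      bubbleExt n γ L σ x t = K * L ^ (((n : ℝ) - 2 * γ) / 2) *
        ∫ v in Set.Ioi (0 : ℝ), v ^ (γ - 1) *
          (‖x - σ‖ ^ 2 + (v + L ^ 2) * (v + t ^ 2) / v) ^ (-((n : ℝ) / 2)) := by
  have hJ : 0 < betaPrimeIntegral (((n : ℝ) + 2 * γ) / 2) n :=
    betaPrimeIntegral_pos (by linarith) (by linarith)
  refine ⟨png n γ * cng n γ * (betaPrimeIntegral (((n : ℝ) + 2 * γ) / 2) n)⁻¹ *
    ∫ ξ : EuclideanSpace ℝ (Fin n), (1 + ‖ξ‖ ^ 2) ^ (-(n : ℝ)), fun L hL σ x t ht => ?_⟩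
  have h := integral_poisson_mul_bubble hγ hn hL ht x σ
  have e : ∀ ξ : EuclideanSpace ℝ (Fin n),
      t ^ (2 * γ) / (‖x - ξ‖ ^ 2 + t ^ 2) ^ (((n : ℝ) + 2 * γ) / 2) * bubble n γ L σ ξ =
        t ^ (2 * γ) * cng n γ * L ^ (((n : ℝ) - 2 * γ) / 2) *
          ((‖x - ξ‖ ^ 2 + t ^ 2) ^ (-(((n : ℝ) + 2 * γ) / 2)) *
          (‖ξ - σ‖ ^ 2 + L ^ 2) ^ (-(((n : ℝ) - 2 * γ) / 2))) := fun ξ => by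
    rw [bubble, Real.rpow_neg (by positivity), Real.rpow_neg (by positivity),
      Real.div_rpow hL.le (by positivity), add_comm (L ^ 2)]
    ring
  rw [bubbleExt]
  simp_rw [e]
  rw [integral_const_mul]
  field_simp
  linear_combination (png n γ * cng n γ) * h

/-- An integrable majorant for the differentiated one-dimensional integrands. -/
def bubbleMajorant (γ k L M c v : ℝ) : ℝ :=
  v ^ (γ - 1) * (v + M) ^ (-k) + L ^ 2 * (v ^ (γ - 2) * (M + c / v) ^ (-k))

lemma integrableOn_bubbleMajorant {γ k M c : ℝ} (L : ℝ) (hγ0 : 0 < γ) (hγ1 : γ < 1) (hk : 1 < k)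
    (hM : 0 < M) (hc : 0 < c) : IntegrableOn (bubbleMajorant γ k L M c) (Set.Ioi 0) :=
  (integrableOn_rpow_mul_add_rpow_neg hγ0 (by linarith) hM).add
    ((integrableOn_rpow_mul_add_div_rpow_neg hγ1 (by linarith) hM hc).const_mul _)

lemma rpow_mul_rpow_neg_le_bubbleMajorant {γ k L M c s t v : ℝ} (hk : 0 ≤ k) (hM : 0 < M)
    (hc : 0 < c) (hv : 0 < v) (hMs : M ≤ s + L ^ 2 + t ^ 2) (hct : c ≤ L ^ 2 * t ^ 2) :
    v ^ (γ - 1) * (1 + L ^ 2 / v) * (s + (v + L ^ 2) * (v + t ^ 2) / v) ^ (-k) ≤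
      bubbleMajorant γ k L M c v := by
  have e : s + (v + L ^ 2) * (v + t ^ 2) / v = s + L ^ 2 + t ^ 2 + v + L ^ 2 * t ^ 2 / v := by
    field_simp
    ring
  have hdiv : c / v ≤ L ^ 2 * t ^ 2 / v := by gcongr
  have hcv : 0 < c / v := by positivity
  have h1 : (s + (v + L ^ 2) * (v + t ^ 2) / v) ^ (-k) ≤ (v + M) ^ (-k) :=
    Real.rpow_le_rpow_of_nonpos (by positivity) (by linarith) (by linarith)
  have h2 : (s + (v + L ^ 2) * (v + t ^ 2) / v) ^ (-k) ≤ (M + c / v) ^ (-k) :=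
    Real.rpow_le_rpow_of_nonpos (by positivity) (by linarith) (by linarith)
  have e2 : v ^ (γ - 1) * (L ^ 2 / v) = L ^ 2 * v ^ (γ - 2) := by
    rw [show γ - 2 = γ - 1 - 1 by ring, Real.rpow_sub_one hv.ne' (γ - 1)]
    ring
  rw [mul_add, mul_one, add_mul, e2, mul_assoc (L ^ 2), bubbleMajorant]
  gcongr

lemma integral_bubbleMajorant_le {γ h L s t : ℝ} (hγ0 : 0 < γ) (hγ1 : γ < 1) (hh : 0 < h)
    (hL : 0 < L) (hs : 0 ≤ s) (ht : 0 < t) :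
    ∫ v in Set.Ioi (0 : ℝ), bubbleMajorant γ (h + 1) L (s + L ^ 2 + t ^ 2) (L ^ 2 * t ^ 2) v ≤
      (betaPrimeIntegral γ (h + 1) + betaPrimeIntegral (h + γ) (h + 1)) * (t ^ 2) ^ (γ - 1) *
        (s + L ^ 2 + t ^ 2) ^ (-h) := by
  have hLR : L ^ 2 ≤ s + L ^ 2 + t ^ 2 := by nlinarith
  have htR : t ^ 2 ≤ s + L ^ 2 + t ^ 2 := by nlinarith
  have hT : 0 < t ^ 2 := by positivity
  have hΛ : 0 < L ^ 2 := by positivity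
  unfold bubbleMajorant
  generalize s + L ^ 2 + t ^ 2 = R at *
  generalize t ^ 2 = T at *
  generalize L ^ 2 = Λ at *
  have hR : 0 < R := by linarith
  have hJ1 := betaPrimeIntegral_pos hγ0 (show γ < h + 1 by linarith)
  have hJ2 := betaPrimeIntegral_pos (show 0 < h + γ by linarith) (show h + γ < h + 1 by linarith)
  rw [integral_add (integrableOn_rpow_mul_add_rpow_neg hγ0 (by linarith) hR)
    ((integrableOn_rpow_mul_add_div_rpow_neg hγ1 (by linarith) hR (by positivity)).const_mul _),
    integral_const_mul, integral_rpow_mul_add_rpow_neg _ _ hR,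
    integral_rpow_mul_add_div_rpow_neg hR (by positivity), show h + 1 - 1 + γ = h + γ by ring]
  have b1 : R ^ (γ - (h + 1)) ≤ T ^ (γ - 1) * R ^ (-h) := by
    rw [show γ - (h + 1) = (γ - 1) + -h by ring, Real.rpow_add hR]
    gcongr ?_ * _
    exact Real.rpow_le_rpow_of_nonpos hT htR (by linarith)
  have b2 : Λ * (R ^ (-(h + 1)) * (Λ * T / R) ^ (γ - 1)) ≤ T ^ (γ - 1) * R ^ (-h) := by
    have hle : (Λ / R) ^ γ ≤ 1 :=
      Real.rpow_le_one (by positivity) ((div_le_one hR).2 hLR) hγ0.le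
    have e : Λ * (R ^ (-(h + 1)) * (Λ * T / R) ^ (γ - 1)) =
        (Λ / R) ^ γ * (T ^ (γ - 1) * R ^ (-h)) := by
      rw [show Λ * T / R = Λ / R * T by ring, Real.mul_rpow (by positivity) hT.le,
        Real.rpow_sub_one (by positivity : Λ / R ≠ 0), neg_add, ← sub_eq_add_neg,
        Real.rpow_sub_one hR.ne']
      field_simp
    rw [e]
    exact mul_le_of_le_one_left (by positivity) hle
  calc _ = R ^ (γ - (h + 1)) * betaPrimeIntegral γ (h + 1) +
        Λ * (R ^ (-(h + 1)) * (Λ * T / R) ^ (γ - 1)) * betaPrimeIntegral (h + γ) (h + 1) := by ring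
    _ ≤ T ^ (γ - 1) * R ^ (-h) * betaPrimeIntegral γ (h + 1) +
        T ^ (γ - 1) * R ^ (-h) * betaPrimeIntegral (h + γ) (h + 1) := by gcongr
    _ = _ := by ring

lemma hasDerivAt_integral_height {γ h L s t : ℝ} (hγ0 : 0 < γ) (hγ1 : γ < 1) (hh : γ < h)
    (hL : 0 < L) (hs : 0 ≤ s) (ht : 0 < t) :
    HasDerivAt (fun t : ℝ => ∫ v in Set.Ioi (0 : ℝ),
        v ^ (γ - 1) * (s + (v + L ^ 2) * (v + t ^ 2) / v) ^ (-h))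
      (-(2 * h * t) * ∫ v in Set.Ioi (0 : ℝ),
        v ^ (γ - 1) * (1 + L ^ 2 / v) * (s + (v + L ^ 2) * (v + t ^ 2) / v) ^ (-(h + 1))) t := by
  have hh0 : 0 < h := hγ0.trans hh
  rw [← integral_const_mul]
  refine (hasDerivAt_integral_of_dominated_loc_of_deriv_le (s := Set.Ioo (t / 2) (2 * t))
    (bound := fun v => 4 * h * t *
      bubbleMajorant γ (h + 1) L (s + L ^ 2 + (t / 2) ^ 2) (L ^ 2 * (t / 2) ^ 2) v)
    (F' := fun t v => -(2 * h * t) *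
      (v ^ (γ - 1) * (1 + L ^ 2 / v) * (s + (v + L ^ 2) * (v + t ^ 2) / v) ^ (-(h + 1))))
    (Ioo_mem_nhds (by linarith) (by linarith))
    (Eventually.of_forall fun t => Measurable.aestronglyMeasurable (by fun_prop)) ?_
    (Measurable.aestronglyMeasurable (by fun_prop)) ?_
    ((integrableOn_bubbleMajorant L hγ0 hγ1 (by linarith) (by positivity)
      (by positivity)).const_mul _) ?_).2
  · refine Integrable.mono' (integrableOn_rpow_mul_add_rpow_neg hγ0 hh (pow_pos hL 2))
      (Measurable.aestronglyMeasurable (by fun_prop)) ?_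
    filter_upwards [ae_restrict_mem measurableSet_Ioi] with v hv
    have hv : 0 < v := hv
    rw [Real.norm_of_nonneg (by positivity)]
    gcongr ?_ * ?_
    refine Real.rpow_le_rpow_of_nonpos (by positivity) ?_ (by linarith)
    have e : (v + L ^ 2) * (v + t ^ 2) / v = v + L ^ 2 + (v + L ^ 2) * t ^ 2 / v := by field_simp
    have : 0 ≤ (v + L ^ 2) * t ^ 2 / v := by positivity
    linarith
  · filter_upwards [ae_restrict_mem measurableSet_Ioi] with v hv r hr
    have hv : 0 < v := hv
    have hr0 : 0 < r := by linarith [hr.1]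
    have hr2 : (t / 2) ^ 2 ≤ r ^ 2 := by
      have := hr.1
      gcongr
    rw [neg_mul, norm_neg, Real.norm_of_nonneg (by positivity)]
    have hle := rpow_mul_rpow_neg_le_bubbleMajorant (γ := γ) (k := h + 1) (L := L) (s := s) (t := r)
      (M := s + L ^ 2 + (t / 2) ^ 2) (c := L ^ 2 * (t / 2) ^ 2) (by linarith) (by positivity)
      (by positivity) hv (by linarith) (by gcongr)
    have hle2 : 2 * h * r ≤ 4 * h * t := by nlinarith [hr.2]
    exact mul_le_mul hle2 hle (by positivity) (by positivity)
  · filter_upwards [ae_restrict_mem measurableSet_Ioi] with v hv r hr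
    have hv : 0 < v := hv
    have hP : 0 < s + (v + L ^ 2) * (v + r ^ 2) / v := by positivity
    have h1 : HasDerivAt (fun r : ℝ => s + (v + L ^ 2) * (v + r ^ 2) / v)
        ((v + L ^ 2) * (2 * r) / v) r := by
      have := ((((hasDerivAt_pow 2 r).const_add v).const_mul (v + L ^ 2)).div_const v).const_add s
      simpa using this
    refine ((h1.rpow_const (p := -h) (Or.inl hP.ne')).const_mul (v ^ (γ - 1))).congr_deriv ?_
    rw [show -h - 1 = -(h + 1) by ring]
    field_simp

lemma hasDerivAt_integral_sq_dist {γ k L s t : ℝ} (hγ0 : 0 < γ) (hγ1 : γ < 1) (hk : 1 < k)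
    (hL : 0 < L) (hs : 0 ≤ s) (ht : 0 < t) :
    HasDerivAt (fun s : ℝ => ∫ v in Set.Ioi (0 : ℝ),
        v ^ (γ - 1) * (1 + L ^ 2 / v) * (s + (v + L ^ 2) * (v + t ^ 2) / v) ^ (-k))
      (∫ v in Set.Ioi (0 : ℝ), v ^ (γ - 1) * (1 + L ^ 2 / v) *
        (-k * (s + (v + L ^ 2) * (v + t ^ 2) / v) ^ (-k - 1))) s := by
  have hLt : 0 < (L ^ 2 + t ^ 2) / 2 := by positivity
  have hP : ∀ r ∈ Set.Ioi (s - (L ^ 2 + t ^ 2) / 2), ∀ v > 0,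
      (L ^ 2 + t ^ 2) / 2 ≤ r + (v + L ^ 2) * (v + t ^ 2) / v := fun r hr v hv => by
    have hr : s - (L ^ 2 + t ^ 2) / 2 < r := hr
    have e : (v + L ^ 2) * (v + t ^ 2) / v = L ^ 2 + t ^ 2 + (v + L ^ 2 * t ^ 2 / v) := by
      field_simp
      ring
    have : 0 < v + L ^ 2 * t ^ 2 / v := by positivity
    linarith
  refine (hasDerivAt_integral_of_dominated_loc_of_deriv_le (s := Set.Ioi (s - (L ^ 2 + t ^ 2) / 2))
    (bound := fun v => k * ((L ^ 2 + t ^ 2) / 2)⁻¹ *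
      bubbleMajorant γ k L ((L ^ 2 + t ^ 2) / 2) (L ^ 2 * t ^ 2) v)
    (F' := fun s v => v ^ (γ - 1) * (1 + L ^ 2 / v) *
        (-k * (s + (v + L ^ 2) * (v + t ^ 2) / v) ^ (-k - 1)))
    (Ioi_mem_nhds (by linarith))
    (Eventually.of_forall fun t => Measurable.aestronglyMeasurable (by fun_prop)) ?_
    (Measurable.aestronglyMeasurable (by fun_prop)) ?_
    ((integrableOn_bubbleMajorant L hγ0 hγ1 hk hLt (by positivity)).const_mul _) ?_).2
  · refine Integrable.mono' (integrableOn_bubbleMajorant L hγ0 hγ1 hk hLt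
      (c := L ^ 2 * t ^ 2) (by positivity)) (Measurable.aestronglyMeasurable (by fun_prop)) ?_
    filter_upwards [ae_restrict_mem measurableSet_Ioi] with v hv
    have hv : 0 < v := hv
    rw [Real.norm_of_nonneg (by positivity)]
    exact rpow_mul_rpow_neg_le_bubbleMajorant (by linarith) hLt (by positivity) hv (by linarith)
      le_rfl
  · filter_upwards [ae_restrict_mem measurableSet_Ioi] with v hv r hr
    have hv : 0 < v := hv
    have hPr := hP r hr v hv
    have hr' : s - (L ^ 2 + t ^ 2) / 2 < r := hr
    have hP0 := hLt.trans_le hPr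
    have hle := rpow_mul_rpow_neg_le_bubbleMajorant (γ := γ) (k := k) (L := L) (s := r) (t := t)
      (by linarith) hLt (by positivity) hv (by linarith) le_rfl
    rw [Real.rpow_sub_one hP0.ne', neg_mul, mul_neg, norm_neg, Real.norm_of_nonneg (by positivity)]
    calc _ = k * (r + (v + L ^ 2) * (v + t ^ 2) / v)⁻¹ * (v ^ (γ - 1) * (1 + L ^ 2 / v) *
          (r + (v + L ^ 2) * (v + t ^ 2) / v) ^ (-k)) := by ring
      _ ≤ _ := by gcongr
  · filter_upwards [ae_restrict_mem measurableSet_Ioi] with v hv r hr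
    have hP0 := hLt.trans_le (hP r hr v hv)
    have h1 := ((hasDerivAt_id r).add_const ((v + L ^ 2) * (v + t ^ 2) / v)).rpow_const
      (p := -k) (Or.inl hP0.ne')
    refine (h1.const_mul (v ^ (γ - 1) * (1 + L ^ 2 / v))).congr_deriv ?_
    simp

theorem stmt_1 (n : ℕ) (γ : ℝ) (hγ0 : 0 < γ) (hγ1 : γ < 1) (hn : 2 * γ < (n : ℝ)) :
    ∃ C : ℝ, 0 < C ∧
      ∀ (lam : ℝ), 0 < lam → ∀ (σ xb : EuclideanSpace ℝ (Fin n)) (xN : ℝ), 0 < xN →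
        ∀ m : ℕ, m ≤ 1 →
          ‖iteratedFDeriv ℝ m
              (fun y => deriv (fun t => bubbleExt n γ lam σ y t) xN) xb‖ ≤
            C * lam ^ (((n : ℝ) - 2 * γ) / 2) *
              (xN ^ (2 * γ - 1) /
                  (lam ^ ((n : ℝ) + (m : ℝ)) +
                    Real.sqrt (‖xb - σ‖ ^ 2 + xN ^ 2) ^ ((n : ℝ) + (m : ℝ))) +
                1 /
                  (lam ^ ((n : ℝ) - 2 * γ + 1 + (m : ℝ)) +
                    Real.sqrt (‖xb - σ‖ ^ 2 + xN ^ 2) ^ ((n : ℝ) - 2 * γ + 1 + (m : ℝ)))) := by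
  obtain ⟨K, hK⟩ := exists_bubbleExt_eq hγ0 hn
  have hn0 : (0 : ℝ) < n := by linarith
  obtain ⟨J, hJ, hbound⟩ : ∃ J : ℝ, 0 < J ∧ ∀ L s t : ℝ, 0 < L → 0 ≤ s → 0 < t →
      ∫ v in Set.Ioi (0 : ℝ), bubbleMajorant γ ((n : ℝ) / 2 + 1) L (s + L ^ 2 + t ^ 2)
        (L ^ 2 * t ^ 2) v ≤ J * (t ^ 2) ^ (γ - 1) * (s + L ^ 2 + t ^ 2) ^ (-((n : ℝ) / 2)) :=
    ⟨_, add_pos (betaPrimeIntegral_pos (k := (n : ℝ) / 2 + 1) hγ0 (by linarith))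
      (betaPrimeIntegral_pos (a := (n : ℝ) / 2 + γ) (k := (n : ℝ) / 2 + 1) (by linarith)
        (by linarith)), fun L s t hL hs ht =>
      integral_bubbleMajorant_le hγ0 hγ1 (by linarith) hL hs ht⟩
  refine ⟨2 * ((|K| + 1) * ((n : ℝ) * ((n : ℝ) + 2)) * J), by positivity,
    fun L hL σ x t ht m hm => ?_⟩
  have hderiv : (fun y => deriv (fun t => bubbleExt n γ L σ y t) t) = fun y =>
      K * L ^ (((n : ℝ) - 2 * γ) / 2) * (-(n * t)) * ∫ v in Set.Ioi (0 : ℝ),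
        v ^ (γ - 1) * (1 + L ^ 2 / v) *
          (‖y - σ‖ ^ 2 + (v + L ^ 2) * (v + t ^ 2) / v) ^ (-((n : ℝ) / 2 + 1)) := by
    funext y
    have h := ((hasDerivAt_integral_height (h := (n : ℝ) / 2) hγ0 hγ1 (by linarith) hL
      (sq_nonneg ‖y - σ‖) ht).const_mul (K * L ^ (((n : ℝ) - 2 * γ) / 2))).congr_of_eventuallyEq
      (f₁ := fun t => bubbleExt n γ L σ y t)
      (by filter_upwards [Ioi_mem_nhds ht] with r hr using hK L hL σ y r hr)
    rw [h.deriv]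
    ring
  rw [hderiv]
  set R := ‖x - σ‖ ^ 2 + L ^ 2 + t ^ 2 with hR
  have hR0 : 0 < R := by positivity
  have htpow : t * (t ^ 2) ^ (γ - 1) = t ^ (2 * γ - 1) := by
    nth_rw 1 [← Real.rpow_one t]
    rw [← Real.rpow_natCast t 2, ← Real.rpow_mul ht.le, ← Real.rpow_add ht]
    push_cast
    ring_nf
  have hpow : ∀ v ∈ Set.Ioi (0 : ℝ), v ^ (γ - 1) * (1 + L ^ 2 / v) *
      (‖x - σ‖ ^ 2 + (v + L ^ 2) * (v + t ^ 2) / v) ^ (-((n : ℝ) / 2 + 1)) ≤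
        bubbleMajorant γ ((n : ℝ) / 2 + 1) L R (L ^ 2 * t ^ 2) v := fun v hv =>
    rpow_mul_rpow_neg_le_bubbleMajorant (by positivity) hR0 (by positivity) hv le_rfl le_rfl
  have hint := integrableOn_bubbleMajorant (k := (n : ℝ) / 2 + 1) L hγ0 hγ1 (by linarith) hR0
    (c := L ^ 2 * t ^ 2) (by positivity)
  have hB := hbound L (‖x - σ‖ ^ 2) t hL (by positivity) ht
  rw [← hR] at hB
  have hmain : ‖iteratedFDeriv ℝ m (fun y => K * L ^ (((n : ℝ) - 2 * γ) / 2) * (-(n * t)) *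
      ∫ v in Set.Ioi (0 : ℝ), v ^ (γ - 1) * (1 + L ^ 2 / v) *
        (‖y - σ‖ ^ 2 + (v + L ^ 2) * (v + t ^ 2) / v) ^ (-((n : ℝ) / 2 + 1))) x‖ ≤
      ((|K| + 1) * ((n : ℝ) * ((n : ℝ) + 2)) * J) * L ^ (((n : ℝ) - 2 * γ) / 2) *
        (t ^ (2 * γ - 1) * R ^ (-(((n : ℝ) + m) / 2))) := by
    interval_cases m
    · rw [norm_iteratedFDeriv_zero, norm_mul, norm_mul, norm_mul, norm_neg, Real.norm_eq_abs K,
        Real.norm_of_nonneg (by positivity : 0 ≤ L ^ (((n : ℝ) - 2 * γ) / 2)),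
        Real.norm_of_nonneg (by positivity : 0 ≤ (n : ℝ) * t)]
      have h1 := norm_integral_le_of_norm_le (f := fun v : ℝ => v ^ (γ - 1) * (1 + L ^ 2 / v) *
        (‖x - σ‖ ^ 2 + (v + L ^ 2) * (v + t ^ 2) / v) ^ (-((n : ℝ) / 2 + 1))) hint (by
          filter_upwards [ae_restrict_mem measurableSet_Ioi] with v hv
          have hv0 : 0 < v := hv
          rw [Real.norm_of_nonneg (by positivity)]
          exact hpow v hv)
      have h2 := h1.trans hB
      have h3 : |K| * (n : ℝ) ≤ (|K| + 1) * ((n : ℝ) * ((n : ℝ) + 2)) := by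
        nlinarith [abs_nonneg K, mul_nonneg (abs_nonneg K) hn0.le,
          mul_nonneg (abs_nonneg K) (sq_nonneg (n : ℝ))]
      calc _ ≤ |K| * L ^ (((n : ℝ) - 2 * γ) / 2) * (n * t) *
            (J * (t ^ 2) ^ (γ - 1) * R ^ (-((n : ℝ) / 2))) := by gcongr
        _ = (|K| * n) * J * L ^ (((n : ℝ) - 2 * γ) / 2) *
            ((t * (t ^ 2) ^ (γ - 1)) * R ^ (-((n : ℝ) / 2))) := by ring
        _ ≤ _ := by
          rw [htpow, Nat.cast_zero, add_zero]
          gcongr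
    · rw [norm_iteratedFDeriv_one]
      have hs : HasFDerivAt (fun y : EuclideanSpace ℝ (Fin n) => ‖y - σ‖ ^ 2)
          (2 • innerSL ℝ (x - σ)) x := by
        simpa using ((hasFDerivAt_id x).sub_const σ).norm_sq
      have hd := hasDerivAt_integral_sq_dist (k := (n : ℝ) / 2 + 1) hγ0 hγ1 (by linarith) hL
        (sq_nonneg ‖x - σ‖) ht
      have hf := (hd.comp_hasFDerivAt x hs).const_mul
        (K * L ^ (((n : ℝ) - 2 * γ) / 2) * (-(n * t)))
      simp only [Function.comp_apply] at hf
      rw [hf.fderiv, norm_smul, norm_smul, norm_mul, norm_mul, norm_neg,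
        Real.norm_eq_abs K,
        Real.norm_of_nonneg (by positivity : 0 ≤ L ^ (((n : ℝ) - 2 * γ) / 2)),
        Real.norm_of_nonneg (by positivity : 0 ≤ (n : ℝ) * t), two_nsmul]
      have h1 := norm_integral_le_of_norm_le (f := fun v : ℝ => v ^ (γ - 1) * (1 + L ^ 2 / v) *
        (-((n : ℝ) / 2 + 1) * (‖x - σ‖ ^ 2 + (v + L ^ 2) * (v + t ^ 2) / v) ^
          (-((n : ℝ) / 2 + 1) - 1))) (hint.const_mul (((n : ℝ) / 2 + 1) * R⁻¹)) (by
          filter_upwards [ae_restrict_mem measurableSet_Ioi] with v hv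
          have hv0 : 0 < v := hv
          have hP0 : 0 < ‖x - σ‖ ^ 2 + (v + L ^ 2) * (v + t ^ 2) / v := by positivity
          have hRP : R ≤ ‖x - σ‖ ^ 2 + (v + L ^ 2) * (v + t ^ 2) / v := by
            have e : (v + L ^ 2) * (v + t ^ 2) / v =
                L ^ 2 + t ^ 2 + (v + L ^ 2 * t ^ 2 / v) := by
              field_simp
              ring
            have : 0 < v + L ^ 2 * t ^ 2 / v := by positivity
            linarith
          rw [Real.rpow_sub_one hP0.ne', neg_mul, mul_neg, norm_neg,
            Real.norm_of_nonneg (by positivity)]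
          calc _ = ((n : ℝ) / 2 + 1) * (‖x - σ‖ ^ 2 + (v + L ^ 2) * (v + t ^ 2) / v)⁻¹ *
                (v ^ (γ - 1) * (1 + L ^ 2 / v) *
                  (‖x - σ‖ ^ 2 + (v + L ^ 2) * (v + t ^ 2) / v) ^ (-((n : ℝ) / 2 + 1))) := by ring
            _ ≤ _ := by
              gcongr
              exact hpow v hv)
      rw [integral_const_mul] at h1
      have h2 : ‖innerSL ℝ (x - σ) + innerSL ℝ (x - σ)‖ ≤ 2 * R ^ (1 / 2 : ℝ) := by
        refine (norm_add_le _ _).trans ?_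
        rw [innerSL_apply_norm, ← two_mul, ← Real.sqrt_eq_rpow]
        gcongr
        refine Real.le_sqrt_of_sq_le ?_
        have := sq_nonneg L
        have := sq_nonneg t
        linarith
      have hRpow : R⁻¹ * R ^ (-((n : ℝ) / 2)) * R ^ (1 / 2 : ℝ) =
          R ^ (-(((n : ℝ) + (1 : ℕ)) / 2)) := by
        rw [← Real.rpow_neg_one, ← Real.rpow_add hR0, ← Real.rpow_add hR0]
        push_cast
        ring_nf
      calc _ ≤ |K| * L ^ (((n : ℝ) - 2 * γ) / 2) * (n * t) *
            (((n : ℝ) / 2 + 1) * R⁻¹ * (J * (t ^ 2) ^ (γ - 1) * R ^ (-((n : ℝ) / 2))) *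
              (2 * R ^ (1 / 2 : ℝ))) := by
            gcongr
            exact h1.trans (by gcongr)
        _ = (|K| * (n * (n + 2))) * J * L ^ (((n : ℝ) - 2 * γ) / 2) *
            ((t * (t ^ 2) ^ (γ - 1)) * (R⁻¹ * R ^ (-((n : ℝ) / 2)) * R ^ (1 / 2 : ℝ))) := by ring
        _ ≤ _ := by
          rw [htpow, hRpow]
          gcongr
          linarith
  have hdenom : L ^ ((n : ℝ) + m) + √(‖x - σ‖ ^ 2 + t ^ 2) ^ ((n : ℝ) + m) ≤
      2 * R ^ (((n : ℝ) + m) / 2) := by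
    have e : R ^ (((n : ℝ) + m) / 2) = √R ^ ((n : ℝ) + m) := by
      rw [Real.sqrt_eq_rpow, ← Real.rpow_mul hR0.le]
      ring_nf
    have h1 : L ≤ √R := Real.le_sqrt_of_sq_le (by rw [hR]; nlinarith [sq_nonneg ‖x - σ‖])
    have h2 : √(‖x - σ‖ ^ 2 + t ^ 2) ≤ √R := Real.sqrt_le_sqrt (by rw [hR]; nlinarith)
    rw [e, two_mul]
    gcongr
  have hRdenom : R ^ (-(((n : ℝ) + m) / 2)) ≤
      2 / (L ^ ((n : ℝ) + m) + √(‖x - σ‖ ^ 2 + t ^ 2) ^ ((n : ℝ) + m)) := by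
    rw [Real.rpow_neg hR0.le, le_div_iff₀ (by positivity), inv_mul_le_iff₀ (by positivity)]
    linarith
  refine hmain.trans ?_
  calc _ ≤ ((|K| + 1) * ((n : ℝ) * ((n : ℝ) + 2)) * J) * L ^ (((n : ℝ) - 2 * γ) / 2) *
        (t ^ (2 * γ - 1) *
          (2 / (L ^ ((n : ℝ) + m) + √(‖x - σ‖ ^ 2 + t ^ 2) ^ ((n : ℝ) + m)))) := by gcongr
    _ = 2 * ((|K| + 1) * ((n : ℝ) * ((n : ℝ) + 2)) * J) * L ^ (((n : ℝ) - 2 * γ) / 2) *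
        (t ^ (2 * γ - 1) / (L ^ ((n : ℝ) + m) + √(‖x - σ‖ ^ 2 + t ^ 2) ^ ((n : ℝ) + m))) := by
      ring
    _ ≤ _ := by
      gcongr
      exact le_add_of_nonneg_right (by positivity)

end
end

section
/- Let 2γ < κ < n and let ζ : ℝⁿ → ℝ be measurable with ‖ζ‖ := sup_{x̄ ∈ ℝⁿ} (1 + |x̄|^κ)|ζ(x̄)| < ∞. Define U(x̄, x_N) = (1/|S^{n-1}|) · (2^{1-2γ} Γ((n-2γ)/2) / (Γ(n/2) Γ(γ))) ∫_{ℝⁿ} (|x̄ - ȳ|² + x_N²)^{-(n-2γ)/2} ζ(ȳ) dȳ for (x̄, x_N) ∈ ℝ^N_+. Then there exists a constant C > 0 depending only on N, γ and κ such that for every x = (x̄, x_N) ∈ ℝ^N_+, |∂_{x_N} U(x)| ≤ C ‖ζ‖ ( 1/(1 + |x|^{κ-2γ+1}) + x_N^{2γ-1}/(1 + |x̄|^κ) ). -/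
open MeasureTheory Real Filter Topology

noncomputable section

/-- The total surface measure `|S^{n-1}|` of the unit sphere in `ℝⁿ`. -/
def sphereConst (n : ℕ) : ℝ := 2 * Real.pi ^ ((n : ℝ) / 2) / Real.Gamma ((n : ℝ) / 2)

/-- The function `U` defined by Green's representation formula from a boundary datum `ζ`. -/
def greenU (n : ℕ) (γ : ℝ) (ζ : EuclideanSpace ℝ (Fin n) → ℝ)
    (x : EuclideanSpace ℝ (Fin n)) (xN : ℝ) : ℝ :=
  (1 / sphereConst n) *
    (2 ^ (1 - 2 * γ) * Real.Gamma (((n : ℝ) - 2 * γ) / 2) /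
      (Real.Gamma ((n : ℝ) / 2) * Real.Gamma γ)) *
    ∫ y : EuclideanSpace ℝ (Fin n),
      (‖x - y‖ ^ 2 + xN ^ 2) ^ (-(((n : ℝ) - 2 * γ) / 2)) * ζ y

local notation "𝔼" n => EuclideanSpace ℝ (Fin n)

/-- The constant normalising the kernel of `greenU`. -/
def greenConst (n : ℕ) (γ : ℝ) : ℝ :=
  (1 / sphereConst n) *
    (2 ^ (1 - 2 * γ) * Real.Gamma (((n : ℝ) - 2 * γ) / 2) /
      (Real.Gamma ((n : ℝ) / 2) * Real.Gamma γ))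

lemma integrable_one_add_norm_sq_rpow {n : ℕ} {b : ℝ} (hb : (n : ℝ) < 2 * b) :
    Integrable (fun y : 𝔼 n => (1 + ‖y‖ ^ 2) ^ (-b)) := by
  have h := integrable_rpow_neg_one_add_norm_sq (E := 𝔼 n) (μ := volume) (r := 2 * b)
    (by simpa using hb)
  convert h using 3
  ring

lemma norm_sub_sq_add_sq_rpow_eq {n : ℕ} {t : ℝ} (ht : 0 < t) (b : ℝ) (z : 𝔼 n) :
    (‖z‖ ^ 2 + t ^ 2) ^ (-b) = t ^ (-(2 * b)) * (1 + ‖t⁻¹ • z‖ ^ 2) ^ (-b) := by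
  have h : ‖z‖ ^ 2 + t ^ 2 = t ^ 2 * (1 + ‖t⁻¹ • z‖ ^ 2) := by
    rw [norm_smul, Real.norm_of_nonneg (by positivity)]
    field_simp
    ring
  rw [h, Real.mul_rpow (by positivity) (by positivity), ← Real.rpow_natCast t 2,
    ← Real.rpow_mul ht.le]
  congr 2
  push_cast
  ring

lemma integrable_norm_sub_sq_add_sq_rpow {n : ℕ} {b t : ℝ} (hb : (n : ℝ) < 2 * b) (ht : 0 < t)
    (x : 𝔼 n) : Integrable (fun y : 𝔼 n => (‖x - y‖ ^ 2 + t ^ 2) ^ (-b)) := by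
  have h : Integrable (fun z : 𝔼 n => (‖z‖ ^ 2 + t ^ 2) ^ (-b)) := by
    simp_rw [norm_sub_sq_add_sq_rpow_eq ht b]
    exact ((integrable_one_add_norm_sq_rpow hb).comp_smul (inv_ne_zero ht.ne')).const_mul _
  exact h.comp_sub_left x

lemma integral_norm_sub_sq_add_sq_rpow {n : ℕ} (b : ℝ) {t : ℝ} (ht : 0 < t) (x : 𝔼 n) :
    ∫ y : 𝔼 n, (‖x - y‖ ^ 2 + t ^ 2) ^ (-b) =
      t ^ ((n : ℝ) - 2 * b) * ∫ z : 𝔼 n, (1 + ‖z‖ ^ 2) ^ (-b) := by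
  rw [integral_sub_left_eq_self (fun z : 𝔼 n => (‖z‖ ^ 2 + t ^ 2) ^ (-b)) volume x]
  simp_rw [norm_sub_sq_add_sq_rpow_eq ht b]
  rw [integral_const_mul,
    Measure.integral_comp_inv_smul_of_nonneg volume (fun z : 𝔼 n => (1 + ‖z‖ ^ 2) ^ (-b)) ht.le,
    smul_eq_mul, ← mul_assoc, finrank_euclideanSpace_fin, ← Real.rpow_natCast, ← Real.rpow_add ht]
  congr 2
  ring

lemma integrableOn_ball_norm_rpow_neg {n : ℕ} (hn : 0 < n) {κ : ℝ} (hκ : κ < n) (R : ℝ) :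
    IntegrableOn (fun y : 𝔼 n => ‖y‖ ^ (-κ)) (Metric.ball 0 R) := by
  refine integrableOn_ball_of_norm_le_rpow (C := 1) (α := κ) ?_ (by simpa using hκ) ?_ ?_
  · simpa using Nat.succ_le_of_lt hn
  · refine Eventually.of_forall fun y => ?_
    rw [Real.norm_of_nonneg (by positivity), one_mul]
  · exact Measurable.aestronglyMeasurable (by fun_prop)

lemma setIntegral_ball_norm_rpow_neg (n : ℕ) (κ : ℝ) {R : ℝ} (hR : 0 < R) :
    ∫ y in Metric.ball (0 : 𝔼 n) R, ‖y‖ ^ (-κ) =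
      R ^ ((n : ℝ) - κ) * ∫ y in Metric.ball (0 : 𝔼 n) 1, ‖y‖ ^ (-κ) := by
  have h := Measure.setIntegral_comp_smul_of_pos volume (fun y : 𝔼 n => ‖y‖ ^ (-κ))
    (Metric.ball 0 1) hR
  rw [smul_unitBall_of_pos hR, smul_eq_mul, finrank_euclideanSpace_fin] at h
  have h2 : ∀ y : 𝔼 n, ‖R • y‖ ^ (-κ) = R ^ (-κ) * ‖y‖ ^ (-κ) := fun y => by
    rw [norm_smul, Real.norm_of_nonneg hR.le, Real.mul_rpow hR.le (norm_nonneg _)]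
  simp_rw [h2] at h
  rw [integral_const_mul] at h
  rw [sub_eq_add_neg, Real.rpow_add hR, mul_assoc, h, Real.rpow_natCast]
  field_simp

lemma one_add_norm_sq_rpow_le {n : ℕ} {κ : ℝ} (hκ : 0 < κ) (y : 𝔼 n) :
    (1 + ‖y‖ ^ 2) ^ (κ / 2) ≤ 2 ^ (κ / 2) * (1 + ‖y‖ ^ κ) := by
  have hy : (‖y‖ ^ 2) ^ (κ / 2) = ‖y‖ ^ κ := by
    rw [← Real.rpow_natCast, ← Real.rpow_mul (norm_nonneg _)]
    congr 1
    push_cast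
    ring
  have h0 : 0 ≤ ‖y‖ ^ κ := by positivity
  rcases le_total (‖y‖ ^ 2) 1 with h | h
  · calc (1 + ‖y‖ ^ 2) ^ (κ / 2) ≤ 2 ^ (κ / 2) := by gcongr; linarith
      _ ≤ 2 ^ (κ / 2) * (1 + ‖y‖ ^ κ) := le_mul_of_one_le_right (by positivity) (by linarith)
  · calc (1 + ‖y‖ ^ 2) ^ (κ / 2) ≤ (2 * ‖y‖ ^ 2) ^ (κ / 2) := by gcongr; linarith
      _ = 2 ^ (κ / 2) * ‖y‖ ^ κ := by rw [Real.mul_rpow (by norm_num) (by positivity), hy]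
      _ ≤ 2 ^ (κ / 2) * (1 + ‖y‖ ^ κ) := by gcongr; linarith

lemma one_add_norm_sq_le {n : ℕ} {t : ℝ} (ht : 0 < t) (x y : 𝔼 n) :
    1 + ‖y‖ ^ 2 ≤ (2 + (1 + 2 * ‖x‖ ^ 2) / t ^ 2) * (‖x - y‖ ^ 2 + t ^ 2) := by
  have h1 : ‖y‖ ≤ ‖x‖ + ‖x - y‖ := by
    have := norm_sub_le x (x - y)
    simpa using this
  have h2 : ‖y‖ ^ 2 ≤ 2 * ‖x‖ ^ 2 + 2 * ‖x - y‖ ^ 2 := by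
    nlinarith [sq_nonneg (‖x‖ - ‖x - y‖), norm_nonneg y]
  have h3 : (1 + 2 * ‖x‖ ^ 2) / t ^ 2 * t ^ 2 = 1 + 2 * ‖x‖ ^ 2 := by field_simp
  have h4 : 0 ≤ (1 + 2 * ‖x‖ ^ 2) / t ^ 2 * ‖x - y‖ ^ 2 := by positivity
  nlinarith [sq_nonneg t]

/-- The integrand of `greenU` is integrable. -/
lemma integrable_kernel_mul {n : ℕ} {s κ M t : ℝ} (hs : 0 < s) (hκ : 0 < κ)
    (hsκ : (n : ℝ) < 2 * s + κ) {ζ : (𝔼 n) → ℝ} (hζ : Measurable ζ)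
    (hM : ∀ x, (1 + ‖x‖ ^ κ) * |ζ x| ≤ M) (ht : 0 < t) (x : 𝔼 n) :
    Integrable (fun y : 𝔼 n => (‖x - y‖ ^ 2 + t ^ 2) ^ (-s) * ζ y) := by
  have hM0 : 0 ≤ M := le_trans (by positivity) (hM 0)
  set c := 2 + (1 + 2 * ‖x‖ ^ 2) / t ^ 2 with hc
  have hc0 : 0 < c := by positivity
  have hI := (integrable_one_add_norm_sq_rpow (n := n) (b := s + κ / 2) (by linarith)).const_mul
    (c ^ s * (2 ^ (κ / 2) * M))
  refine hI.mono' (Measurable.aestronglyMeasurable (by fun_prop)) (Eventually.of_forall fun y => ?_)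
  have hk : 0 < ‖x - y‖ ^ 2 + t ^ 2 := by positivity
  have hy : 0 < 1 + ‖y‖ ^ 2 := by positivity
  have h1 : (‖x - y‖ ^ 2 + t ^ 2) ^ (-s) ≤ c ^ s * (1 + ‖y‖ ^ 2) ^ (-s) := by
    have h := Real.rpow_le_rpow hy.le (one_add_norm_sq_le ht x y) hs.le
    rw [← hc, Real.mul_rpow hc0.le hk.le] at h
    rw [Real.rpow_neg hk.le, Real.rpow_neg hy.le, ← div_eq_mul_inv, inv_eq_one_div,
      div_le_div_iff₀ (by positivity) (by positivity)]
    linarith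
  have h2 : |ζ y| ≤ 2 ^ (κ / 2) * M * (1 + ‖y‖ ^ 2) ^ (-(κ / 2)) := by
    rw [Real.rpow_neg hy.le, ← div_eq_mul_inv, le_div_iff₀ (by positivity)]
    calc |ζ y| * (1 + ‖y‖ ^ 2) ^ (κ / 2) ≤ |ζ y| * (2 ^ (κ / 2) * (1 + ‖y‖ ^ κ)) := by
          gcongr; exact one_add_norm_sq_rpow_le hκ y
      _ = 2 ^ (κ / 2) * ((1 + ‖y‖ ^ κ) * |ζ y|) := by ring
      _ ≤ 2 ^ (κ / 2) * M := by gcongr; exact hM y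
  rw [norm_mul, Real.norm_of_nonneg (by positivity), Real.norm_eq_abs]
  calc _ ≤ (c ^ s * (1 + ‖y‖ ^ 2) ^ (-s)) * (2 ^ (κ / 2) * M * (1 + ‖y‖ ^ 2) ^ (-(κ / 2))) := by
        gcongr
    _ = _ := by
        rw [neg_add, Real.rpow_add hy]
        ring

lemma abs_le_of_weighted {n : ℕ} {κ M : ℝ} {ζ : (𝔼 n) → ℝ}
    (hM : ∀ x, (1 + ‖x‖ ^ κ) * |ζ x| ≤ M) (y : 𝔼 n) : |ζ y| ≤ M :=
  (le_mul_of_one_le_left (abs_nonneg _) (by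
    have : 0 ≤ ‖y‖ ^ κ := by positivity
    linarith)).trans (hM y)

/-- Differentiation of the kernel integral in the normal variable. -/
lemma hasDerivAt_integral_kernel {n : ℕ} {s κ M t : ℝ} (hs : 0 < s) (hsn : (n : ℝ) < 2 * (s + 1))
    (hκ : 0 < κ) (hsκ : (n : ℝ) < 2 * s + κ) {ζ : (𝔼 n) → ℝ} (hζ : Measurable ζ)
    (hM : ∀ x, (1 + ‖x‖ ^ κ) * |ζ x| ≤ M) (ht : 0 < t) (x : 𝔼 n) :
    HasDerivAt (fun r => ∫ y : 𝔼 n, (‖x - y‖ ^ 2 + r ^ 2) ^ (-s) * ζ y)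
      (∫ y : 𝔼 n, -(2 * s * t * (‖x - y‖ ^ 2 + t ^ 2) ^ (-(s + 1)) * ζ y)) t := by
  have hM0 : 0 ≤ M := le_trans (by positivity) (hM 0)
  have hI := (integrable_norm_sub_sq_add_sq_rpow hsn (half_pos ht) x).const_mul
    (2 * s * (2 * t) * M)
  have hnhds : Set.Ioo (t / 2) (2 * t) ∈ 𝓝 t := Ioo_mem_nhds (by linarith) (by linarith)
  refine (hasDerivAt_integral_of_dominated_loc_of_deriv_le (μ := volume)
    (F := fun r (y : 𝔼 n) => (‖x - y‖ ^ 2 + r ^ 2) ^ (-s) * ζ y)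
    (F' := fun r (y : 𝔼 n) => -(2 * s * r * (‖x - y‖ ^ 2 + r ^ 2) ^ (-(s + 1)) * ζ y))
    hnhds (Eventually.of_forall fun r => Measurable.aestronglyMeasurable (by fun_prop))
    (integrable_kernel_mul hs hκ hsκ hζ hM ht x)
    (Measurable.aestronglyMeasurable (by fun_prop))
    (Eventually.of_forall fun y r hr => ?_) hI (Eventually.of_forall fun y r hr => ?_)).2
  · have hr0 : 0 < r := lt_trans (by positivity) hr.1
    rw [norm_neg, norm_mul, Real.norm_of_nonneg (by positivity), Real.norm_eq_abs]
    have h1 : (‖x - y‖ ^ 2 + r ^ 2) ^ (-(s + 1)) ≤ (‖x - y‖ ^ 2 + (t / 2) ^ 2) ^ (-(s + 1)) := by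
      apply Real.rpow_le_rpow_of_nonpos (by positivity) _ (by linarith)
      gcongr
      exact hr.1.le
    calc _ ≤ 2 * s * (2 * t) * (‖x - y‖ ^ 2 + (t / 2) ^ 2) ^ (-(s + 1)) * M := by
          gcongr
          · exact hr.2.le
          · exact abs_le_of_weighted hM y
      _ = _ := by ring
  · have hr0 : 0 < r := lt_trans (by positivity) hr.1
    have h1 : HasDerivAt (fun r : ℝ => ‖x - y‖ ^ 2 + r ^ 2) (2 * r) r := by
      simpa using (hasDerivAt_pow 2 r).const_add (‖x - y‖ ^ 2)
    have h2 := (h1.rpow_const (p := -s) (Or.inl (by positivity))).mul_const (ζ y)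
    refine h2.congr_deriv ?_
    rw [show -(s + 1) = -s - 1 by ring]
    ring

/-- Pointwise bound for the integrand: where `‖x‖ ≤ 2 * ‖y‖` the weight at `y` controls the weight
at `x`, elsewhere the kernel is comparable to its value at `y = 0`. -/
lemma kernel_mul_abs_le {n : ℕ} {b κ M t : ℝ} (hb : 0 < b) (hκ : 0 < κ) {ζ : (𝔼 n) → ℝ}
    (hM : ∀ x, (1 + ‖x‖ ^ κ) * |ζ x| ≤ M) (ht : 0 < t) (x : 𝔼 n)
    {y : 𝔼 n} (hy : y ≠ 0) :
    (‖x - y‖ ^ 2 + t ^ 2) ^ (-b) * |ζ y| ≤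
      2 ^ κ * M / (1 + ‖x‖ ^ κ) * (‖x - y‖ ^ 2 + t ^ 2) ^ (-b) +
        M * 4 ^ b * (‖x‖ ^ 2 + t ^ 2) ^ (-b) *
          (Metric.ball (0 : 𝔼 n) √(‖x‖ ^ 2 + t ^ 2)).indicator (fun z => ‖z‖ ^ (-κ)) y := by
  have hM0 : 0 ≤ M := le_trans (by positivity) (hM 0)
  have hind : 0 ≤ (Metric.ball (0 : 𝔼 n) √(‖x‖ ^ 2 + t ^ 2)).indicator
      (fun z => ‖z‖ ^ (-κ)) y := Set.indicator_nonneg (fun z _ => by positivity) y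
  rcases le_or_gt ‖x‖ (2 * ‖y‖) with h | h
  · have h1 : 1 + ‖x‖ ^ κ ≤ 2 ^ κ * (1 + ‖y‖ ^ κ) := by
      have h2 : ‖x‖ ^ κ ≤ 2 ^ κ * ‖y‖ ^ κ := by
        rw [← Real.mul_rpow (by norm_num) (norm_nonneg _)]
        gcongr
      have h3 : (1 : ℝ) ≤ 2 ^ κ := Real.one_le_rpow (by norm_num) hκ.le
      linarith
    have h4 : |ζ y| ≤ 2 ^ κ * M / (1 + ‖x‖ ^ κ) := by
      rw [le_div_iff₀ (by positivity)]
      calc |ζ y| * (1 + ‖x‖ ^ κ) ≤ |ζ y| * (2 ^ κ * (1 + ‖y‖ ^ κ)) := by gcongr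
        _ = 2 ^ κ * ((1 + ‖y‖ ^ κ) * |ζ y|) := by ring
        _ ≤ 2 ^ κ * M := by gcongr; exact hM y
    refine le_add_of_le_of_nonneg ?_ (by positivity)
    rw [mul_comm]
    gcongr
  · refine le_add_of_nonneg_of_le (by positivity) ?_
    have hy0 : 0 < ‖y‖ := norm_pos_iff.mpr hy
    have hmem : y ∈ Metric.ball (0 : 𝔼 n) √(‖x‖ ^ 2 + t ^ 2) := by
      rw [mem_ball_zero_iff]
      exact Real.lt_sqrt_of_sq_lt (by nlinarith)
    rw [Set.indicator_of_mem hmem]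
    have h1 : ‖x‖ / 2 ≤ ‖x - y‖ := by
      have := norm_sub_norm_le x y
      linarith
    have h2 : (‖x - y‖ ^ 2 + t ^ 2) ^ (-b) ≤ 4 ^ b * (‖x‖ ^ 2 + t ^ 2) ^ (-b) := by
      have h3 : (‖x‖ ^ 2 + t ^ 2) / 4 ≤ ‖x - y‖ ^ 2 + t ^ 2 := by
        nlinarith [norm_nonneg x, sq_nonneg t]
      calc _ ≤ ((‖x‖ ^ 2 + t ^ 2) / 4) ^ (-b) :=
            Real.rpow_le_rpow_of_nonpos (by positivity) h3 (by linarith)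
        _ = _ := by
          rw [Real.div_rpow (by positivity) (by norm_num), Real.rpow_neg (x := 4) (by norm_num),
            div_inv_eq_mul, mul_comm]
    have h4 : |ζ y| ≤ M * ‖y‖ ^ (-κ) := by
      rw [Real.rpow_neg hy0.le, ← div_eq_mul_inv, le_div_iff₀ (by positivity)]
      have := hM y
      nlinarith [abs_nonneg (ζ y)]
    calc _ ≤ (4 ^ b * (‖x‖ ^ 2 + t ^ 2) ^ (-b)) * (M * ‖y‖ ^ (-κ)) := by gcongr
      _ = _ := by ring

lemma integral_kernel_mul_abs_le {n : ℕ} (hn : 0 < n) {b κ M t : ℝ} (hb : (n : ℝ) < 2 * b)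
    (hκ : 0 < κ) (hκn : κ < n) {ζ : (𝔼 n) → ℝ}
    (hM : ∀ x, (1 + ‖x‖ ^ κ) * |ζ x| ≤ M) (ht : 0 < t) (x : 𝔼 n) :
    ∫ y : 𝔼 n, (‖x - y‖ ^ 2 + t ^ 2) ^ (-b) * |ζ y| ≤
      2 ^ κ * M / (1 + ‖x‖ ^ κ) *
          (t ^ ((n : ℝ) - 2 * b) * ∫ z : 𝔼 n, (1 + ‖z‖ ^ 2) ^ (-b)) +
        M * 4 ^ b * (‖x‖ ^ 2 + t ^ 2) ^ (-b) *
          (√(‖x‖ ^ 2 + t ^ 2) ^ ((n : ℝ) - κ) *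
            ∫ y in Metric.ball (0 : 𝔼 n) 1, ‖y‖ ^ (-κ)) := by
  have hb0 : 0 < b := by
    have : (0 : ℝ) ≤ n := n.cast_nonneg
    linarith
  have : Nonempty (Fin n) := ⟨⟨0, hn⟩⟩
  have hR : 0 < √(‖x‖ ^ 2 + t ^ 2) := by positivity
  have hI1 := (integrable_norm_sub_sq_add_sq_rpow hb ht x).const_mul (2 ^ κ * M / (1 + ‖x‖ ^ κ))
  have hI2 := ((integrableOn_ball_norm_rpow_neg hn hκn √(‖x‖ ^ 2 + t ^ 2)).integrable_indicator
    measurableSet_ball).const_mul (M * 4 ^ b * (‖x‖ ^ 2 + t ^ 2) ^ (-b))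
  have hne : ∀ᵐ y : 𝔼 n, y ≠ 0 := by simp [ae_iff]
  refine (integral_mono_of_nonneg (Eventually.of_forall fun y => by positivity)
    (hI1.add hI2) ?_).trans_eq ?_
  · filter_upwards [hne] with y hy
    exact kernel_mul_abs_le hb0 hκ hM ht x hy
  · rw [integral_add' hI1 hI2, integral_const_mul, integral_const_mul,
      integral_norm_sub_sq_add_sq_rpow b ht, integral_indicator measurableSet_ball,
      setIntegral_ball_norm_rpow_neg n κ hR]

lemma inv_rpow_le_two_div {R p : ℝ} (hR : 1 ≤ R) (hp : 0 ≤ p) :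
    R ^ (-p) ≤ 2 * (1 / (1 + R ^ p)) := by
  have h1 : 1 ≤ R ^ p := Real.one_le_rpow hR hp
  rw [Real.rpow_neg (by linarith), inv_eq_one_div, mul_one_div,
    div_le_div_iff₀ (by linarith) (by linarith)]
  linarith

/-- The weighted bound for the normal derivative of the kernel integral. -/
lemma exists_mul_integral_kernel_le {n : ℕ} {γ κ : ℝ} (hγ0 : 0 < γ) (hγ1 : γ < 1)
    (hκ1 : 2 * γ < κ) (hκ2 : κ < (n : ℝ)) :
    ∃ C : ℝ, 0 ≤ C ∧ ∀ (ζ : (𝔼 n) → ℝ) (M : ℝ), (∀ x, (1 + ‖x‖ ^ κ) * |ζ x| ≤ M) →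
      ∀ (x : 𝔼 n) (t : ℝ), 0 < t →
        t * ∫ y : 𝔼 n, (‖x - y‖ ^ 2 + t ^ 2) ^ (-(((n : ℝ) - 2 * γ) / 2 + 1)) * |ζ y| ≤
          C * M * (1 / (1 + √(‖x‖ ^ 2 + t ^ 2) ^ (κ - 2 * γ + 1)) +
            t ^ (2 * γ - 1) / (1 + ‖x‖ ^ κ)) := by
  set b := ((n : ℝ) - 2 * γ) / 2 + 1 with hbdef
  have hn0 : 0 < n := by
    have : (0 : ℝ) < n := by linarith
    exact_mod_cast this
  have hκ : 0 < κ := by linarith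
  have hb : (n : ℝ) < 2 * b := by rw [hbdef]; linarith
  set J₁ := ∫ z : 𝔼 n, (1 + ‖z‖ ^ 2) ^ (-b) with hJ₁
  set J₂ := ∫ y in Metric.ball (0 : 𝔼 n) 1, ‖y‖ ^ (-κ) with hJ₂
  have hJ₁0 : 0 ≤ J₁ := integral_nonneg fun z => by positivity
  have hJ₂0 : 0 ≤ J₂ := integral_nonneg fun z => by positivity
  refine ⟨2 ^ κ * J₁ + 2 * 4 ^ b * J₂ + 2 * J₁, by positivity, fun ζ M hM x t ht => ?_⟩
  have hM0 : 0 ≤ M := le_trans (by positivity) (hM 0)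
  have htpow : t * t ^ ((n : ℝ) - 2 * b) = t ^ (2 * γ - 1) := by
    nth_rewrite 1 [← Real.rpow_one t]
    rw [← Real.rpow_add ht]
    congr 1
    rw [hbdef]
    ring
  set R := √(‖x‖ ^ 2 + t ^ 2) with hRdef
  have hR0 : 0 < R := by positivity
  have hRsq : ‖x‖ ^ 2 + t ^ 2 = R ^ 2 := (Real.sq_sqrt (by positivity)).symm
  set A := 1 / (1 + R ^ (κ - 2 * γ + 1)) with hA
  set B := t ^ (2 * γ - 1) / (1 + ‖x‖ ^ κ) with hB
  have hA0 : 0 ≤ A := by positivity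
  have hB0 : 0 ≤ B := by positivity
  rcases le_or_gt 1 R with h1 | h1
  · have htR : t ≤ R := Real.le_sqrt_of_sq_le (by nlinarith [sq_nonneg ‖x‖])
    have hRpow : t * ((R ^ 2) ^ (-b) * R ^ ((n : ℝ) - κ)) ≤ 2 * A := by
      calc t * ((R ^ 2) ^ (-b) * R ^ ((n : ℝ) - κ))
          ≤ R * ((R ^ 2) ^ (-b) * R ^ ((n : ℝ) - κ)) := by gcongr
        _ = R ^ (1 : ℝ) * (R ^ (2 * -b) * R ^ ((n : ℝ) - κ)) := by
          rw [Real.rpow_one, Real.rpow_mul hR0.le, Real.rpow_two]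
        _ = R ^ (-(κ - 2 * γ + 1)) := by
          rw [← Real.rpow_add hR0, ← Real.rpow_add hR0, hbdef]
          congr 1
          ring
        _ ≤ 2 * A := inv_rpow_le_two_div h1 (by linarith)
    calc t * ∫ y : 𝔼 n, (‖x - y‖ ^ 2 + t ^ 2) ^ (-b) * |ζ y|
        ≤ t * (2 ^ κ * M / (1 + ‖x‖ ^ κ) * (t ^ ((n : ℝ) - 2 * b) * J₁) +
          M * 4 ^ b * (‖x‖ ^ 2 + t ^ 2) ^ (-b) * (R ^ ((n : ℝ) - κ) * J₂)) := by
          gcongr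
          exact integral_kernel_mul_abs_le hn0 hb hκ hκ2 hM ht x
      _ = 2 ^ κ * J₁ * M * ((t * t ^ ((n : ℝ) - 2 * b)) / (1 + ‖x‖ ^ κ)) +
          4 ^ b * J₂ * M * (t * ((R ^ 2) ^ (-b) * R ^ ((n : ℝ) - κ))) := by
          rw [hRsq]
          ring
      _ ≤ 2 ^ κ * J₁ * M * B + 4 ^ b * J₂ * M * (2 * A) := by
          rw [htpow]
          gcongr
      _ = (2 ^ κ * J₁) * M * B + (2 * 4 ^ b * J₂) * M * A := by ring
      _ ≤ (2 ^ κ * J₁ + 2 * 4 ^ b * J₂ + 2 * J₁) * M * B +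
          (2 ^ κ * J₁ + 2 * 4 ^ b * J₂ + 2 * J₁) * M * A := by
          have h2 : 0 ≤ 2 ^ κ * J₁ := by positivity
          have h3 : 0 ≤ 2 * 4 ^ b * J₂ := by positivity
          gcongr <;> linarith
      _ = _ := by ring
  · have hx1 : ‖x‖ ≤ 1 := by
      have : ‖x‖ ≤ R := Real.le_sqrt_of_sq_le (by nlinarith [sq_nonneg t])
      linarith
    have hx2 : ‖x‖ ^ κ ≤ 1 := Real.rpow_le_one (norm_nonneg _) hx1 hκ.le
    have hB2 : t ^ (2 * γ - 1) ≤ 2 * B := by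
      rw [hB, ← mul_div_assoc, le_div_iff₀ (by positivity)]
      nlinarith [Real.rpow_nonneg ht.le (2 * γ - 1)]
    have hint : ∫ y : 𝔼 n, (‖x - y‖ ^ 2 + t ^ 2) ^ (-b) * |ζ y| ≤
        (t ^ ((n : ℝ) - 2 * b) * J₁) * M := by
      rw [← integral_norm_sub_sq_add_sq_rpow b ht x, ← integral_mul_const]
      refine integral_mono_of_nonneg (Eventually.of_forall fun y => by positivity)
        ((integrable_norm_sub_sq_add_sq_rpow hb ht x).mul_const M)
        (Eventually.of_forall fun y => ?_)
      exact mul_le_mul_of_nonneg_left (abs_le_of_weighted hM y) (by positivity)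
    calc t * ∫ y : 𝔼 n, (‖x - y‖ ^ 2 + t ^ 2) ^ (-b) * |ζ y|
        ≤ t * ((t ^ ((n : ℝ) - 2 * b) * J₁) * M) := by gcongr
      _ = J₁ * M * (t * t ^ ((n : ℝ) - 2 * b)) := by ring
      _ ≤ J₁ * M * (2 * B) := by rw [htpow]; gcongr
      _ = (2 * J₁) * M * (0 + B) := by ring
      _ ≤ (2 ^ κ * J₁ + 2 * 4 ^ b * J₂ + 2 * J₁) * M * (A + B) := by
          have h2 : 0 ≤ 2 ^ κ * J₁ := by positivity
          have h3 : 0 ≤ 2 * 4 ^ b * J₂ := by positivity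
          gcongr
          linarith

theorem stmt_5 (n : ℕ) (γ κ : ℝ) (hγ0 : 0 < γ) (hγ1 : γ < 1) (hn : 2 * γ < (n : ℝ))
    (hκ1 : 2 * γ < κ) (hκ2 : κ < (n : ℝ)) :
    ∃ C : ℝ, 0 < C ∧
      ∀ ζ : EuclideanSpace ℝ (Fin n) → ℝ, Measurable ζ →
        ∀ M : ℝ, (∀ x, (1 + ‖x‖ ^ κ) * |ζ x| ≤ M) →
          ∀ (xb : EuclideanSpace ℝ (Fin n)) (xN : ℝ), 0 < xN →
            |deriv (fun t => greenU n γ ζ xb t) xN| ≤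
              C * M * (1 / (1 + Real.sqrt (‖xb‖ ^ 2 + xN ^ 2) ^ (κ - 2 * γ + 1)) +
                xN ^ (2 * γ - 1) / (1 + ‖xb‖ ^ κ)) := by
  obtain ⟨C, hC0, hC⟩ := exists_mul_integral_kernel_le hγ0 hγ1 hκ1 hκ2
  set s := ((n : ℝ) - 2 * γ) / 2 with hsdef
  have hs : 0 < s := by rw [hsdef]; linarith
  refine ⟨|greenConst n γ| * (2 * s) * C + 1, by positivity, fun ζ hζ M hM x t ht => ?_⟩
  have hM0 : 0 ≤ M := le_trans (by positivity) (hM 0)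
  have hd : HasDerivAt (fun r => greenU n γ ζ x r) _ t :=
    (hasDerivAt_integral_kernel hs (by rw [hsdef]; linarith) (by linarith)
      (by rw [hsdef]; linarith) hζ hM ht x).const_mul (greenConst n γ)
  have hbound : |∫ y : 𝔼 n, -(2 * s * t * (‖x - y‖ ^ 2 + t ^ 2) ^ (-(s + 1)) * ζ y)| ≤
      2 * s * (t * ∫ y : 𝔼 n, (‖x - y‖ ^ 2 + t ^ 2) ^ (-(s + 1)) * |ζ y|) := by
    refine (abs_integral_le_integral_abs).trans_eq ?_
    rw [← mul_assoc, ← integral_const_mul]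
    congr 1 with y
    rw [abs_neg, abs_mul, abs_of_nonneg (by positivity), mul_assoc]
  rw [hd.deriv, abs_mul]
  set W := 1 / (1 + √(‖x‖ ^ 2 + t ^ 2) ^ (κ - 2 * γ + 1)) + t ^ (2 * γ - 1) / (1 + ‖x‖ ^ κ)
    with hW
  have hW0 : 0 ≤ W := by positivity
  calc _ ≤ |greenConst n γ| * (2 * s * (C * M * W)) := by
        gcongr
        exact hbound.trans (mul_le_mul_of_nonneg_left (hC ζ M hM x t ht) (by positivity))
    _ = |greenConst n γ| * (2 * s) * C * M * W := by ring
    _ ≤ _ := by gcongr; linarith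

end
end

section
/- Let γ ∈ (0,1), α = 1 - 2γ, and φ(t) = (2^{1-γ}/Γ(γ)) t^γ K_γ(t) for t > 0. Then for every η > 1: ((η+1)/2 - α) ∫_0^∞ φ'(t)² t^η dt = ((η+1)/2) ∫_0^∞ φ(t)² t^η dt, and ∫_0^∞ φ(t)² t^η dt = (η - α)((η-1)/2) [1 + ((η+1)/2)((η+1)/2 - α)^{-1}]^{-1} ∫_0^∞ φ(t)² t^{η-2} dt (note (η+1)/2 - α > 0, so the expressions are well defined, and all four integrals are finite). -/
open MeasureTheory Real Filter Topology

noncomputable section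

/-- The modified Bessel function of the second kind `K_γ`. -/
def besselK (γ t : ℝ) : ℝ :=
  ∫ s in Set.Ioi (0 : ℝ), Real.exp (-t * Real.cosh s) * Real.cosh (γ * s)

/-- The function `φ(t) = (2^{1-γ}/Γ(γ)) t^γ K_γ(t)`. -/
def phiK (γ : ℝ) : ℝ → ℝ := fun t => (2 ^ (1 - γ) / Real.Gamma γ) * t ^ γ * besselK γ t

theorem exp_neg_mul_cosh_le {a δ : ℝ} (ha : 0 < a) (hδ : 0 < δ) (s : ℝ) :
    exp (-a * cosh s) ≤ exp (-a / 2) * (4 * δ / a) ^ δ * exp (-δ * s) := by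
  have hcosh : exp s / 2 ≤ cosh s := by
    rw [cosh_eq]; linarith [exp_pos (-s)]
  have hsplit : exp (-a * cosh s) ≤ exp (-a / 2) * exp (-(a / 4 * exp s)) := by
    rw [← exp_add]
    apply exp_le_exp.2
    nlinarith [one_le_cosh s]
  have hpow : exp (-(a / 4 * exp s)) ≤ (4 * δ / a) ^ δ * exp (-δ * s) := by
    set x := a / 4 * exp s with hx
    have hx0 : 0 < x := by positivity
    have h1 : (x / δ) ^ δ ≤ exp x := by
      have h2 : x / δ ≤ exp (x / δ) := by linarith [add_one_le_exp (x / δ)]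
      calc (x / δ) ^ δ ≤ exp (x / δ) ^ δ := rpow_le_rpow (by positivity) h2 hδ.le
        _ = exp x := by rw [← exp_mul]; congr 1; field_simp
    have h3 : (4 * δ / a) ^ δ * exp (-δ * s) = ((x / δ) ^ δ)⁻¹ := by
      rw [← inv_rpow (by positivity), show -δ * s = -s * δ by ring, exp_mul,
        ← mul_rpow (by positivity) (by positivity), hx, exp_neg]
      congr 1
      field_simp
    rw [h3, exp_neg]
    exact inv_anti₀ (by positivity) h1
  calc exp (-a * cosh s) ≤ exp (-a / 2) * exp (-(a / 4 * exp s)) := hsplit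
    _ ≤ exp (-a / 2) * ((4 * δ / a) ^ δ * exp (-δ * s)) := by gcongr
    _ = _ := by ring

theorem integrableOn_exp_neg_mul_cosh_mul {a M : ℝ} (ha : 0 < a) (hM : 0 ≤ M) {f : ℝ → ℝ}
    (hf : Continuous f) (hfM : ∀ s, 0 < s → |f s| ≤ exp (M * s)) :
    IntegrableOn (fun s => exp (-a * cosh s) * f s) (Set.Ioi 0) := by
  have hInt : IntegrableOn
      (fun s => exp (-a / 2) * (4 * (M + 1) / a) ^ (M + 1) * exp (-1 * s)) (Set.Ioi 0) :=
    (integrableOn_exp_mul_Ioi (by norm_num) 0).const_mul _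
  refine hInt.mono' (by fun_prop) ?_
  filter_upwards [ae_restrict_mem measurableSet_Ioi] with s hs
  rw [norm_mul, norm_eq_abs, norm_eq_abs, abs_of_pos (exp_pos _)]
  calc exp (-a * cosh s) * |f s|
      ≤ (exp (-a / 2) * (4 * (M + 1) / a) ^ (M + 1) * exp (-(M + 1) * s)) * exp (M * s) :=
        mul_le_mul (exp_neg_mul_cosh_le ha (by linarith) s) (hfM s hs) (abs_nonneg _)
          (by positivity)
    _ = _ := by rw [mul_assoc, ← exp_add]; ring_nf

theorem cosh_mul_le_exp {γ s : ℝ} (hγ : 0 ≤ γ) (hs : 0 < s) : cosh (γ * s) ≤ exp (γ * s) := by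
  have : 0 ≤ γ * s := by positivity
  rw [cosh_eq]
  linarith [exp_le_exp.2 (show -(γ * s) ≤ γ * s by linarith)]

theorem abs_cosh_mul_le {γ s : ℝ} (hγ : 0 ≤ γ) (hs : 0 < s) :
    |cosh (γ * s)| ≤ exp (γ * s) := by
  rw [abs_of_pos (cosh_pos _)]
  exact cosh_mul_le_exp hγ hs

theorem abs_sinh_mul_le {γ s : ℝ} (hγ : 0 ≤ γ) (hs : 0 < s) :
    |sinh (γ * s)| ≤ exp (γ * s) := by
  rw [abs_of_nonneg (sinh_nonneg_iff.2 (by positivity))]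
  exact (sinh_lt_cosh _).le.trans (cosh_mul_le_exp hγ hs)

theorem abs_cosh_mul_cosh_le {γ s : ℝ} (hγ : 0 ≤ γ) (hs : 0 < s) :
    |cosh s * cosh (γ * s)| ≤ exp ((1 + γ) * s) := by
  rw [abs_mul, add_mul, exp_add]
  refine mul_le_mul ?_ (abs_cosh_mul_le hγ hs) (abs_nonneg _) (exp_pos _).le
  simpa using abs_cosh_mul_le zero_le_one hs

theorem abs_sinh_mul_sinh_le {γ s : ℝ} (hγ : 0 ≤ γ) (hs : 0 < s) :
    |sinh s * sinh (γ * s)| ≤ exp ((1 + γ) * s) := by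
  rw [abs_mul, add_mul, exp_add]
  refine mul_le_mul ?_ (abs_sinh_mul_le hγ hs) (abs_nonneg _) (exp_pos _).le
  simpa using abs_sinh_mul_le zero_le_one hs

theorem integrableOn_besselK {γ t : ℝ} (hγ : 0 ≤ γ) (ht : 0 < t) :
    IntegrableOn (fun s => exp (-t * cosh s) * cosh (γ * s)) (Set.Ioi 0) :=
  integrableOn_exp_neg_mul_cosh_mul ht hγ (by fun_prop) fun _ => abs_cosh_mul_le hγ

theorem integrableOn_cosh_mul_cosh {γ t : ℝ} (hγ : 0 ≤ γ) (ht : 0 < t) :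
    IntegrableOn (fun s => exp (-t * cosh s) * (cosh s * cosh (γ * s))) (Set.Ioi 0) :=
  integrableOn_exp_neg_mul_cosh_mul ht (by linarith) (by fun_prop)
    fun _ => abs_cosh_mul_cosh_le hγ

theorem integrableOn_sinh_mul_sinh {γ t : ℝ} (hγ : 0 ≤ γ) (ht : 0 < t) :
    IntegrableOn (fun s => exp (-t * cosh s) * (sinh s * sinh (γ * s))) (Set.Ioi 0) :=
  integrableOn_exp_neg_mul_cosh_mul ht (by linarith) (by fun_prop)
    fun _ => abs_sinh_mul_sinh_le hγ

theorem abs_besselK_le {γ δ t : ℝ} (hγ : 0 ≤ γ) (hδ : γ < δ) (ht : 0 < t) :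
    |besselK γ t| ≤ ((4 * δ) ^ δ / (δ - γ)) * t ^ (-δ) * exp (-t / 2) := by
  have hδ0 : 0 < δ := hγ.trans_lt hδ
  have hInt : IntegrableOn
      (fun s => exp (-t / 2) * (4 * δ / t) ^ δ * exp ((γ - δ) * s)) (Set.Ioi 0) :=
    (integrableOn_exp_mul_Ioi (by linarith) 0).const_mul _
  have hle : |besselK γ t| ≤
      ∫ s in Set.Ioi (0 : ℝ), exp (-t / 2) * (4 * δ / t) ^ δ * exp ((γ - δ) * s) := by
    rw [← norm_eq_abs, besselK]
    refine norm_integral_le_of_norm_le hInt ?_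
    filter_upwards [ae_restrict_mem measurableSet_Ioi] with s hs
    rw [norm_mul, norm_eq_abs, norm_eq_abs, abs_of_pos (exp_pos _)]
    calc exp (-t * cosh s) * |cosh (γ * s)|
        ≤ (exp (-t / 2) * (4 * δ / t) ^ δ * exp (-δ * s)) * exp (γ * s) :=
          mul_le_mul (exp_neg_mul_cosh_le ht hδ0 s) (abs_cosh_mul_le hγ hs) (abs_nonneg _)
            (by positivity)
      _ = _ := by rw [mul_assoc, ← exp_add]; ring_nf
  refine hle.trans_eq ?_
  rw [integral_const_mul, integral_exp_mul_Ioi (by linarith), div_rpow (by positivity) ht.le,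
    rpow_neg ht.le, mul_zero, exp_zero, ← neg_sub δ γ, neg_div_neg_eq]
  ring

theorem mul_besselK_eq {γ t : ℝ} (hγ : 0 ≤ γ) (ht : 0 < t) :
    γ * besselK γ t =
      t * ∫ s in Set.Ioi (0 : ℝ), exp (-t * cosh s) * (sinh s * sinh (γ * s)) := by
  have hderiv (s : ℝ) : HasDerivAt (fun s => exp (-t * cosh s) * sinh (γ * s))
      (γ * (exp (-t * cosh s) * cosh (γ * s)) -
        t * (exp (-t * cosh s) * (sinh s * sinh (γ * s)))) s := by
    have h1 := ((hasDerivAt_cosh s).const_mul (-t)).exp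
    have h2 := ((hasDerivAt_id s).const_mul γ).sinh
    refine (h1.mul h2).congr_deriv ?_
    simp only [id]
    ring
  have hi1 := (integrableOn_besselK hγ ht).const_mul γ
  have hi2 := (integrableOn_sinh_mul_sinh hγ ht).const_mul t
  have hlim : Tendsto (fun s => exp (-t * cosh s) * sinh (γ * s)) atTop (𝓝 0) := by
    have h0 : Tendsto (fun s => exp (-t / 2) * (4 * (γ + 1) / t) ^ (γ + 1) * exp (-s))
        atTop (𝓝 0) := by
      simpa using tendsto_exp_neg_atTop_nhds_zero.const_mul
        (exp (-t / 2) * (4 * (γ + 1) / t) ^ (γ + 1))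
    refine squeeze_zero_norm' ?_ h0
    filter_upwards [eventually_gt_atTop 0] with s hs
    rw [norm_mul, norm_eq_abs, norm_eq_abs, abs_of_pos (exp_pos _)]
    calc exp (-t * cosh s) * |sinh (γ * s)|
        ≤ (exp (-t / 2) * (4 * (γ + 1) / t) ^ (γ + 1) * exp (-(γ + 1) * s)) * exp (γ * s) :=
          mul_le_mul (exp_neg_mul_cosh_le ht (by linarith) s) (abs_sinh_mul_le hγ hs)
            (abs_nonneg _) (by positivity)
      _ = _ := by rw [mul_assoc, ← exp_add]; ring_nf
  have h := integral_Ioi_of_hasDerivAt_of_tendsto' (a := 0) (fun s _ => hderiv s)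
    (hi1.sub hi2) hlim
  rw [integral_sub hi1 hi2, integral_const_mul, integral_const_mul] at h
  simp only [mul_zero, sinh_zero, sub_zero] at h
  rw [besselK]
  linarith

theorem hasDerivAt_besselK {γ t : ℝ} (hγ : 0 ≤ γ) (ht : 0 < t) :
    HasDerivAt (besselK γ) (-(γ / t) * besselK γ t - besselK (1 - γ) t) t := by
  have hderiv : HasDerivAt (besselK γ)
      (∫ s in Set.Ioi (0 : ℝ), -(exp (-t * cosh s) * (cosh s * cosh (γ * s)))) t := by
    refine (hasDerivAt_integral_of_dominated_loc_of_deriv_le (𝕜 := ℝ)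
      (F := fun t s => exp (-t * cosh s) * cosh (γ * s))
      (F' := fun t s => -(exp (-t * cosh s) * (cosh s * cosh (γ * s))))
      (bound := fun s => exp (-(t / 2) * cosh s) * (cosh s * cosh (γ * s)))
      (Ioi_mem_nhds (half_lt_self ht)) (Eventually.of_forall fun x => by fun_prop)
      (integrableOn_besselK hγ ht) (by fun_prop) ?_
      (integrableOn_cosh_mul_cosh hγ (half_pos ht)) ?_).2
    · refine Eventually.of_forall fun s x hx => ?_
      have hc := cosh_pos s
      have hc' := cosh_pos (γ * s)
      rw [norm_neg, norm_eq_abs, abs_of_pos (by positivity)]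
      gcongr
      exact (Set.mem_Ioi.1 hx).le
    · refine Eventually.of_forall fun s x _ => ?_
      have h1 := (((hasDerivAt_id x).neg.mul_const (cosh s)).exp).mul_const (cosh (γ * s))
      refine h1.congr_deriv ?_
      simp only [id, Pi.neg_apply]
      ring
  refine hderiv.congr_deriv ?_
  have hsub : besselK (1 - γ) t =
      (∫ s in Set.Ioi (0 : ℝ), exp (-t * cosh s) * (cosh s * cosh (γ * s))) -
        ∫ s in Set.Ioi (0 : ℝ), exp (-t * cosh s) * (sinh s * sinh (γ * s)) := by
    rw [← integral_sub (integrableOn_cosh_mul_cosh hγ ht) (integrableOn_sinh_mul_sinh hγ ht),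
      besselK]
    congr 1 with s
    rw [sub_mul, one_mul, cosh_sub]
    ring
  have hmul := mul_besselK_eq hγ ht
  rw [integral_neg, hsub, show -(γ / t) * besselK γ t = -((γ * besselK γ t) / t) by ring, hmul,
    mul_div_cancel_left₀ _ ht.ne']
  ring

/-- `f` is `O(t ^ p)` near zero and decays exponentially at infinity, with a uniform constant. -/
def ExpDecay (p : ℝ) (f : ℝ → ℝ) : Prop :=
  ∃ C, 0 ≤ C ∧ ∀ t, 0 < t → |f t| ≤ C * t ^ p * exp (-t / 2)

namespace ExpDecay

theorem mul {p q : ℝ} {f g : ℝ → ℝ} (hf : ExpDecay p f) (hg : ExpDecay q g) :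
    ExpDecay (p + q) fun t => f t * g t := by
  obtain ⟨C, hC, hf⟩ := hf
  obtain ⟨D, hD, hg⟩ := hg
  refine ⟨C * D, by positivity, fun t ht => ?_⟩
  have hexp : exp (-t / 2) ≤ 1 := exp_le_one_iff.2 (by linarith)
  rw [abs_mul, rpow_add ht]
  calc |f t| * |g t| ≤ (C * t ^ p * exp (-t / 2)) * (D * t ^ q * exp (-t / 2)) :=
        mul_le_mul (hf t ht) (hg t ht) (abs_nonneg _) (by positivity)
    _ ≤ (C * t ^ p * exp (-t / 2)) * (D * t ^ q * 1) := by gcongr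
    _ = _ := by ring

theorem sq {p : ℝ} {f : ℝ → ℝ} (hf : ExpDecay p f) : ExpDecay (p + p) fun t => f t ^ 2 := by
  simpa only [pow_two] using hf.mul hf

theorem mul_rpow {p : ℝ} {f : ℝ → ℝ} (hf : ExpDecay p f) (q : ℝ) :
    ExpDecay (p + q) fun t => f t * t ^ q := by
  obtain ⟨C, hC, hf⟩ := hf
  refine ⟨C, hC, fun t ht => ?_⟩
  have htq : 0 < t ^ q := rpow_pos_of_pos ht q
  rw [abs_mul, rpow_add ht, abs_of_pos htq]
  calc |f t| * t ^ q ≤ (C * t ^ p * exp (-t / 2)) * t ^ q := by gcongr; exact hf t ht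
    _ = _ := by ring

theorem const_mul {p : ℝ} {f : ℝ → ℝ} (hf : ExpDecay p f) (c : ℝ) :
    ExpDecay p fun t => c * f t := by
  obtain ⟨C, hC, hf⟩ := hf
  refine ⟨|c| * C, by positivity, fun t ht => ?_⟩
  rw [abs_mul]
  calc |c| * |f t| ≤ |c| * (C * t ^ p * exp (-t / 2)) := by gcongr; exact hf t ht
    _ = _ := by ring

theorem congr {p : ℝ} {f g : ℝ → ℝ} (hf : ExpDecay p f) (hfg : ∀ t, 0 < t → g t = f t) :
    ExpDecay p g := by
  obtain ⟨C, hC, hf⟩ := hf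
  exact ⟨C, hC, fun t ht => hfg t ht ▸ hf t ht⟩

theorem integrableOn {p : ℝ} {f : ℝ → ℝ} (hf : ExpDecay p f) (hp : -1 < p)
    (hcont : ContinuousOn f (Set.Ioi 0)) : IntegrableOn f (Set.Ioi 0) := by
  obtain ⟨C, -, hf⟩ := hf
  have hInt := (integrableOn_rpow_mul_exp_neg_mul_rpow hp one_pos
    (show (0 : ℝ) < 1 / 2 by norm_num)).const_mul C
  refine hInt.mono' (hcont.aestronglyMeasurable measurableSet_Ioi) ?_
  filter_upwards [ae_restrict_mem measurableSet_Ioi] with t ht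
  refine (hf t ht).trans_eq ?_
  rw [rpow_one, mul_assoc]
  ring_nf

theorem tendsto_atTop {p : ℝ} {f : ℝ → ℝ} (hf : ExpDecay p f) : Tendsto f atTop (𝓝 0) := by
  obtain ⟨C, -, hf⟩ := hf
  have hlim := (tendsto_rpow_mul_exp_neg_mul_atTop_nhds_zero p (1 / 2)
    (by norm_num)).const_mul C
  rw [mul_zero] at hlim
  refine squeeze_zero_norm' ?_ hlim
  filter_upwards [eventually_gt_atTop 0] with t ht
  refine (hf t ht).trans_eq ?_
  rw [mul_assoc]
  ring_nf

theorem tendsto_nhdsGT_zero {p : ℝ} {f : ℝ → ℝ} (hf : ExpDecay p f) (hp : 0 < p) :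
    Tendsto f (𝓝[>] 0) (𝓝 0) := by
  obtain ⟨C, hC, hf⟩ := hf
  have hlim : Tendsto (fun t : ℝ => C * t ^ p) (𝓝[>] 0) (𝓝 0) := by
    have h : ContinuousAt (fun t : ℝ => C * t ^ p) 0 :=
      (continuousAt_rpow_const 0 p (Or.inr hp.le)).const_mul C
    simpa [zero_rpow hp.ne'] using h.tendsto.mono_left nhdsWithin_le_nhds
  refine squeeze_zero_norm' ?_ hlim
  filter_upwards [self_mem_nhdsWithin] with t ht
  have ht : 0 < t := ht
  exact (hf t ht).trans
    (mul_le_of_le_one_right (by positivity) (exp_le_one_iff.2 (by linarith)))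

theorem integral_deriv_sub_eq_zero {p q : ℝ} {f g F' : ℝ → ℝ} (hf : ExpDecay p f)
    (hg : ExpDecay q g) (hp : 0 < p) (hq : 0 < q)
    (hderiv : ∀ t, 0 < t → HasDerivAt (fun t => f t - g t) (F' t) t)
    (hInt : IntegrableOn F' (Set.Ioi 0)) : ∫ t in Set.Ioi (0 : ℝ), F' t = 0 := by
  have h0 := (hf.tendsto_nhdsGT_zero hp).sub (hg.tendsto_nhdsGT_zero hq)
  have htop := hf.tendsto_atTop.sub hg.tendsto_atTop
  have h := integral_Ioi_deriv_mul_eq_sub (v := fun _ => (1 : ℝ)) (v' := fun _ => 0)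
    (fun t ht => hderiv t ht) (fun t _ => hasDerivAt_const t 1)
    (by simpa [Pi.mul_def, Pi.add_def] using hInt)
    (by simpa [Pi.mul_def] using h0) (by simpa [Pi.mul_def] using htop)
  simpa using h

end ExpDecay

section WeightedIdentities

variable {u w : ℝ → ℝ} {α η ε : ℝ}

theorem integrableOn_sq_mul_rpow {f : ℝ → ℝ} {p q : ℝ} (hf : ExpDecay p f)
    (hcont : ContinuousOn f (Set.Ioi 0)) (hpq : -1 < p + p + q) :
    IntegrableOn (fun t => f t ^ 2 * t ^ q) (Set.Ioi 0) :=
  (hf.sq.mul_rpow q).integrableOn hpq <| (hcont.pow 2).mul <|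
    continuousOn_id.rpow_const fun _ ht => Or.inl (ne_of_gt ht)

theorem integral_deriv_sq_eq (hα : α < 1) (hη : 2 * ε < η - 1)
    (hu : ExpDecay (-ε) u) (hw : ExpDecay (-α - ε) w)
    (hu' : ∀ t, 0 < t → HasDerivAt u (w t) t)
    (hw' : ∀ t, 0 < t → HasDerivAt w (u t - α / t * w t) t) :
    (η + 1 - 2 * α) * (∫ t in Set.Ioi (0 : ℝ), w t ^ 2 * t ^ η) =
      (η + 1) * ∫ t in Set.Ioi (0 : ℝ), u t ^ 2 * t ^ η := by
  have hu_cont : ContinuousOn u (Set.Ioi 0) :=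
    fun t ht => (hu' t ht).continuousAt.continuousWithinAt
  have hw_cont : ContinuousOn w (Set.Ioi 0) :=
    fun t ht => (hw' t ht).continuousAt.continuousWithinAt
  have hA := (integrableOn_sq_mul_rpow (q := η) hw hw_cont (by linarith)).const_mul
    (η + 1 - 2 * α)
  have hB := (integrableOn_sq_mul_rpow (q := η) hu hu_cont (by linarith)).const_mul (η + 1)
  have h := (hw.sq.mul_rpow (η + 1)).integral_deriv_sub_eq_zero (hu.sq.mul_rpow (η + 1))
    (by linarith) (by linarith) (F' := fun t =>
      (η + 1 - 2 * α) * (w t ^ 2 * t ^ η) - (η + 1) * (u t ^ 2 * t ^ η)) ?_ (Integrable.sub' hA hB)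
  · rw [integral_sub hA hB, integral_const_mul, integral_const_mul] at h
    linarith
  · intro t ht
    have hpow : HasDerivAt (fun t : ℝ => t ^ (η + 1)) ((η + 1) * t ^ η) t := by
      simpa using hasDerivAt_rpow_const (p := η + 1) (Or.inl ht.ne')
    refine ((((hw' t ht).pow 2).mul hpow).sub (((hu' t ht).pow 2).mul hpow)).congr_deriv ?_
    simp only [Pi.pow_apply]
    rw [rpow_add_one ht.ne']
    field_simp
    ring

theorem integral_deriv_sq_add_eq (hα : α < 1) (hη : 2 * ε < η - 1)
    (hu : ExpDecay (-ε) u) (hw : ExpDecay (-α - ε) w)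
    (hu' : ∀ t, 0 < t → HasDerivAt u (w t) t)
    (hw' : ∀ t, 0 < t → HasDerivAt w (u t - α / t * w t) t) :
    (∫ t in Set.Ioi (0 : ℝ), w t ^ 2 * t ^ η) + (∫ t in Set.Ioi (0 : ℝ), u t ^ 2 * t ^ η) =
      (η - α) * ((η - 1) / 2) * ∫ t in Set.Ioi (0 : ℝ), u t ^ 2 * t ^ (η - 2) := by
  have hu_cont : ContinuousOn u (Set.Ioi 0) :=
    fun t ht => (hu' t ht).continuousAt.continuousWithinAt
  have hw_cont : ContinuousOn w (Set.Ioi 0) :=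
    fun t ht => (hw' t ht).continuousAt.continuousWithinAt
  have hA := integrableOn_sq_mul_rpow (q := η) hw hw_cont (by linarith)
  have hB := integrableOn_sq_mul_rpow (q := η) hu hu_cont (by linarith)
  have hD := (integrableOn_sq_mul_rpow (q := η - 2) hu hu_cont (by linarith)).const_mul
    ((η - α) * ((η - 1) / 2))
  have hAB := Integrable.fun_add hA hB
  have h := ((hu.mul hw).mul_rpow η).integral_deriv_sub_eq_zero
    ((hu.sq.mul_rpow (η - 1)).const_mul ((η - α) / 2))
    (by linarith) (by linarith) (F' := fun t =>
      (w t ^ 2 * t ^ η + u t ^ 2 * t ^ η) -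
        (η - α) * ((η - 1) / 2) * (u t ^ 2 * t ^ (η - 2))) ?_ (Integrable.sub' hAB hD)
  · rw [integral_sub hAB hD, integral_add hA hB, integral_const_mul] at h
    linarith
  · intro t ht
    have hpow : HasDerivAt (fun t : ℝ => t ^ η) (η * t ^ (η - 1)) t :=
      hasDerivAt_rpow_const (Or.inl ht.ne')
    have hpow' : HasDerivAt (fun t : ℝ => t ^ (η - 1)) ((η - 1) * t ^ (η - 2)) t := by
      convert hasDerivAt_rpow_const (p := η - 1) (Or.inl ht.ne') using 3
      ring
    refine ((((hu' t ht).mul (hw' t ht)).mul hpow).sub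
      ((((hu' t ht).pow 2).mul hpow').const_mul ((η - α) / 2))).congr_deriv ?_
    simp only [Pi.pow_apply, Pi.mul_apply]
    have h1 : t ^ η = t ^ (η - 1) * t := by
      rw [← rpow_add_one ht.ne', sub_add_cancel]
    rw [h1]
    field_simp
    ring

end WeightedIdentities

theorem expDecay_rpow_mul_besselK {γ ε : ℝ} (β : ℝ) (hγ : 0 ≤ γ) (hε : 0 < ε) :
    ExpDecay (β - γ - ε) fun t => t ^ β * besselK γ t := by
  have hbessel : ExpDecay (-(γ + ε)) (besselK γ) :=
    ⟨_, div_nonneg (by positivity) (by linarith),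
      fun t ht => abs_besselK_le hγ (lt_add_of_pos_right γ hε) ht⟩
  convert hbessel.mul_rpow β using 1
  · ring
  · ext t
    ring

theorem hasDerivAt_rpow_mul_besselK {γ t : ℝ} (hγ : 0 ≤ γ) (ht : 0 < t) :
    HasDerivAt (fun t => t ^ γ * besselK γ t) (-(t ^ γ * besselK (1 - γ) t)) t := by
  refine ((hasDerivAt_rpow_const (p := γ) (Or.inl ht.ne')).mul
    (hasDerivAt_besselK hγ ht)).congr_deriv ?_
  rw [rpow_sub_one ht.ne']
  field_simp
  ring

theorem hasDerivAt_neg_rpow_mul_besselK {γ t : ℝ} (hγ : γ ≤ 1) (ht : 0 < t) :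
    HasDerivAt (fun t => -(t ^ γ * besselK (1 - γ) t))
      (t ^ γ * besselK γ t - (1 - 2 * γ) / t * -(t ^ γ * besselK (1 - γ) t)) t := by
  refine ((hasDerivAt_rpow_const (p := γ) (Or.inl ht.ne')).mul
    (hasDerivAt_besselK (sub_nonneg.2 hγ) ht)).neg.congr_deriv ?_
  rw [rpow_sub_one ht.ne', sub_sub_cancel]
  field_simp
  ring

theorem phiK_eq (γ : ℝ) :
    phiK γ = fun t => 2 ^ (1 - γ) / Real.Gamma γ * (t ^ γ * besselK γ t) := by
  ext t
  rw [phiK, mul_assoc]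

theorem hasDerivAt_phiK {γ t : ℝ} (hγ : 0 ≤ γ) (ht : 0 < t) :
    HasDerivAt (phiK γ)
      (2 ^ (1 - γ) / Real.Gamma γ * -(t ^ γ * besselK (1 - γ) t)) t := by
  rw [phiK_eq]
  exact (hasDerivAt_rpow_mul_besselK hγ ht).const_mul _

theorem hasDerivAt_deriv_phiK {γ t : ℝ} (hγ0 : 0 ≤ γ) (hγ1 : γ ≤ 1) (ht : 0 < t) :
    HasDerivAt (deriv (phiK γ)) (phiK γ t - (1 - 2 * γ) / t * deriv (phiK γ) t) t := by
  have h := (hasDerivAt_neg_rpow_mul_besselK hγ1 ht).const_mul (2 ^ (1 - γ) / Real.Gamma γ)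
  have heq : deriv (phiK γ) =ᶠ[𝓝 t]
      fun t => 2 ^ (1 - γ) / Real.Gamma γ * -(t ^ γ * besselK (1 - γ) t) := by
    filter_upwards [Ioi_mem_nhds ht] with s hs using (hasDerivAt_phiK hγ0 hs).deriv
  refine (h.congr_of_eventuallyEq heq).congr_deriv ?_
  rw [(hasDerivAt_phiK hγ0 ht).deriv, phiK_eq]
  ring

theorem expDecay_phiK {γ ε : ℝ} (hγ : 0 ≤ γ) (hε : 0 < ε) : ExpDecay (-ε) (phiK γ) := by
  rw [phiK_eq]
  convert (expDecay_rpow_mul_besselK γ hγ hε).const_mul (2 ^ (1 - γ) / Real.Gamma γ) using 1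
  ring

theorem expDecay_deriv_phiK {γ ε : ℝ} (hγ0 : 0 ≤ γ) (hγ1 : γ ≤ 1) (hε : 0 < ε) :
    ExpDecay (-(1 - 2 * γ) - ε) (deriv (phiK γ)) := by
  have h := (expDecay_rpow_mul_besselK γ (sub_nonneg.2 hγ1) hε).const_mul
    (-(2 ^ (1 - γ) / Real.Gamma γ))
  rw [show γ - (1 - γ) - ε = -(1 - 2 * γ) - ε by ring] at h
  refine h.congr fun t ht => ?_
  rw [(hasDerivAt_phiK hγ0 ht).deriv]
  ring

theorem stmt_8 (γ η : ℝ) (hγ0 : 0 < γ) (hγ1 : γ < 1) (hη : 1 < η) :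
    IntegrableOn (fun t => (deriv (phiK γ) t) ^ 2 * t ^ η) (Set.Ioi 0) volume ∧
    IntegrableOn (fun t => (phiK γ t) ^ 2 * t ^ η) (Set.Ioi 0) volume ∧
    IntegrableOn (fun t => (phiK γ t) ^ 2 * t ^ (η - 2)) (Set.Ioi 0) volume ∧
    ((η + 1) / 2 - (1 - 2 * γ)) *
        (∫ t in Set.Ioi (0 : ℝ), (deriv (phiK γ) t) ^ 2 * t ^ η) =
      ((η + 1) / 2) * (∫ t in Set.Ioi (0 : ℝ), (phiK γ t) ^ 2 * t ^ η) ∧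
    (∫ t in Set.Ioi (0 : ℝ), (phiK γ t) ^ 2 * t ^ η) =
      (η - (1 - 2 * γ)) * ((η - 1) / 2) *
        (1 + ((η + 1) / 2) * ((η + 1) / 2 - (1 - 2 * γ))⁻¹)⁻¹ *
        (∫ t in Set.Ioi (0 : ℝ), (phiK γ t) ^ 2 * t ^ (η - 2)) := by
  obtain ⟨ε, hε, hεη⟩ : ∃ ε : ℝ, 0 < ε ∧ 2 * ε < η - 1 :=
    ⟨(η - 1) / 4, by linarith, by linarith⟩
  have hu := expDecay_phiK hγ0.le hε
  have hw := expDecay_deriv_phiK hγ0.le hγ1.le hε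
  have hu' : ∀ t, 0 < t → HasDerivAt (phiK γ) (deriv (phiK γ) t) t := fun t ht =>
    (hasDerivAt_phiK hγ0.le ht).differentiableAt.hasDerivAt
  have hw' := fun t (ht : 0 < t) => hasDerivAt_deriv_phiK hγ0.le hγ1.le ht
  have hu_cont : ContinuousOn (phiK γ) (Set.Ioi 0) :=
    fun t ht => (hu' t ht).continuousAt.continuousWithinAt
  have hw_cont : ContinuousOn (deriv (phiK γ)) (Set.Ioi 0) :=
    fun t ht => (hw' t ht).continuousAt.continuousWithinAt
  have hα : 1 - 2 * γ < 1 := by linarith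
  have h1 := integral_deriv_sq_eq hα hεη hu hw hu' hw'
  have h2 := integral_deriv_sq_add_eq hα hεη hu hw hu' hw'
  refine ⟨integrableOn_sq_mul_rpow hw hw_cont (by linarith),
    integrableOn_sq_mul_rpow hu hu_cont (by linarith),
    integrableOn_sq_mul_rpow hu hu_cont (by linarith), by linarith, ?_⟩
  have hpos : 0 < (η + 1) / 2 - (1 - 2 * γ) := by linarith
  have hfactor : 0 < 1 + (η + 1) / 2 * ((η + 1) / 2 - (1 - 2 * γ))⁻¹ := by positivity
  rw [mul_right_comm, ← h2, eq_mul_inv_iff_mul_eq₀ hfactor.ne', mul_add, mul_one, add_comm,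
    add_left_inj, ← mul_assoc, mul_inv_eq_iff_eq_mul₀ hpos.ne']
  linarith

end
end

section
/- For every i, j ∈ {1,…,n}: Σ_{p,q=1}^n ∫_{S^{n-1}} x_i x_j H_{pq}(x̄)² dS = (|S^{n-1}|/(2n(n+2)(n+4))) |W|² δ_{ij} + (2|S^{n-1}|/(n(n+2)(n+4))) W̃_{ij}, and Σ_{k,p,q=1}^n ∫_{S^{n-1}} x_i x_j (∂_k H_{pq}(x̄))² dS = (|S^{n-1}|/(n(n+2))) |W|² δ_{ij} + (2|S^{n-1}|/(n(n+2))) W̃_{ij}. -/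
open MeasureTheory Real Filter Topology

noncomputable section

/-- The tensor `H_{ij}(x̄) = Σ_{k,l} W_{ikjl} x^k x^l`. -/
def Hten (n : ℕ) (W4 : Fin n → Fin n → Fin n → Fin n → ℝ) (i j : Fin n)
    (x : EuclideanSpace ℝ (Fin n)) : ℝ :=
  ∑ k, ∑ l, W4 i k j l * x k * x l

/-- The squared tensor norm `|W|² = Σ (W_{ikjl} + W_{iljk})²`. -/
def normWsq (n : ℕ) (W4 : Fin n → Fin n → Fin n → Fin n → ℝ) : ℝ :=
  ∑ i, ∑ j, ∑ k, ∑ l, (W4 i k j l + W4 i l j k) ^ 2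

/-- The symmetric two-tensor `W̃_{ij} = Σ_{k,p,q}(W_{ikpq}+W_{kqip})(W_{jkpq}+W_{kqjp})`. -/
def Wtil (n : ℕ) (W4 : Fin n → Fin n → Fin n → Fin n → ℝ) (i j : Fin n) : ℝ :=
  ∑ k, ∑ p, ∑ q, (W4 i k p q + W4 k q i p) * (W4 j k p q + W4 k q j p)

/-- The partial derivative `∂_k f`. -/
def pd (n : ℕ) (k : Fin n) (f : EuclideanSpace ℝ (Fin n) → ℝ) :
    EuclideanSpace ℝ (Fin n) → ℝ :=
  fun x => fderiv ℝ f x (EuclideanSpace.single k 1)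

/-- The Euclidean Laplacian `Δf = Σ_k ∂_k∂_k f`. -/
def lapl (n : ℕ) (f : EuclideanSpace ℝ (Fin n) → ℝ) :
    EuclideanSpace ℝ (Fin n) → ℝ :=
  fun x => ∑ k, pd n k (pd n k f) x

/-- The tensor `h̄_{ij}(x̄) = f(|x̄|²) H_{ij}(x̄)`. -/
def hbar (n : ℕ) (W4 : Fin n → Fin n → Fin n → Fin n → ℝ) (f : Polynomial ℝ)
    (i j : Fin n) (x : EuclideanSpace ℝ (Fin n)) : ℝ :=
  Polynomial.eval (‖x‖ ^ 2) f * Hten n W4 i j x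

/-- The map sending `y` to the radial projection onto the unit sphere of the point with `i`-th
coordinate `s` and remaining coordinates `y`. -/
def faceProj (m : ℕ) (i : Fin (m + 1)) (s : ℝ) (y : Fin m → ℝ) :
    EuclideanSpace ℝ (Fin (m + 1)) :=
  ‖(WithLp.toLp 2 (i.insertNth s y) : EuclideanSpace ℝ (Fin (m + 1)))‖⁻¹ •
    WithLp.toLp 2 (i.insertNth s y)

lemma contDiff_faceProj (m : ℕ) (i : Fin (m + 1)) {s : ℝ} (hs : s ≠ 0) :
    ContDiff ℝ 1 (faceProj m i s) := by
  have h : ContDiff ℝ 1 (fun y : Fin m → ℝ ↦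
      (WithLp.toLp 2 (i.insertNth s y) : EuclideanSpace ℝ (Fin (m + 1)))) := by
    rw [contDiff_euclidean]
    intro k
    refine Fin.succAboveCases i ?_ (fun j ↦ ?_) k
    · simpa using contDiff_const
    · simpa using contDiff_apply ℝ ℝ j
  have h0 : ∀ y : Fin m → ℝ,
      (WithLp.toLp 2 (i.insertNth s y) : EuclideanSpace ℝ (Fin (m + 1))) ≠ 0 := by
    intro y hy
    have := congrArg (fun v : EuclideanSpace ℝ (Fin (m + 1)) ↦ v i) hy
    simp at this
    exact hs this
  exact ((h.norm ℝ h0).inv fun y ↦ norm_ne_zero_iff.2 (h0 y)).smul h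

lemma sphere_subset_iUnion_faceProj (m : ℕ) :
    Metric.sphere (0 : EuclideanSpace ℝ (Fin (m + 1))) 1 ⊆
      ⋃ i : Fin (m + 1), (faceProj m i 1 '' Set.Icc (-1) 1 ∪
        faceProj m i (-1) '' Set.Icc (-1) 1) := by
  intro x hx
  have hx1 : ‖x‖ = 1 := by simpa using hx
  obtain ⟨i, -, hi⟩ := Finset.exists_max_image Finset.univ (fun i ↦ |x i|) Finset.univ_nonempty
  have hpos : 0 < |x i| := by
    rcases (abs_nonneg (x i)).lt_or_eq with h | h
    · exact h
    · exfalso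
      have : x = 0 := by
        ext j
        have := hi j (Finset.mem_univ j)
        rw [← h] at this
        simpa using this
      simp [this] at hx1
  have key : ∀ s : ℝ, x i = s * |x i| → x ∈ faceProj m i s '' Set.Icc (-1) 1 := by
    intro s hs
    refine ⟨fun j ↦ x (i.succAbove j) / |x i|, ?_, ?_⟩
    · have : ∀ j, |x (i.succAbove j) / (|x i|)| ≤ 1 := fun j ↦ by
        rw [abs_div, abs_abs, div_le_one hpos]
        exact hi _ (Finset.mem_univ _)
      exact ⟨fun j ↦ (abs_le.1 (this j)).1, fun j ↦ (abs_le.1 (this j)).2⟩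
    · have : (WithLp.toLp 2 (i.insertNth s fun j ↦ x (i.succAbove j) / |x i|) :
          EuclideanSpace ℝ (Fin (m + 1))) = |x i|⁻¹ • x := by
        ext k
        refine Fin.succAboveCases i ?_ (fun j ↦ ?_) k
        · simp only [Fin.insertNth_apply_same, PiLp.smul_apply, smul_eq_mul]
          field_simp
          linarith
        · simp [div_eq_inv_mul]
      rw [faceProj, this, norm_smul, hx1, smul_smul]
      simp [hpos.ne']
  refine Set.mem_iUnion.2 ⟨i, ?_⟩
  rcases abs_cases (x i) with h | h
  · exact Or.inl (key 1 (by linarith))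
  · exact Or.inr (key (-1) (by linarith))

lemma hausdorffMeasure_faceProj_lt_top (m : ℕ) (i : Fin (m + 1)) {s : ℝ} (hs : s ≠ 0) :
    μH[(m : ℝ)] (faceProj m i s '' Set.Icc (-1) 1) < ⊤ := by
  obtain ⟨K, hK⟩ := (contDiff_faceProj m i hs).contDiffOn.exists_lipschitzOnWith one_ne_zero
    (convex_Icc (-1) 1) isCompact_Icc
  refine (hK.hausdorffMeasure_image_le (Nat.cast_nonneg m)).trans_lt ?_
  have h : (μH[(m : ℝ)] : Measure (Fin m → ℝ)) = volume := by
    simpa using hausdorffMeasure_pi_real (ι := Fin m)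
  rw [h]
  exact ENNReal.mul_lt_top (ENNReal.rpow_lt_top_of_nonneg (Nat.cast_nonneg m) ENNReal.coe_ne_top)
    isCompact_Icc.measure_lt_top

/-- The surface measure of the unit sphere of `ℝⁿ`, as a measure on `ℝⁿ`. -/
def sphereMeasure (n : ℕ) : Measure (EuclideanSpace ℝ (Fin n)) :=
  μH[(n : ℝ) - 1].restrict (Metric.sphere 0 1)

lemma isFiniteMeasure_sphereMeasure {n : ℕ} (hn : n ≠ 0) : IsFiniteMeasure (sphereMeasure n) := by
  obtain ⟨m, rfl⟩ := Nat.exists_eq_succ_of_ne_zero hn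
  refine isFiniteMeasure_restrict.2 (lt_of_le_of_lt
    (measure_mono (sphere_subset_iUnion_faceProj m)) ?_).ne
  have hm : ((m.succ : ℕ) : ℝ) - 1 = m := by simp
  rw [hm]
  refine (measure_iUnion_le _).trans_lt ?_
  rw [tsum_fintype, ENNReal.sum_lt_top]
  exact fun i _ ↦ (measure_union_le _ _).trans_lt (ENNReal.add_lt_top.2
    ⟨hausdorffMeasure_faceProj_lt_top m i one_ne_zero,
      hausdorffMeasure_faceProj_lt_top m i (by norm_num)⟩)

lemma norm_eq_one_ae_sphereMeasure (n : ℕ) : ∀ᵐ x ∂sphereMeasure n, ‖x‖ = 1 := by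
  filter_upwards [ae_restrict_mem (μ := μH[(n : ℝ) - 1])
    (Metric.isClosed_sphere (x := (0 : EuclideanSpace ℝ (Fin n))) (ε := 1)).measurableSet] with x hx
  simpa using hx

lemma measurePreserving_sphereMeasure {n : ℕ}
    (e : EuclideanSpace ℝ (Fin n) ≃ₗᵢ[ℝ] EuclideanSpace ℝ (Fin n)) :
    MeasurePreserving e (sphereMeasure n) (sphereMeasure n) := by
  have h := (e.toIsometryEquiv.measurePreserving_hausdorffMeasure ((n : ℝ) - 1)).restrict_preimage
    (Metric.isClosed_sphere (x := (0 : EuclideanSpace ℝ (Fin n))) (ε := 1)).measurableSet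
  have h2 : e.toIsometryEquiv ⁻¹' Metric.sphere (0 : EuclideanSpace ℝ (Fin n)) 1 =
      Metric.sphere 0 1 := by
    ext x; simp
  rw [h2] at h
  exact h

lemma integrable_sphereMeasure {n : ℕ} (hn : n ≠ 0) {f : EuclideanSpace ℝ (Fin n) → ℝ}
    (hf : Continuous f) : Integrable f (sphereMeasure n) := by
  have := isFiniteMeasure_sphereMeasure hn
  obtain ⟨C, hC⟩ := (isCompact_sphere (0 : EuclideanSpace ℝ (Fin n)) 1).exists_bound_of_continuousOn
    hf.continuousOn
  refine Integrable.of_bound hf.aestronglyMeasurable C ?_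
  filter_upwards [norm_eq_one_ae_sphereMeasure n] with x hx
  exact hC x (by simpa using hx)

/-- Rotation by the angle `t` in the coordinate plane spanned by `e_a` and `e_b`. -/
def planeRot {n : ℕ} (a b : Fin n) (t : ℝ) (x : EuclideanSpace ℝ (Fin n)) :
    EuclideanSpace ℝ (Fin n) :=
  x + ((cos t - 1) * x a - sin t * x b) • EuclideanSpace.single a 1 +
    (sin t * x a + (cos t - 1) * x b) • EuclideanSpace.single b 1

lemma norm_planeRot {n : ℕ} {a b : Fin n} (hab : a ≠ b) (t : ℝ) (x : EuclideanSpace ℝ (Fin n)) :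
    ‖planeRot a b t x‖ = ‖x‖ := by
  rw [← sq_eq_sq₀ (norm_nonneg _) (norm_nonneg _), planeRot, norm_add_sq_real, norm_add_sq_real]
  simp only [inner_add_left, inner_smul_left, inner_smul_right, EuclideanSpace.inner_single_right,
    norm_smul, mul_pow, PiLp.norm_single, Real.norm_eq_abs, sq_abs]
  simp [hab.symm]
  linear_combination ((x a) ^ 2 + (x b) ^ 2) * sin_sq_add_cos_sq t

lemma continuous_planeRot {n : ℕ} (a b : Fin n) :
    Continuous fun p : ℝ × EuclideanSpace ℝ (Fin n) ↦ planeRot a b p.1 p.2 := by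
  unfold planeRot
  fun_prop

/-- `planeRot` as a linear isometric equivalence. -/
def planeRotEquiv {n : ℕ} {a b : Fin n} (hab : a ≠ b) (t : ℝ) :
    EuclideanSpace ℝ (Fin n) ≃ₗᵢ[ℝ] EuclideanSpace ℝ (Fin n) :=
  LinearIsometry.toLinearIsometryEquiv
    { toFun := planeRot a b t
      map_add' := fun x y ↦ by
        simp only [planeRot, PiLp.add_apply]; module
      map_smul' := fun c x ↦ by
        simp only [planeRot, PiLp.smul_apply, smul_eq_mul, RingHom.id_apply]; module
      norm_map' := norm_planeRot hab t } rfl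

lemma integral_comp_planeRot {n : ℕ} {a b : Fin n} (hab : a ≠ b) (t : ℝ)
    (f : EuclideanSpace ℝ (Fin n) → ℝ) :
    ∫ x, f (planeRot a b t x) ∂sphereMeasure n = ∫ x, f x ∂sphereMeasure n :=
  (measurePreserving_sphereMeasure (planeRotEquiv hab t)).integral_comp
    (planeRotEquiv hab t).toHomeomorph.measurableEmbedding f

/-- The derivative of `planeRot a b t x` with respect to `t`. -/
def planeRotDeriv {n : ℕ} (a b : Fin n) (t : ℝ) (x : EuclideanSpace ℝ (Fin n)) :
    EuclideanSpace ℝ (Fin n) :=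
  (-sin t * x a - cos t * x b) • EuclideanSpace.single a 1 +
    (cos t * x a - sin t * x b) • EuclideanSpace.single b 1

lemma hasDerivAt_planeRot {n : ℕ} (a b : Fin n) (t : ℝ) (x : EuclideanSpace ℝ (Fin n)) :
    HasDerivAt (fun t ↦ planeRot a b t x) (planeRotDeriv a b t x) t := by
  have h1 : HasDerivAt (fun t ↦ (cos t - 1) * x a - sin t * x b)
      (-sin t * x a - cos t * x b) t :=
    (((hasDerivAt_cos t).sub_const 1).mul_const _).sub ((hasDerivAt_sin t).mul_const _)
  have h2 : HasDerivAt (fun t ↦ sin t * x a + (cos t - 1) * x b)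
      (cos t * x a - sin t * x b) t := by
    refine (((hasDerivAt_sin t).mul_const (x a)).add
      (((hasDerivAt_cos t).sub_const 1).mul_const (x b))).congr_deriv ?_
    ring
  exact ((h1.smul_const _).const_add x).add (h2.smul_const _)

lemma continuous_pd {n : ℕ} (k : Fin n) {f : EuclideanSpace ℝ (Fin n) → ℝ} (hf : ContDiff ℝ 1 f) :
    Continuous (pd n k f) :=
  (hf.continuous_fderiv one_ne_zero).clm_apply continuous_const

/-- Functions of class `C¹` satisfy `∫ (x_a ∂_b f - x_b ∂_a f) = 0` over the unit sphere. -/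
lemma integral_rotation_field {n : ℕ} (hn : n ≠ 0) (a b : Fin n)
    {f : EuclideanSpace ℝ (Fin n) → ℝ} (hf : ContDiff ℝ 1 f) :
    ∫ x, (x a * pd n b f x - x b * pd n a f x) ∂sphereMeasure n = 0 := by
  rcases eq_or_ne a b with rfl | hab
  · simp
  have := isFiniteMeasure_sphereMeasure hn
  have hcont : Continuous fun p : ℝ × EuclideanSpace ℝ (Fin n) ↦
      fderiv ℝ f (planeRot a b p.1 p.2) (planeRotDeriv a b p.1 p.2) := by
    refine ((hf.continuous_fderiv one_ne_zero).comp (continuous_planeRot a b)).clm_apply ?_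
    unfold planeRotDeriv
    fun_prop
  obtain ⟨C, hC⟩ := ((isCompact_Icc (a := (-1 : ℝ)) (b := 1)).prod
    (isCompact_sphere (0 : EuclideanSpace ℝ (Fin n)) 1)).exists_bound_of_continuousOn
    hcont.continuousOn
  have hd := (hasDerivAt_integral_of_dominated_loc_of_deriv_le (μ := sphereMeasure n)
    (F := fun t x ↦ f (planeRot a b t x))
    (F' := fun t x ↦ fderiv ℝ f (planeRot a b t x) (planeRotDeriv a b t x))
    (bound := fun _ ↦ C) (x₀ := (0 : ℝ)) (s := Set.Icc (-1) 1)
    (Icc_mem_nhds (by norm_num) (by norm_num))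
    (Eventually.of_forall fun t ↦ (hf.continuous.comp
      ((continuous_planeRot a b).comp (Continuous.prodMk_right t))).aestronglyMeasurable)
    (integrable_sphereMeasure hn (hf.continuous.comp
      ((continuous_planeRot a b).comp (Continuous.prodMk_right 0))))
    (hcont.comp (Continuous.prodMk_right 0)).aestronglyMeasurable
    (by
      filter_upwards [norm_eq_one_ae_sphereMeasure n] with x hx t ht
      exact hC (t, x) ⟨ht, by simpa using hx⟩)
    (integrable_const C)
    (Eventually.of_forall fun x t _ ↦
      ((hf.differentiable one_ne_zero _).hasFDerivAt).comp_hasDerivAt t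
        (hasDerivAt_planeRot a b t x))).2
  simp_rw [integral_comp_planeRot hab] at hd
  have h0 := hd.unique (hasDerivAt_const (0 : ℝ) _)
  rw [← h0]
  refine integral_congr_ae (Eventually.of_forall fun x ↦ ?_)
  simp [planeRot, planeRotDeriv, pd]
  ring

lemma contDiff_coord {n : ℕ} (i : Fin n) :
    ContDiff ℝ 1 fun x : EuclideanSpace ℝ (Fin n) ↦ x i := by
  fun_prop

lemma pd_coord {n : ℕ} (k i : Fin n) (x : EuclideanSpace ℝ (Fin n)) :
    pd n k (fun x ↦ x i) x = if k = i then 1 else 0 := by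
  have h : HasFDerivAt (fun x : EuclideanSpace ℝ (Fin n) ↦ x i)
      (EuclideanSpace.proj i : EuclideanSpace ℝ (Fin n) →L[ℝ] ℝ) x :=
    (EuclideanSpace.proj i : EuclideanSpace ℝ (Fin n) →L[ℝ] ℝ).hasFDerivAt
  rw [pd, h.fderiv]
  simp [eq_comm]

lemma pd_mul {n : ℕ} (k : Fin n) {f g : EuclideanSpace ℝ (Fin n) → ℝ} (hf : ContDiff ℝ 1 f)
    (hg : ContDiff ℝ 1 g) (x : EuclideanSpace ℝ (Fin n)) :
    pd n k (fun x ↦ f x * g x) x = pd n k f x * g x + f x * pd n k g x := by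
  rw [pd, fderiv_fun_mul (hf.differentiable one_ne_zero x) (hg.differentiable one_ne_zero x)]
  simp [pd]
  ring

lemma pd_sum {n : ℕ} {ι : Type*} (s : Finset ι) (k : Fin n)
    {f : ι → EuclideanSpace ℝ (Fin n) → ℝ} (hf : ∀ i, ContDiff ℝ 1 (f i))
    (x : EuclideanSpace ℝ (Fin n)) :
    pd n k (fun x ↦ ∑ i ∈ s, f i x) x = ∑ i ∈ s, pd n k (f i) x := by
  rw [pd, fderiv_fun_sum fun i _ ↦ (hf i).differentiable one_ne_zero x]
  simp [pd]

lemma pd_const {n : ℕ} (k : Fin n) (c : ℝ) (x : EuclideanSpace ℝ (Fin n)) :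
    pd n k (fun _ ↦ c) x = 0 := by
  simp [pd]

/-- If `g` is homogeneous of degree `d` (in Euler's form), then
`(n + d - 1) ∫ x_a g = ∫ ∂_a g` over the unit sphere. -/
lemma integral_coord_mul {n : ℕ} (hn : n ≠ 0) (a : Fin n)
    {g : EuclideanSpace ℝ (Fin n) → ℝ} (hg : ContDiff ℝ 1 g) (d : ℝ)
    (hd : ∀ x, ∑ b, x b * pd n b g x = d * g x) :
    ((n : ℝ) + d - 1) * ∫ x, x a * g x ∂sphereMeasure n = ∫ x, pd n a g x ∂sphereMeasure n := by
  have h0 : ∑ b, ∫ x, (x a * pd n b (fun x ↦ x b * g x) x - x b * pd n a (fun x ↦ x b * g x) x)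
      ∂sphereMeasure n = 0 :=
    Finset.sum_eq_zero fun b _ ↦ integral_rotation_field hn a b ((contDiff_coord b).mul hg)
  have hc := fun b ↦ continuous_pd b hg
  rw [← integral_finsetSum _ fun b _ ↦ integrable_sphereMeasure hn (by
    have := continuous_pd a ((contDiff_coord b).mul hg)
    have := continuous_pd b ((contDiff_coord b).mul hg)
    fun_prop)] at h0
  have h1 : ∀ᵐ x ∂sphereMeasure n,
      ∑ b, (x a * pd n b (fun x ↦ x b * g x) x - x b * pd n a (fun x ↦ x b * g x) x) =
      ((n : ℝ) + d - 1) * (x a * g x) - pd n a g x := by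
    filter_upwards [norm_eq_one_ae_sphereMeasure n] with x hx
    have hsq : ∑ b, x b ^ 2 = 1 := by
      rw [← EuclideanSpace.real_norm_sq_eq, hx, one_pow]
    calc ∑ b, (x a * pd n b (fun x ↦ x b * g x) x - x b * pd n a (fun x ↦ x b * g x) x)
        = ∑ b, (x a * g x + x a * (x b * pd n b g x) - (if a = b then x b * g x else 0)
            - pd n a g x * x b ^ 2) := by
          refine Finset.sum_congr rfl fun b _ ↦ ?_
          rw [pd_mul _ (contDiff_coord b) hg, pd_mul _ (contDiff_coord b) hg, pd_coord, pd_coord]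
          rw [if_pos rfl]
          split_ifs <;> ring
      _ = _ := by
          rw [Finset.sum_sub_distrib, Finset.sum_sub_distrib, Finset.sum_add_distrib]
          simp only [← Finset.mul_sum, hd, hsq]
          simp
          ring
  rw [integral_congr_ae h1, integral_sub, integral_const_mul] at h0
  · linarith
  · exact integrable_sphereMeasure hn (by have := hg.continuous; fun_prop)
  · exact integrable_sphereMeasure hn (hc a)

lemma sum_coord_mul_pd_mul {n : ℕ} {f g : EuclideanSpace ℝ (Fin n) → ℝ} (hf : ContDiff ℝ 1 f)
    (hg : ContDiff ℝ 1 g) {d e : ℝ} (hd : ∀ x, ∑ b, x b * pd n b f x = d * f x)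
    (he : ∀ x, ∑ b, x b * pd n b g x = e * g x) (x : EuclideanSpace ℝ (Fin n)) :
    ∑ b, x b * pd n b (fun x ↦ f x * g x) x = (d + e) * (f x * g x) := by
  calc ∑ b, x b * pd n b (fun x ↦ f x * g x) x
      = (∑ b, x b * pd n b f x) * g x + f x * ∑ b, x b * pd n b g x := by
        rw [Finset.sum_mul, Finset.mul_sum, ← Finset.sum_add_distrib]
        refine Finset.sum_congr rfl fun b _ ↦ ?_
        rw [pd_mul _ hf hg]
        ring
    _ = _ := by rw [hd, he]; ring

/-- The linear form with coefficients `v`. -/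
def linForm {n : ℕ} (v : Fin n → ℝ) (x : EuclideanSpace ℝ (Fin n)) : ℝ :=
  ∑ l, v l * x l

/-- The quadratic form with (not necessarily symmetric) coefficients `A`. -/
def quadForm {n : ℕ} (A : Fin n → Fin n → ℝ) (x : EuclideanSpace ℝ (Fin n)) : ℝ :=
  ∑ k, ∑ l, A k l * x k * x l

lemma contDiff_linForm {n : ℕ} (v : Fin n → ℝ) : ContDiff ℝ 1 (linForm v) := by
  unfold linForm; fun_prop

lemma contDiff_quadForm {n : ℕ} (A : Fin n → Fin n → ℝ) : ContDiff ℝ 1 (quadForm A) := by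
  unfold quadForm; fun_prop

lemma pd_linForm {n : ℕ} (k : Fin n) (v : Fin n → ℝ) (x : EuclideanSpace ℝ (Fin n)) :
    pd n k (linForm v) x = v k := by
  unfold linForm
  rw [pd_sum _ _ fun i ↦ by fun_prop]
  simp only [pd_mul k contDiff_const (contDiff_coord _), pd_const, pd_coord]
  simp

lemma pd_quadForm {n : ℕ} (k : Fin n) (A : Fin n → Fin n → ℝ) (x : EuclideanSpace ℝ (Fin n)) :
    pd n k (quadForm A) x = linForm (fun l ↦ A k l + A l k) x := by
  unfold quadForm
  rw [pd_sum _ _ fun i ↦ by fun_prop]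
  have h : ∀ i, pd n k (fun x ↦ ∑ l, A i l * x i * x l) x =
      (if k = i then ∑ l, A i l * x l else 0) + A i k * x i := by
    intro i
    rw [pd_sum _ _ fun i ↦ by fun_prop]
    simp only [pd_mul k (contDiff_const.mul (contDiff_coord _)) (contDiff_coord _),
      pd_mul k contDiff_const (contDiff_coord _), pd_const, pd_coord]
    split_ifs <;> simp [Finset.sum_add_distrib]
  simp only [h, Finset.sum_add_distrib, linForm, add_mul]
  simp

lemma sum_coord_mul_pd_coord {n : ℕ} (i : Fin n) (x : EuclideanSpace ℝ (Fin n)) :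
    ∑ b, x b * pd n b (fun x ↦ x i) x = 1 * x i := by
  simp [pd_coord]

lemma sum_coord_mul_pd_linForm {n : ℕ} (v : Fin n → ℝ) (x : EuclideanSpace ℝ (Fin n)) :
    ∑ b, x b * pd n b (linForm v) x = 1 * linForm v x := by
  simp [pd_linForm, linForm, mul_comm]

lemma sum_coord_mul_linForm {n : ℕ} (A : Fin n → Fin n → ℝ) (x : EuclideanSpace ℝ (Fin n)) :
    ∑ b, x b * linForm (fun l ↦ A b l + A l b) x = 2 * quadForm A x := by
  have h : ∑ b, x b * linForm (fun l ↦ A b l + A l b) x =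
      ∑ b, ∑ l, A b l * x b * x l + ∑ b, ∑ l, A l b * x l * x b := by
    simp only [linForm, Finset.mul_sum, ← Finset.sum_add_distrib]
    refine Finset.sum_congr rfl fun b _ ↦ Finset.sum_congr rfl fun l _ ↦ ?_
    ring
  rw [h, Finset.sum_comm (f := fun b l ↦ A l b * x l * x b), two_mul]
  rfl

lemma sum_coord_mul_pd_quadForm {n : ℕ} (A : Fin n → Fin n → ℝ)
    (x : EuclideanSpace ℝ (Fin n)) :
    ∑ b, x b * pd n b (quadForm A) x = 2 * quadForm A x := by
  simp only [pd_quadForm, sum_coord_mul_linForm]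

section Moments

variable {n : ℕ}

lemma integral_coord_mul_linForm (hn : n ≠ 0) (a : Fin n) (v : Fin n → ℝ) :
    n * ∫ x, x a * linForm v x ∂sphereMeasure n = v a * (sphereMeasure n).real Set.univ := by
  have h := integral_coord_mul hn a (contDiff_linForm v) 1 (sum_coord_mul_pd_linForm v)
  simp only [pd_linForm, integral_const, smul_eq_mul] at h
  linarith

lemma integral_linForm_mul_linForm (hn : n ≠ 0) (v w : Fin n → ℝ) :
    n * ∫ x, linForm v x * linForm w x ∂sphereMeasure n =
      (∑ l, v l * w l) * (sphereMeasure n).real Set.univ := by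
  have h : ∫ x, linForm v x * linForm w x ∂sphereMeasure n =
      ∑ l, v l * ∫ x, x l * linForm w x ∂sphereMeasure n := by
    simp only [← integral_const_mul]
    rw [← integral_finsetSum _ fun l _ ↦ integrable_sphereMeasure hn (by
      have := (contDiff_linForm w).continuous
      fun_prop)]
    refine integral_congr_ae (Eventually.of_forall fun x ↦ ?_)
    dsimp only
    rw [linForm, Finset.sum_mul]
    exact Finset.sum_congr rfl fun l _ ↦ mul_assoc _ _ _
  rw [h, Finset.mul_sum, Finset.sum_mul]
  refine Finset.sum_congr rfl fun l _ ↦ ?_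
  linear_combination v l * integral_coord_mul_linForm hn l w

lemma integral_coord_mul_coord_mul_linForm_sq (hn : n ≠ 0) (i j : Fin n) (v : Fin n → ℝ) :
    ((n : ℝ) * (n + 2)) * ∫ x, x i * x j * linForm v x ^ 2 ∂sphereMeasure n =
      ((∑ l, v l ^ 2) * (if i = j then 1 else 0) + 2 * (v i * v j)) *
        (sphereMeasure n).real Set.univ := by
  have hv := contDiff_linForm v
  have hc := hv.continuous
  have h := integral_coord_mul hn i ((contDiff_coord j).mul (hv.mul hv)) (1 + (1 + 1))
    (sum_coord_mul_pd_mul (contDiff_coord j) (hv.mul hv) (sum_coord_mul_pd_coord j)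
      (sum_coord_mul_pd_mul hv hv (sum_coord_mul_pd_linForm v) (sum_coord_mul_pd_linForm v)))
  have h1 : ∀ x, pd n i (fun x ↦ x j * (linForm v x * linForm v x)) x =
      (if i = j then 1 else 0) * (linForm v x * linForm v x) + 2 * v i * (x j * linForm v x) := by
    intro x
    rw [pd_mul _ (contDiff_coord j) (hv.mul hv), pd_mul _ hv hv, pd_coord, pd_linForm]
    ring
  simp only [h1] at h
  rw [integral_add (integrable_sphereMeasure hn (by fun_prop))
    (integrable_sphereMeasure hn (by fun_prop)), integral_const_mul, integral_const_mul] at h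
  have h2 : ∀ x : EuclideanSpace ℝ (Fin n), x i * x j * linForm v x ^ 2 =
      x i * (x j * (linForm v x * linForm v x)) := fun x ↦ by ring
  simp only [h2, sq (v _)]
  linear_combination n * h + (if i = j then 1 else 0) * integral_linForm_mul_linForm hn v v +
    2 * v i * integral_coord_mul_linForm hn j v

lemma integral_quadForm (hn : n ≠ 0) {A : Fin n → Fin n → ℝ} (hA : ∑ k, A k k = 0) :
    ∫ x, quadForm A x ∂sphereMeasure n = 0 := by
  have h : ∫ x, quadForm A x ∂sphereMeasure n =
      ∑ k, ∫ x, x k * linForm (A k) x ∂sphereMeasure n := by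
    rw [← integral_finsetSum _ fun l _ ↦ integrable_sphereMeasure hn (by
      have := (contDiff_linForm (A l)).continuous
      fun_prop)]
    refine integral_congr_ae (Eventually.of_forall fun x ↦ ?_)
    simp only [linForm, quadForm, Finset.mul_sum]
    refine Finset.sum_congr rfl fun b _ ↦ Finset.sum_congr rfl fun l _ ↦ ?_
    ring
  have hn' : (n : ℝ) ≠ 0 := Nat.cast_ne_zero.2 hn
  refine (mul_eq_zero.1 ?_).resolve_left hn'
  rw [h, Finset.mul_sum]
  simp only [integral_coord_mul_linForm hn]
  rw [← Finset.sum_mul, hA, zero_mul]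

/-- `∫ x_j ℓ Q` for a trace-free quadratic form `Q` and a linear form `ℓ`. -/
lemma integral_coord_mul_quadForm_mul_linForm (hn : n ≠ 0) {A : Fin n → Fin n → ℝ}
    (hA : ∑ k, A k k = 0) (j : Fin n) (v : Fin n → ℝ) :
    ((n : ℝ) * (n + 2)) * ∫ x, x j * (quadForm A x * linForm v x) ∂sphereMeasure n =
      (∑ l, (A j l + A l j) * v l) * (sphereMeasure n).real Set.univ := by
  have hv := contDiff_linForm v
  have hq := contDiff_quadForm A
  have hcv := hv.continuous
  have hcq := hq.continuous
  have hcl := (contDiff_linForm fun l ↦ A j l + A l j).continuous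
  have h := integral_coord_mul hn j (hq.mul hv) (2 + 1)
    (sum_coord_mul_pd_mul hq hv (sum_coord_mul_pd_quadForm A) (sum_coord_mul_pd_linForm v))
  simp only [pd_mul _ hq hv, pd_quadForm, pd_linForm] at h
  rw [integral_add (integrable_sphereMeasure hn (by fun_prop))
    (integrable_sphereMeasure hn (by fun_prop)), integral_mul_const, integral_quadForm hn hA] at h
  linear_combination n * h + integral_linForm_mul_linForm hn (fun l ↦ A j l + A l j) v

lemma integral_quadForm_sq (hn : n ≠ 0) {A : Fin n → Fin n → ℝ} (hA : ∑ k, A k k = 0) :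
    (2 * (n : ℝ) * (n + 2)) * ∫ x, quadForm A x ^ 2 ∂sphereMeasure n =
      (∑ k, ∑ l, (A k l + A l k) ^ 2) * (sphereMeasure n).real Set.univ := by
  have h : 2 * ∫ x, quadForm A x ^ 2 ∂sphereMeasure n =
      ∑ k, ∫ x, x k * (quadForm A x * linForm (fun l ↦ A k l + A l k) x) ∂sphereMeasure n := by
    rw [← integral_finsetSum _ fun l _ ↦ integrable_sphereMeasure hn (by
      have := (contDiff_linForm fun k ↦ A l k + A k l).continuous
      have := (contDiff_quadForm A).continuous
      fun_prop), ← integral_const_mul]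
    refine integral_congr_ae (Eventually.of_forall fun x ↦ ?_)
    dsimp only
    rw [sq, ← mul_assoc, ← sum_coord_mul_linForm, Finset.sum_mul]
    exact Finset.sum_congr rfl fun b _ ↦ by ring
  have h2 : (2 * (n : ℝ) * (n + 2)) * ∫ x, quadForm A x ^ 2 ∂sphereMeasure n =
      (n : ℝ) * (n + 2) * (2 * ∫ x, quadForm A x ^ 2 ∂sphereMeasure n) := by ring
  rw [h2, h, Finset.mul_sum, Finset.sum_mul]
  simp only [integral_coord_mul_quadForm_mul_linForm hn hA, sq]

/-- `∫ x_i x_j Q²` for a trace-free quadratic form `Q`. -/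
lemma integral_coord_mul_coord_mul_quadForm_sq (hn : n ≠ 0) {A : Fin n → Fin n → ℝ}
    (hA : ∑ k, A k k = 0) (i j : Fin n) :
    ((n : ℝ) * (n + 2) * (n + 4)) * ∫ x, x i * x j * quadForm A x ^ 2 ∂sphereMeasure n =
      ((∑ k, ∑ l, (A k l + A l k) ^ 2) / 2 * (if i = j then 1 else 0) +
        2 * ∑ l, (A i l + A l i) * (A j l + A l j)) * (sphereMeasure n).real Set.univ := by
  have hq := contDiff_quadForm A
  have hcq := hq.continuous
  have hcl := (contDiff_linForm fun l ↦ A i l + A l i).continuous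
  have h := integral_coord_mul hn i ((contDiff_coord j).mul (hq.mul hq)) (1 + (2 + 2))
    (sum_coord_mul_pd_mul (contDiff_coord j) (hq.mul hq) (sum_coord_mul_pd_coord j)
      (sum_coord_mul_pd_mul hq hq (sum_coord_mul_pd_quadForm A) (sum_coord_mul_pd_quadForm A)))
  have h1 : ∀ x, pd n i (fun x ↦ x j * (quadForm A x * quadForm A x)) x =
      (if i = j then 1 else 0) * quadForm A x ^ 2 +
        2 * (x j * (quadForm A x * linForm (fun l ↦ A i l + A l i) x)) := by
    intro x
    rw [pd_mul _ (contDiff_coord j) (hq.mul hq), pd_mul _ hq hq, pd_coord, pd_quadForm]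
    ring
  simp only [h1] at h
  rw [integral_add (integrable_sphereMeasure hn (by fun_prop))
    (integrable_sphereMeasure hn (by fun_prop)), integral_const_mul, integral_const_mul] at h
  have h2 : ∀ x : EuclideanSpace ℝ (Fin n), x i * x j * quadForm A x ^ 2 =
      x i * (x j * (quadForm A x * quadForm A x)) := fun x ↦ by ring
  have h3 : ∑ l, (A i l + A l i) * (A j l + A l j) = ∑ l, (A j l + A l j) * (A i l + A l i) :=
    Finset.sum_congr rfl fun l _ ↦ mul_comm _ _
  simp only [h2]
  rw [h3]
  linear_combination (n : ℝ) * (n + 2) * h +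
    (if i = j then 1 else 0) / 2 * integral_quadForm_sq hn hA +
    2 * integral_coord_mul_quadForm_mul_linForm hn hA j fun l ↦ A i l + A l i

end Moments

theorem stmt_11 (n : ℕ) (hn : 2 ≤ n) (W4 : Fin n → Fin n → Fin n → Fin n → ℝ)
    (hanti1 : ∀ i j k l, W4 i j k l = -W4 j i k l)
    (hanti2 : ∀ i j k l, W4 i j k l = -W4 i j l k)
    (hsymm : ∀ i j k l, W4 i j k l = W4 k l i j)
    (hbianchi : ∀ i j k l, W4 i j k l + W4 i k l j + W4 i l j k = 0)
    (htrace : ∀ j k, ∑ i, W4 i j i k = 0) :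
    ∀ i j : Fin n,
      (∑ p, ∑ q, ∫ x in Metric.sphere (0 : EuclideanSpace ℝ (Fin n)) 1,
          x i * x j * (Hten n W4 p q x) ^ 2 ∂μH[(n : ℝ) - 1]) =
        (μH[(n : ℝ) - 1] (Metric.sphere (0 : EuclideanSpace ℝ (Fin n)) 1)).toReal /
            (2 * (n : ℝ) * ((n : ℝ) + 2) * ((n : ℝ) + 4)) * normWsq n W4 *
            (if i = j then 1 else 0) +
          2 * (μH[(n : ℝ) - 1] (Metric.sphere (0 : EuclideanSpace ℝ (Fin n)) 1)).toReal /
            ((n : ℝ) * ((n : ℝ) + 2) * ((n : ℝ) + 4)) * Wtil n W4 i j ∧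
      (∑ k, ∑ p, ∑ q, ∫ x in Metric.sphere (0 : EuclideanSpace ℝ (Fin n)) 1,
          x i * x j * (pd n k (Hten n W4 p q) x) ^ 2 ∂μH[(n : ℝ) - 1]) =
        (μH[(n : ℝ) - 1] (Metric.sphere (0 : EuclideanSpace ℝ (Fin n)) 1)).toReal /
            ((n : ℝ) * ((n : ℝ) + 2)) * normWsq n W4 * (if i = j then 1 else 0) +
          2 * (μH[(n : ℝ) - 1] (Metric.sphere (0 : EuclideanSpace ℝ (Fin n)) 1)).toReal /
            ((n : ℝ) * ((n : ℝ) + 2)) * Wtil n W4 i j := by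
  intro i j
  have hn0 : n ≠ 0 := by omega
  have hnr : (n : ℝ) ≠ 0 := Nat.cast_ne_zero.2 hn0
  have hn2 : (n : ℝ) + 2 ≠ 0 := by positivity
  have hn4 : (n : ℝ) + 4 ≠ 0 := by positivity
  have hσ : (μH[(n : ℝ) - 1] (Metric.sphere (0 : EuclideanSpace ℝ (Fin n)) 1)).toReal =
      (sphereMeasure n).real Set.univ := by
    simp [sphereMeasure, Measure.real]
  have hH : ∀ p q, Hten n W4 p q = quadForm fun k l ↦ W4 p k q l := fun _ _ ↦ rfl
  have htr : ∀ p q, ∑ k, W4 p k q k = 0 := fun p q ↦ by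
    rw [← htrace p q]
    refine Finset.sum_congr rfl fun k _ ↦ ?_
    rw [hanti1, hanti2, neg_neg]
  have hW : Wtil n W4 i j = ∑ p, ∑ q, ∑ l,
      (W4 p i q l + W4 p l q i) * (W4 p j q l + W4 p l q j) := by
    refine Finset.sum_congr rfl fun p _ ↦ Finset.sum_congr rfl fun q _ ↦
      Finset.sum_congr rfl fun l _ ↦ ?_
    rw [hanti1 p i, hanti2 p l q i, hanti1 p j, hanti2 p l q j]
    ring
  rw [hσ]
  set σ := (sphereMeasure n).real Set.univ
  constructor
  · have h : ∀ p q, ∫ x in Metric.sphere (0 : EuclideanSpace ℝ (Fin n)) 1,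
        x i * x j * (Hten n W4 p q x) ^ 2 ∂μH[(n : ℝ) - 1] =
        σ / (2 * n * (n + 2) * (n + 4)) *
            (∑ k, ∑ l, (W4 p k q l + W4 p l q k) ^ 2) * (if i = j then 1 else 0) +
          2 * σ / (n * (n + 2) * (n + 4)) *
            ∑ l, (W4 p i q l + W4 p l q i) * (W4 p j q l + W4 p l q j) := by
      intro p q
      have h := integral_coord_mul_coord_mul_quadForm_sq hn0 (htr p q) i j
      rw [← hH] at h
      refine mul_left_cancel₀ (mul_ne_zero (mul_ne_zero hnr hn2) hn4) (h.trans ?_)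
      field_simp
      ring
    simp only [h, Finset.sum_add_distrib, ← Finset.mul_sum, ← Finset.sum_mul, hW]
    rfl
  · have h : ∀ k p q, ∫ x in Metric.sphere (0 : EuclideanSpace ℝ (Fin n)) 1,
        x i * x j * (pd n k (Hten n W4 p q) x) ^ 2 ∂μH[(n : ℝ) - 1] =
        σ / (n * (n + 2)) *
            (∑ l, (W4 p k q l + W4 p l q k) ^ 2) * (if i = j then 1 else 0) +
          2 * σ / (n * (n + 2)) *
            ((W4 p i q k + W4 p k q i) * (W4 p j q k + W4 p k q j)) := by
      intro k p q
      simp only [hH, pd_quadForm]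
      have h := integral_coord_mul_coord_mul_linForm_sq hn0 i j
        fun l ↦ W4 p k q l + W4 p l q k
      refine mul_left_cancel₀ (mul_ne_zero hnr hn2) (h.trans ?_)
      field_simp
      ring
    have hcomm : ∀ F : Fin n → Fin n → Fin n → ℝ,
        ∑ k, ∑ p, ∑ q, F k p q = ∑ p, ∑ q, ∑ k, F k p q := fun F ↦ by
      rw [Finset.sum_comm]
      exact Finset.sum_congr rfl fun p _ ↦ Finset.sum_comm
    simp only [h]
    rw [hcomm]
    simp only [Finset.sum_add_distrib, ← Finset.mul_sum, ← Finset.sum_mul, hW]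
    rfl

end
end
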